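/- arXiv:2407.06588 — 3 statements merged into one kernel-verified Lean document; each statement's English description precedes it below -/
import Mathlib

section
/- Let d, e ≥ 1 be integers and let g : Dᵈ → Dᵈ be a continuous map with g(S^{d-1}) ⊆ S^{d-1} such that the induced homomorphism (g|_{S^{d-1}})_* : H̃_{d-1}(S^{d-1}) → H̃_{d-1}(S^{d-1}) on reduced singular homology with integer coefficients is nonzero. Then the map F = g × id_{Dᵉ} : Dᵈ × Dᵉ → Dᵈ × Dᵉ maps ∂(Dᵈ × Dᵉ) = (S^{d-1} × Dᵉ) ∪ (Dᵈ × S^{e-1}) into itself, and the induced homomorphism F_* : H̃_{d+e-1}(∂(Dᵈ × Dᵉ)) → H̃_{d+e-1}(∂(Dᵈ × Dᵉ)) is injective; in particular it is nonzero. -/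
open CategoryTheory

/-- The singular chain complex functor with `ℤ` coefficients. -/
noncomputable def singularChains : TopCat.{0} ⥤ ChainComplex (ModuleCat.{0} ℤ) ℕ :=
  TopCat.toSSet ⋙ ((SimplicialObject.whiskering _ _).obj (ModuleCat.free ℤ)) ⋙
    AlgebraicTopology.alternatingFaceMapComplex (ModuleCat ℤ)

/-- Singular homology with `ℤ` coefficients as a functor. -/
noncomputable def SH (n : ℕ) : TopCat.{0} ⥤ ModuleCat.{0} ℤ :=
  singularChains ⋙ HomologicalComplex.homologyFunctor _ _ n

/-- The map on singular homology induced by a continuous map. -/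
noncomputable def SHmap (n : ℕ) {X Y : Type} [TopologicalSpace X] [TopologicalSpace Y]
    (f : C(X, Y)) : (SH n).obj (TopCat.of X) ⟶ (SH n).obj (TopCat.of Y) :=
  (SH n).map (X := TopCat.of X) (Y := TopCat.of Y) (TopCat.ofHom f)

/-- Reduced singular homology in degree `n`, i.e. the kernel (here, as a set) of the map induced
on singular homology by the map to a one-point space.  A map `f` induces a group homomorphism
between the reduced homology groups, namely the restriction of `SHmap n f`. -/
noncomputable def reducedSH (n : ℕ) (X : Type) [TopologicalSpace X] :
    Set ((SH n).obj (TopCat.of X)) :=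
  {x | SHmap n (ContinuousMap.const X (PUnit.unit : PUnit.{1})) x = 0}

/-- The homomorphism induced by `f` between reduced singular homology groups in degree `n`
is nonzero.  (The induced map automatically sends reduced homology into reduced homology, so
this says exactly that the restriction of `SHmap n f` to the reduced homology is nonzero.) -/
noncomputable def SHmapNontrivial (n : ℕ) {X Y : Type} [TopologicalSpace X]
    [TopologicalSpace Y] (f : C(X, Y)) : Prop :=
  ∃ x ∈ reducedSH n X, SHmap n f x ≠ 0

/-- The restriction of a continuous map to a continuous map between subspaces. -/
def restrictCM {X Y : Type} [TopologicalSpace X] [TopologicalSpace Y] (f : C(X, Y))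
    {s : Set X} {t : Set Y} (h : Set.MapsTo f s t) : C(s, t) :=
  ⟨h.restrict f s t, f.continuous.restrict h⟩

/-- The closed unit ball in `ℝᵈ`. -/
abbrev unitBall (d : ℕ) : Set (EuclideanSpace ℝ (Fin d)) := Metric.closedBall 0 1

/-- A structure of a `d`-dimensional closed ball on a topological space `D`:
a homeomorphism from the closed unit ball of `ℝᵈ` to `D`. -/
structure BallStructure (d : ℕ) (D : Type) [TopologicalSpace D] where
  φ : unitBall d ≃ₜ D

/-- The boundary sphere of a space with a `d`-ball structure. -/
def BallStructure.boundary {d : ℕ} {D : Type} [TopologicalSpace D]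
    (B : BallStructure d D) : Set D :=
  B.φ '' {x : unitBall d | ‖(x : EuclideanSpace ℝ (Fin d))‖ = 1}

/-- A continuous map between spaces with `d`-ball structures is `d`-nontrivial if either `d = 0`,
or `d > 0`, `h` maps the boundary into the boundary, and the induced homomorphism between the
reduced singular homology groups (with `ℤ` coefficients) of the boundaries in degree `d - 1`
is nonzero. -/
noncomputable def DNontrivial (d : ℕ) {D₁ D₂ : Type} [TopologicalSpace D₁] [TopologicalSpace D₂]
    (B₁ : BallStructure d D₁) (B₂ : BallStructure d D₂) (h : C(D₁, D₂)) : Prop :=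
  d = 0 ∨ (0 < d ∧ ∃ hb : Set.MapsTo h B₁.boundary B₂.boundary,
    SHmapNontrivial (d - 1) (restrictCM h hb))

/-- The boundary sphere of the closed unit ball of `ℝᵈ`, as a subset of the ball. -/
def unitSpherePart (d : ℕ) : Set (unitBall d) :=
  {x : unitBall d | ‖(x : EuclideanSpace ℝ (Fin d))‖ = 1}

/-! ### Formal affine chains -/

/-- Formal chains on ordered `n`-tuples of points of `K` (augmented: `n = 0` is allowed). -/
abbrev TupleChain (n : ℕ) (K : Type) := (Fin n → K) →₀ ℤ

namespace TupleChain

variable {K K' : Type} {n : ℕ}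

/-- The alternating sum of the faces of a tuple. -/
noncomputable def bd (n : ℕ) (K : Type) : TupleChain (n + 1) K →ₗ[ℤ] TupleChain n K :=
  Finsupp.linearCombination ℤ fun v =>
    ∑ i : Fin (n + 1), (-1 : ℤ) ^ (i : ℕ) • Finsupp.single (v ∘ i.succAbove) 1

/-- The cone operator with apex `b`. -/
noncomputable def cone (b : K) (n : ℕ) : TupleChain n K →ₗ[ℤ] TupleChain (n + 1) K :=
  Finsupp.lmapDomain ℤ ℤ fun v => Fin.cons b v

/-- The map induced on formal chains by a map of points. -/
noncomputable def map (f : K → K') (n : ℕ) : TupleChain n K →ₗ[ℤ] TupleChain n K' :=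
  Finsupp.lmapDomain ℤ ℤ fun v => f ∘ v

@[simp] lemma bd_single (v : Fin (n + 1) → K) :
    bd n K (Finsupp.single v 1) =
      ∑ i : Fin (n + 1), (-1 : ℤ) ^ (i : ℕ) • Finsupp.single (v ∘ i.succAbove) 1 := by
  simp [bd]

@[simp] lemma cone_single (b : K) (v : Fin n → K) :
    cone b n (Finsupp.single v 1) = Finsupp.single (Fin.cons b v) 1 := by
  simp [cone]

@[simp] lemma map_single (f : K → K') (v : Fin n → K) :
    map f n (Finsupp.single v 1) = Finsupp.single (f ∘ v) 1 := by
  simp [map]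

lemma map_bd (f : K → K') (c : TupleChain (n + 1) K) :
    map f n (bd n K c) = bd n K' (map f (n + 1) c) := by
  have : map f n ∘ₗ bd n K = bd n K' ∘ₗ map f (n + 1) := by
    ext v : 2
    simp only [LinearMap.comp_apply, Finsupp.lsingle_apply, map_single, bd_single, map_sum,
      map_zsmul, Function.comp_assoc]
  exact congr($this c)

lemma map_cone (f : K → K') (b : K) (c : TupleChain n K) :
    map f (n + 1) (cone b n c) = cone (f b) n (map f n c) := by
  have : map f (n + 1) ∘ₗ cone b n = cone (f b) n ∘ₗ map f n := by
    ext v : 2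
    simp only [LinearMap.comp_apply, Finsupp.lsingle_apply, cone_single, map_single]
    congr 1
    exact Fin.comp_cons f b v
  exact congr($this c)

lemma bd_cone_zero (b : K) (c : TupleChain 0 K) : bd 0 K (cone b 0 c) = c := by
  have : bd 0 K ∘ₗ cone b 0 = LinearMap.id := by
    ext v : 2
    simp [Subsingleton.elim _ v]
  exact congr($this c)

lemma bd_cone_succ (b : K) (c : TupleChain (n + 1) K) :
    bd (n + 1) K (cone b (n + 1) c) = c - cone b n (bd n K c) := by
  have : bd (n + 1) K ∘ₗ cone b (n + 1) = LinearMap.id - cone b n ∘ₗ bd n K := by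
    ext v : 2
    simp only [LinearMap.comp_apply, Finsupp.lsingle_apply, cone_single, bd_single,
      LinearMap.sub_apply, LinearMap.id_apply, map_sum, map_zsmul]
    rw [Fin.sum_univ_succ, sub_eq_add_neg, ← Finset.sum_neg_distrib]
    congr 1
    · simp only [Fin.val_zero, pow_zero, one_smul]
      congr 1
    · refine Finset.sum_congr rfl fun i _ => ?_
      rw [Fin.val_succ, pow_succ, mul_neg_one, neg_smul]
      congr 3
      funext j
      refine Fin.cases ?_ (fun j => ?_) j <;> simp
  exact congr($this c)

lemma bd_bd : ∀ {n : ℕ} (c : TupleChain (n + 2) K), bd n K (bd (n + 1) K c) = 0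
  | n, c => by
    have : bd n K ∘ₗ bd (n + 1) K = 0 := by
      ext v : 2
      have hv : Finsupp.single v (1 : ℤ) = cone (v 0) _ (Finsupp.single (Fin.tail v) 1) := by
        simp
      simp only [LinearMap.comp_apply, Finsupp.lsingle_apply, LinearMap.zero_apply]
      rw [hv, bd_cone_succ, map_sub]
      cases n with
      | zero => rw [bd_cone_zero, sub_self]
      | succ n => rw [bd_cone_succ, bd_bd, map_zero, sub_zero, sub_self]
    exact congr($this c)

variable (β : ∀ n : ℕ, (Fin (n + 1) → K) → K)

/-- Subdivision of formal chains, with respect to a choice `β` of centres. -/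
noncomputable def sd : ∀ n : ℕ, TupleChain n K →ₗ[ℤ] TupleChain n K
  | 0 => LinearMap.id
  | n + 1 => Finsupp.linearCombination ℤ fun v =>
      cone (β n v) n (sd n (bd n K (Finsupp.single v 1)))

/-- The homotopy between the identity and the subdivision. -/
noncomputable def sdHomotopy : ∀ n : ℕ, TupleChain n K →ₗ[ℤ] TupleChain (n + 1) K
  | 0 => 0
  | n + 1 => Finsupp.linearCombination ℤ fun v =>
      cone (β n v) (n + 1)
        (Finsupp.single v 1 - sdHomotopy n (bd n K (Finsupp.single v 1)))

lemma sd_single (v : Fin (n + 1) → K) :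
    sd β (n + 1) (Finsupp.single v 1) = cone (β n v) n (sd β n (bd n K (Finsupp.single v 1))) := by
  simp [sd]

lemma sdHomotopy_single (v : Fin (n + 1) → K) :
    sdHomotopy β (n + 1) (Finsupp.single v 1) = cone (β n v) (n + 1)
      (Finsupp.single v 1 - sdHomotopy β n (bd n K (Finsupp.single v 1))) := by
  simp [sdHomotopy]

lemma bd_sd : ∀ {n : ℕ} (c : TupleChain (n + 1) K),
    bd n K (sd β (n + 1) c) = sd β n (bd n K c)
  | n, c => by
    have : bd n K ∘ₗ sd β (n + 1) = sd β n ∘ₗ bd n K := by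
      ext v : 2
      simp only [LinearMap.comp_apply, Finsupp.lsingle_apply]
      rw [sd_single]
      cases n with
      | zero => rw [bd_cone_zero]
      | succ n => rw [bd_cone_succ, bd_sd, bd_bd, map_zero, map_zero, sub_zero]
    exact congr($this c)

lemma bd_sdHomotopy : ∀ {n : ℕ} (c : TupleChain (n + 1) K),
    bd (n + 1) K (sdHomotopy β (n + 1) c) = c - sd β (n + 1) c - sdHomotopy β n (bd n K c)
  | n, c => by
    have : bd (n + 1) K ∘ₗ sdHomotopy β (n + 1) =
        LinearMap.id - sd β (n + 1) - sdHomotopy β n ∘ₗ bd n K := by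
      ext v : 2
      simp only [LinearMap.comp_apply, Finsupp.lsingle_apply, LinearMap.sub_apply,
        LinearMap.id_apply]
      rw [sdHomotopy_single, bd_cone_succ, map_sub, sd_single, sub_right_comm]
      congr 2
      cases n with
      | zero => simp [sdHomotopy, sd]
      | succ n => rw [bd_sdHomotopy, bd_bd, map_zero, sub_zero, sub_sub_cancel]
    exact congr($this c)

variable {β} {β' : ∀ n : ℕ, (Fin (n + 1) → K') → K'} {f : K → K'}

lemma map_sd (hf : ∀ n v, f (β n v) = β' n (f ∘ v)) :
    ∀ {n : ℕ} (c : TupleChain n K), map f n (sd β n c) = sd β' n (map f n c)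
  | 0, c => rfl
  | n + 1, c => by
    have : map f (n + 1) ∘ₗ sd β (n + 1) = sd β' (n + 1) ∘ₗ map f (n + 1) := by
      ext v : 2
      simp only [LinearMap.comp_apply, Finsupp.lsingle_apply]
      rw [sd_single, map_cone, map_sd hf, map_bd, map_single, sd_single, hf]
    exact congr($this c)

lemma map_sdHomotopy (hf : ∀ n v, f (β n v) = β' n (f ∘ v)) :
    ∀ {n : ℕ} (c : TupleChain n K),
      map f (n + 1) (sdHomotopy β n c) = sdHomotopy β' n (map f n c)
  | 0, c => by simp [sdHomotopy]
  | n + 1, c => by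
    have : map f (n + 2) ∘ₗ sdHomotopy β (n + 1) =
        sdHomotopy β' (n + 1) ∘ₗ map f (n + 1) := by
      ext v : 2
      simp only [LinearMap.comp_apply, Finsupp.lsingle_apply]
      rw [sdHomotopy_single, map_cone, map_sub, map_sdHomotopy hf, map_bd, map_single,
        sdHomotopy_single, hf]
    exact congr($this c)

end TupleChain

/-! ### Mesh of the iterated subdivision -/

lemma Finsupp.map_mem_of_mem_supported {α M : Type*} [AddCommGroup M] {S : Set α}
    {f : (α →₀ ℤ) →ₗ[ℤ] M} {P : Submodule ℤ M} (h : ∀ a ∈ S, f (Finsupp.single a 1) ∈ P)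
    {c : α →₀ ℤ} (hc : c ∈ Finsupp.supported ℤ ℤ S) : f c ∈ P := by
  rw [Finsupp.supported_eq_span_single] at hc
  have : Submodule.span ℤ ((fun i => Finsupp.single i (1 : ℤ)) '' S) ≤ P.comap f :=
    Submodule.span_le.2 (by rintro _ ⟨a, ha, rfl⟩; exact h a ha)
  exact this hc

namespace TupleChain

variable {K : Type} {β : ∀ n : ℕ, (Fin (n + 1) → K) → K}

lemma cone_mem_supported {n : ℕ} {b : K} {S : Set (Fin n → K)} {T : Set (Fin (n + 1) → K)}
    (h : ∀ w ∈ S, Fin.cons b w ∈ T) {c : TupleChain n K}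
    (hc : c ∈ Finsupp.supported ℤ ℤ S) : cone b n c ∈ Finsupp.supported ℤ ℤ T :=
  Finsupp.map_mem_of_mem_supported (fun w hw => by
    rw [cone_single]; exact Finsupp.single_mem_supported _ _ (h w hw)) hc

variable [PseudoMetricSpace K]

lemma sd_single_mem_supported
    (h₁ : ∀ n (v : Fin (n + 1) → K) x r, (∀ j, dist x (v j) ≤ r) → dist x (β n v) ≤ r)
    (h₂ : ∀ n (v : Fin (n + 1) → K) D j, (∀ i j, dist (v i) (v j) ≤ D) →
      dist (v j) (β n v) ≤ n / (n + 1) * D) (N : ℕ) :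
    ∀ {n : ℕ}, n ≤ N + 1 → ∀ (v : Fin n → K) (D : ℝ), (∀ i j, dist (v i) (v j) ≤ D) →
      sd β n (Finsupp.single v 1) ∈ Finsupp.supported ℤ ℤ
        {w | (∀ x r, (∀ j, dist x (v j) ≤ r) → ∀ i, dist x (w i) ≤ r) ∧
          ∀ i j, dist (w i) (w j) ≤ N / (N + 1) * D}
  | 0, _, v, D, hD => Finsupp.single_mem_supported _ _ ⟨fun _ _ _ i => i.elim0, fun i => i.elim0⟩
  | n + 1, hn, v, D, hD => by
    have hD0 : 0 ≤ D := dist_nonneg.trans (hD 0 0)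
    have hq : (n : ℝ) / (n + 1) * D ≤ N / (N + 1) * D := by
      refine mul_le_mul_of_nonneg_right ?_ hD0
      rw [div_le_div_iff₀ (by positivity) (by positivity)]
      have : (n : ℝ) ≤ N := by exact_mod_cast Nat.succ_le_succ_iff.1 hn
      nlinarith
    rw [sd_single, bd_single, map_sum]
    refine cone_mem_supported (S := {w | (∀ x r, (∀ j, dist x (v j) ≤ r) →
      ∀ i, dist x (w i) ≤ r) ∧ ∀ i j, dist (w i) (w j) ≤ N / (N + 1) * D}) ?_ ?_
    · rintro w ⟨hw₁, hw₂⟩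
      have hb : ∀ i, dist (β n v) (w i) ≤ N / (N + 1) * D := fun i =>
        (hw₁ _ _ (fun j => by rw [dist_comm]; exact h₂ n v D j hD) i).trans hq
      refine ⟨fun x r hx i => ?_, fun i j => ?_⟩
      · refine Fin.cases ?_ (fun i => ?_) i
        · simpa using h₁ n v x r hx
        · simpa using hw₁ x r hx i
      · refine Fin.cases ?_ (fun i => ?_) i <;> refine Fin.cases ?_ (fun j => ?_) j
        · simp only [dist_self]; positivity
        · simpa using hb j
        · simpa [dist_comm] using hb i
        · simpa using hw₂ i j
    · refine Submodule.sum_mem _ fun k _ => ?_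
      rw [map_zsmul]
      refine Submodule.smul_mem _ _ (Finsupp.supported_mono ?_
        (sd_single_mem_supported h₁ h₂ N (Nat.le_of_succ_le hn) (v ∘ k.succAbove) D
          fun i j => hD _ _))
      rintro w ⟨hw₁, hw₂⟩
      exact ⟨fun x r hx => hw₁ x r fun j => hx _, hw₂⟩

lemma sd_pow_single_mem_supported
    (h₁ : ∀ n (v : Fin (n + 1) → K) x r, (∀ j, dist x (v j) ≤ r) → dist x (β n v) ≤ r)
    (h₂ : ∀ n (v : Fin (n + 1) → K) D j, (∀ i j, dist (v i) (v j) ≤ D) →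
      dist (v j) (β n v) ≤ n / (n + 1) * D) (N : ℕ) (v : Fin N → K) (D : ℝ)
    (hD : ∀ i j, dist (v i) (v j) ≤ D) (k : ℕ) :
    (sd β N ^ k) (Finsupp.single v 1) ∈ Finsupp.supported ℤ ℤ
        {w | ∀ i j, dist (w i) (w j) ≤ (N / (N + 1)) ^ k * D} := by
  induction k with
  | zero => simpa using Finsupp.single_mem_supported _ _ (by simpa using hD)
  | succ k ih =>
    rw [pow_succ' (sd β N), Module.End.mul_apply]
    refine Finsupp.map_mem_of_mem_supported (fun w hw => ?_) ih
    refine Finsupp.supported_mono ?_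
      (sd_single_mem_supported h₁ h₂ N (Nat.le_succ N) w _ hw)
    rintro u ⟨-, hu⟩ i j
    rw [pow_succ', mul_assoc]
    exact hu i j

end TupleChain

/-! ### Affine simplices in a standard simplex -/

/-- The topological simplex with `n` vertices (empty for `n = 0`). -/
abbrev Simp (n : ℕ) : Type := stdSimplex ℝ (Fin n)

namespace Simp

variable {n m k : ℕ}

/-- The inclusion of the face opposite to the vertex `i`. -/
noncomputable def face (i : Fin (n + 1)) : C(Simp n, Simp (n + 1)) :=
  ⟨stdSimplex.map i.succAbove, stdSimplex.continuous_map _⟩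

/-- The affine simplex with given vertices. -/
noncomputable def aff (v : Fin n → Simp m) : C(Simp n, Simp m) where
  toFun t := ⟨∑ i, t.1 i • (v i).1, (convex_stdSimplex ℝ (Fin m)).sum_mem
    (fun i _ => t.2.1 i) t.2.2 fun i _ => (v i).2⟩
  continuous_toFun := Continuous.subtype_mk (continuous_finsetSum _ fun i _ =>
    ((continuous_apply i).comp continuous_subtype_val).smul continuous_const) _

lemma aff_coe (v : Fin n → Simp m) (t : Simp n) :
    (aff v t).1 = Fintype.linearCombination ℝ (fun i => (v i).1) t.1 := rfl

lemma aff_map (v : Fin k → Simp m) (f : Fin n → Fin k) (t : Simp n) :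
    aff v (stdSimplex.map f t) = aff (v ∘ f) t := by
  have : Fintype.linearCombination ℝ (fun i => (v i).1) ∘ₗ FunOnFinite.linearMap ℝ ℝ f =
      Fintype.linearCombination ℝ (fun i => ((v ∘ f) i).1) := by
    refine LinearMap.pi_ext' fun i => LinearMap.ext_ring ?_
    simp [Fintype.linearCombination_apply_single]
  exact Subtype.ext congr($this t.1)

lemma aff_comp_face (v : Fin (n + 1) → Simp m) (i : Fin (n + 1)) :
    (aff v).comp (face i) = aff (v ∘ i.succAbove) :=
  ContinuousMap.ext fun t => aff_map v _ t

lemma aff_aff (w : Fin k → Simp m) (v : Fin n → Simp k) (t : Simp n) :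
    aff w (aff v t) = aff (aff w ∘ v) t := by
  refine Subtype.ext ?_
  rw [aff_coe, aff_coe, aff_coe, Fintype.linearCombination_apply ℝ (fun i => (v i).1), map_sum]
  simp [Fintype.linearCombination_apply, aff]

lemma aff_comp_aff (w : Fin k → Simp m) (v : Fin n → Simp k) :
    (aff w).comp (aff v) = aff (aff w ∘ v) :=
  ContinuousMap.ext fun t => aff_aff w v t

lemma aff_vertex (v : Fin n → Simp m) (i : Fin n) : aff v (stdSimplex.vertex i) = v i :=
  Subtype.ext (by rw [aff_coe]; simp)

lemma aff_id : aff (fun i : Fin n => stdSimplex.vertex i) = ContinuousMap.id (Simp n) := by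
  refine ContinuousMap.ext fun t => Subtype.ext ?_
  ext j
  simp [aff, Pi.single_apply]

/-- The barycenter of a tuple. -/
noncomputable def bary (n : ℕ) (v : Fin (n + 1) → Simp m) : Simp m :=
  aff v stdSimplex.barycenter

lemma aff_bary (w : Fin k → Simp m) (n : ℕ) (v : Fin (n + 1) → Simp k) :
    aff w (bary n v) = bary n (aff w ∘ v) :=
  aff_aff _ _ _

lemma dist_aff_le (v : Fin n → Simp m) (t : Simp n) (x : Simp m) (r : ℝ)
    (h : ∀ j, dist x (v j) ≤ r) : dist x (aff v t) ≤ r := by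
  have := (convex_closedBall (x.1) r).sum_mem (fun i _ => t.2.1 i) t.2.2
    (fun i (_ : i ∈ Finset.univ) => show (v i).1 ∈ Metric.closedBall x.1 r by
      rw [Metric.mem_closedBall, dist_comm]; exact h i)
  rw [Metric.mem_closedBall, dist_comm] at this
  exact this

lemma dist_bary_le (n : ℕ) (v : Fin (n + 1) → Simp m) (D : ℝ) (j : Fin (n + 1))
    (h : ∀ i j, dist (v i) (v j) ≤ D) : dist (v j) (bary n v) ≤ n / (n + 1) * D := by
  have hn : (n + 1 : ℝ) ≠ 0 := by positivity
  have hb : (bary n v).1 - (v j).1 =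
      ∑ i : Fin n, (n + 1 : ℝ)⁻¹ • ((v (j.succAbove i)).1 - (v j).1) := by
    have h1 : (bary n v).1 = ∑ i, (n + 1 : ℝ)⁻¹ • (v i).1 := by
      simp [bary, aff]
    have h2 : (v j).1 = ∑ i : Fin (n + 1), (n + 1 : ℝ)⁻¹ • (v j).1 := by
      simp [← Nat.cast_smul_eq_nsmul ℝ, smul_smul, hn]
    rw [h1]
    conv_lhs => rw [h2]
    rw [← Finset.sum_sub_distrib, Fin.sum_univ_succAbove _ j, sub_self, zero_add]
    simp [smul_sub]
  have hd : dist (v j) (bary n v) = ‖(bary n v).1 - (v j).1‖ := by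
    rw [dist_comm]; exact dist_eq_norm (bary n v).1 (v j).1
  rw [hd, hb]
  refine (norm_sum_le _ _).trans ((Finset.sum_le_sum (g := fun _ => (n + 1 : ℝ)⁻¹ * D)
    fun i _ => ?_).trans ?_)
  · rw [norm_smul, Real.norm_of_nonneg (by positivity)]
    refine mul_le_mul_of_nonneg_left ?_ (by positivity)
    exact (dist_eq_norm (v (j.succAbove i)).1 (v j).1).symm.trans_le (h _ _)
  · simp [div_eq_mul_inv, mul_assoc]

end Simp

/-! ### Augmented singular chains -/

/-- Singular chains on simplices with `n` vertices, i.e. of dimension `n - 1`. -/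
abbrev SingChain (n : ℕ) (X : Type) [TopologicalSpace X] := C(Simp n, X) →₀ ℤ

namespace SingChain

variable {n k m : ℕ} {X Y Z : Type} [TopologicalSpace X] [TopologicalSpace Y] [TopologicalSpace Z]

/-- The singular boundary operator. -/
noncomputable def bd (n : ℕ) (X : Type) [TopologicalSpace X] :
    SingChain (n + 1) X →ₗ[ℤ] SingChain n X :=
  Finsupp.linearCombination ℤ fun σ =>
    ∑ i : Fin (n + 1), (-1 : ℤ) ^ (i : ℕ) • Finsupp.single (σ.comp (Simp.face i)) 1

/-- The map induced on singular chains. -/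
noncomputable def push (f : C(X, Y)) (n : ℕ) : SingChain n X →ₗ[ℤ] SingChain n Y :=
  Finsupp.lmapDomain ℤ ℤ f.comp

/-- The singular chain given by a formal affine chain. -/
noncomputable def ofTuple (n m : ℕ) : TupleChain n (Simp m) →ₗ[ℤ] SingChain n (Simp m) :=
  Finsupp.lmapDomain ℤ ℤ Simp.aff

@[simp] lemma bd_single (σ : C(Simp (n + 1), X)) : bd n X (Finsupp.single σ 1) =
    ∑ i : Fin (n + 1), (-1 : ℤ) ^ (i : ℕ) • Finsupp.single (σ.comp (Simp.face i)) 1 := by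
  simp [bd]

@[simp] lemma push_single (f : C(X, Y)) (σ : C(Simp n, X)) :
    push f n (Finsupp.single σ 1) = Finsupp.single (f.comp σ) 1 := by
  simp [push]

@[simp] lemma ofTuple_single (v : Fin n → Simp m) :
    ofTuple n m (Finsupp.single v 1) = Finsupp.single (Simp.aff v) 1 := by
  simp [ofTuple]

lemma push_comp (g : C(Y, Z)) (f : C(X, Y)) (c : SingChain n X) :
    push (g.comp f) n c = push g n (push f n c) := by
  have : push (g.comp f) n = push g n ∘ₗ push f n := by
    ext σ : 2
    simp only [LinearMap.comp_apply, Finsupp.lsingle_apply, push_single, ContinuousMap.comp_assoc]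
  exact congr($this c)

@[simp] lemma push_id (c : SingChain n X) : push (ContinuousMap.id X) n c = c := by
  have : push (ContinuousMap.id X) n = LinearMap.id := by
    ext σ : 2
    simp
  exact congr($this c)

lemma push_bd (f : C(X, Y)) (c : SingChain (n + 1) X) :
    push f n (bd n X c) = bd n Y (push f (n + 1) c) := by
  have : push f n ∘ₗ bd n X = bd n Y ∘ₗ push f (n + 1) := by
    ext σ : 2
    simp only [LinearMap.comp_apply, Finsupp.lsingle_apply, push_single, bd_single, map_sum,
      map_zsmul, ContinuousMap.comp_assoc]
  exact congr($this c)

lemma ofTuple_bd (c : TupleChain (n + 1) (Simp m)) :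
    ofTuple n m (TupleChain.bd n _ c) = bd n _ (ofTuple (n + 1) m c) := by
  have : ofTuple n m ∘ₗ TupleChain.bd n _ = bd n _ ∘ₗ ofTuple (n + 1) m := by
    ext v : 2
    simp only [LinearMap.comp_apply, Finsupp.lsingle_apply, ofTuple_single, bd_single,
      TupleChain.bd_single, map_sum, map_zsmul, Simp.aff_comp_face]
  exact congr($this c)

lemma push_aff_ofTuple (v : Fin k → Simp m) (c : TupleChain n (Simp k)) :
    push (Simp.aff v) n (ofTuple n k c) = ofTuple n m (TupleChain.map (Simp.aff v) n c) := by
  have : push (Simp.aff v) n ∘ₗ ofTuple n k = ofTuple n m ∘ₗ TupleChain.map (Simp.aff v) n := by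
    ext w : 2
    simp only [LinearMap.comp_apply, Finsupp.lsingle_apply, ofTuple_single, push_single,
      TupleChain.map_single, Simp.aff_comp_aff]
  exact congr($this c)

/-- The tautological formal simplex. -/
noncomputable def idTuple (n : ℕ) : TupleChain n (Simp n) :=
  Finsupp.single (fun i => stdSimplex.vertex i) 1

lemma ofTuple_idTuple (n : ℕ) :
    ofTuple n n (idTuple n) = Finsupp.single (ContinuousMap.id _) 1 := by
  rw [idTuple, ofTuple_single, Simp.aff_id]

lemma map_aff_idTuple (v : Fin n → Simp m) :
    TupleChain.map (Simp.aff v) n (idTuple n) = Finsupp.single v 1 := by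
  rw [idTuple, TupleChain.map_single]
  congr 1
  exact funext fun i => Simp.aff_vertex v i

/-- The natural operator on singular chains determined by a formal affine chain. -/
noncomputable def op (a : TupleChain k (Simp n)) (X : Type) [TopologicalSpace X] :
    SingChain n X →ₗ[ℤ] SingChain k X :=
  Finsupp.linearCombination ℤ fun σ => push σ k (ofTuple k n a)

lemma op_single (a : TupleChain k (Simp n)) (σ : C(Simp n, X)) :
    op a X (Finsupp.single σ 1) = push σ k (ofTuple k n a) := by
  simp [op]

lemma push_op (a : TupleChain k (Simp n)) (f : C(X, Y)) (c : SingChain n X) :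
    push f k (op a X c) = op a Y (push f n c) := by
  have : push f k ∘ₗ op a X = op a Y ∘ₗ push f n := by
    ext σ : 2
    simp only [LinearMap.comp_apply, Finsupp.lsingle_apply, op_single, push_single, push_comp]
  exact congr($this c)

lemma op_ofTuple (A : ∀ m, TupleChain n (Simp m) →ₗ[ℤ] TupleChain k (Simp m))
    (hA : ∀ m m' (v : Fin m → Simp m') c,
      TupleChain.map (Simp.aff v) k (A m c) = A m' (TupleChain.map (Simp.aff v) n c))
    (c : TupleChain n (Simp m)) :
    op (A n (idTuple n)) (Simp m) (ofTuple n m c) = ofTuple k m (A m c) := by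
  have : op (A n (idTuple n)) (Simp m) ∘ₗ ofTuple n m = ofTuple k m ∘ₗ A m := by
    ext v : 2
    simp only [LinearMap.comp_apply, Finsupp.lsingle_apply, ofTuple_single, op_single,
      push_aff_ofTuple, hA, map_aff_idTuple]
  exact congr($this c)

lemma natural_eq {F G : ∀ (X : Type) [TopologicalSpace X], SingChain n X →ₗ[ℤ] SingChain k X}
    (hF : ∀ {X Y : Type} [TopologicalSpace X] [TopologicalSpace Y] (f : C(X, Y)) c,
      push f k (F X c) = F Y (push f n c))
    (hG : ∀ {X Y : Type} [TopologicalSpace X] [TopologicalSpace Y] (f : C(X, Y)) c,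
      push f k (G X c) = G Y (push f n c))
    (h : F (Simp n) (ofTuple n n (idTuple n)) = G (Simp n) (ofTuple n n (idTuple n)))
    (c : SingChain n X) : F X c = G X c := by
  have : F X = G X := by
    ext σ : 2
    have hσ : Finsupp.single σ (1 : ℤ) = push σ n (ofTuple n n (idTuple n)) := by
      rw [ofTuple_idTuple, push_single, ContinuousMap.comp_id]
    simp only [LinearMap.comp_apply, Finsupp.lsingle_apply]
    rw [hσ, ← hF, ← hG, h]
  exact congr($this c)

lemma bd_bd (c : SingChain (n + 2) X) : bd n X (bd (n + 1) X c) = 0 := by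
  refine natural_eq (F := fun X _ => bd n X ∘ₗ bd (n + 1) X) (G := fun _ _ => 0) ?_ ?_ ?_ c
  · intro X Y _ _ f c
    simp [push_bd]
  · simp
  · simp [← ofTuple_bd, TupleChain.bd_bd]

/-- Barycentric subdivision of singular chains. -/
noncomputable def sd (n : ℕ) (X : Type) [TopologicalSpace X] : SingChain n X →ₗ[ℤ] SingChain n X :=
  op (TupleChain.sd Simp.bary n (idTuple n)) X

/-- The homotopy between the identity and the barycentric subdivision. -/
noncomputable def sdHomotopy (n : ℕ) (X : Type) [TopologicalSpace X] :
    SingChain n X →ₗ[ℤ] SingChain (n + 1) X :=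
  op (TupleChain.sdHomotopy Simp.bary n (idTuple n)) X

lemma push_sd (f : C(X, Y)) (c : SingChain n X) : push f n (sd n X c) = sd n Y (push f n c) :=
  push_op _ _ _

lemma push_sdHomotopy (f : C(X, Y)) (c : SingChain n X) :
    push f (n + 1) (sdHomotopy n X c) = sdHomotopy n Y (push f n c) :=
  push_op _ _ _

lemma sd_ofTuple (c : TupleChain n (Simp m)) :
    sd n (Simp m) (ofTuple n m c) = ofTuple n m (TupleChain.sd Simp.bary n c) :=
  op_ofTuple (fun _ => TupleChain.sd Simp.bary n)
    (fun _ _ v c => TupleChain.map_sd (fun n w => Simp.aff_bary v n w) c) c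

lemma sdHomotopy_ofTuple (c : TupleChain n (Simp m)) :
    sdHomotopy n (Simp m) (ofTuple n m c) =
      ofTuple (n + 1) m (TupleChain.sdHomotopy Simp.bary n c) :=
  op_ofTuple (fun _ => TupleChain.sdHomotopy Simp.bary n)
    (fun _ _ v c => TupleChain.map_sdHomotopy (fun n w => Simp.aff_bary v n w) c) c

lemma bd_sd (c : SingChain (n + 1) X) : bd n X (sd (n + 1) X c) = sd n X (bd n X c) := by
  refine natural_eq (F := fun X _ => bd n X ∘ₗ sd (n + 1) X)
    (G := fun X _ => sd n X ∘ₗ bd n X) ?_ ?_ ?_ c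
  · intro X Y _ _ f c
    simp [push_bd, push_sd]
  · intro X Y _ _ f c
    simp [push_bd, push_sd]
  · simp [← ofTuple_bd, sd_ofTuple, TupleChain.bd_sd]

lemma sd_zero (c : SingChain 0 X) : sd 0 X c = c := by
  refine natural_eq (F := fun X _ => sd 0 X) (G := fun X _ => LinearMap.id) ?_ ?_ ?_ c
  · exact push_sd
  · simp
  · simp [sd_ofTuple, TupleChain.sd]

lemma bd_sdHomotopy (c : SingChain (n + 1) X) :
    bd (n + 1) X (sdHomotopy (n + 1) X c) =
      c - sd (n + 1) X c - sdHomotopy n X (bd n X c) := by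
  refine natural_eq (F := fun X _ => bd (n + 1) X ∘ₗ sdHomotopy (n + 1) X)
    (G := fun X _ => LinearMap.id - sd (n + 1) X - sdHomotopy n X ∘ₗ bd n X) ?_ ?_ ?_ c
  · intro X Y _ _ f c
    simp [push_bd, push_sdHomotopy]
  · intro X Y _ _ f c
    simp [push_bd, push_sd, push_sdHomotopy]
  · simp [← ofTuple_bd, sd_ofTuple, sdHomotopy_ofTuple, TupleChain.bd_sdHomotopy]

end SingChain

/-! ### Small chains -/

namespace SingChain

variable {n k m : ℕ} {X Y Z : Type} [TopologicalSpace X] [TopologicalSpace Y] [TopologicalSpace Z]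

/-- The inclusion of a subspace. -/
def incl (A : Set X) : C(A, X) := ⟨Subtype.val, continuous_subtype_val⟩

/-- Singular chains of `X` supported on simplices contained in `A`. -/
noncomputable def small (n : ℕ) (A : Set X) : Submodule ℤ (SingChain n X) :=
  Finsupp.supported ℤ ℤ {σ | ∀ t, σ t ∈ A}

lemma small_mono {A B : Set X} (h : A ⊆ B) : small n A ≤ small n B :=
  Finsupp.supported_mono fun _ hσ t => h (hσ t)

lemma push_incl_injective (A : Set X) : Function.Injective (push (incl A) n) :=
  Finsupp.mapDomain_injective fun _ _ h =>
    ContinuousMap.ext fun t => Subtype.ext congr($h t)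

lemma range_push_incl (A : Set X) : LinearMap.range (push (incl A) n) = small n A := by
  have := Finsupp.lmapDomain_supported (M := ℤ) (R := ℤ)
    (fun σ : C(Simp n, A) => (incl A).comp σ) Set.univ
  rw [Finsupp.supported_univ, Submodule.map_top] at this
  rw [push, this, small]
  congr 1
  ext σ
  constructor
  · rintro ⟨τ, -, rfl⟩ t
    exact (τ t).2
  · intro h
    exact ⟨⟨fun t => ⟨σ t, h t⟩, σ.continuous.subtype_mk _⟩, trivial, rfl⟩

lemma mem_small_iff {A : Set X} {c : SingChain n X} :
    c ∈ small n A ↔ ∃ a, push (incl A) n a = c := by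
  rw [← range_push_incl]; rfl

lemma push_incl_mem_small (A : Set X) (a : SingChain n A) : push (incl A) n a ∈ small n A :=
  mem_small_iff.2 ⟨a, rfl⟩

lemma small_inter (A B : Set X) : small n (A ∩ B) = small n A ⊓ small n B := by
  rw [small, small, small, ← Finsupp.supported_inter]
  congr 1
  ext σ
  exact forall_and

lemma bd_mem_small {A : Set X} {c : SingChain (n + 1) X} (hc : c ∈ small (n + 1) A) :
    bd n X c ∈ small n A := by
  obtain ⟨a, rfl⟩ := mem_small_iff.1 hc
  rw [← push_bd]
  exact push_incl_mem_small _ _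

lemma push_sd_pow (f : C(X, Y)) (k : ℕ) (c : SingChain n X) :
    push f n ((sd n X ^ k) c) = (sd n Y ^ k) (push f n c) := by
  induction k with
  | zero => rfl
  | succ k ih => rw [pow_succ' (sd n X), pow_succ' (sd n Y), Module.End.mul_apply,
      Module.End.mul_apply, push_sd, ih]

lemma bd_sd_pow (k : ℕ) (c : SingChain (n + 1) X) :
    bd n X ((sd (n + 1) X ^ k) c) = (sd n X ^ k) (bd n X c) := by
  induction k with
  | zero => rfl
  | succ k ih => rw [pow_succ' (sd n X), pow_succ' (sd (n + 1) X), Module.End.mul_apply,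
      Module.End.mul_apply, bd_sd, ih]

lemma sd_pow_ofTuple (k : ℕ) (c : TupleChain n (Simp m)) :
    (sd n (Simp m) ^ k) (ofTuple n m c) = ofTuple n m ((TupleChain.sd Simp.bary n ^ k) c) := by
  induction k with
  | zero => rfl
  | succ k ih => rw [pow_succ' (sd n _), pow_succ' (TupleChain.sd _ n), Module.End.mul_apply,
      Module.End.mul_apply, ih, sd_ofTuple]

lemma sd_pow_mem_small {A : Set X} {c : SingChain n X} (hc : c ∈ small n A) (k : ℕ) :
    (sd n X ^ k) c ∈ small n A := by
  obtain ⟨a, rfl⟩ := mem_small_iff.1 hc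
  rw [← push_sd_pow]
  exact push_incl_mem_small _ _

lemma sd_pow_mem_small_sup {A B : Set X} {c : SingChain n X} (hc : c ∈ small n A ⊔ small n B)
    (k : ℕ) : (sd n X ^ k) c ∈ small n A ⊔ small n B := by
  obtain ⟨a, ha, b, hb, rfl⟩ := Submodule.mem_sup.1 hc
  rw [map_add]
  exact Submodule.add_mem_sup (sd_pow_mem_small ha k) (sd_pow_mem_small hb k)

lemma exists_sd_pow_single_mem {U V : Set X} (hU : IsOpen U) (hV : IsOpen V)
    (σ : C(Simp n, X)) (hσ : ∀ t, σ t ∈ U ∪ V) :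
    ∃ k, (sd n X ^ k) (Finsupp.single σ 1) ∈ small n U ⊔ small n V := by
  obtain ⟨δ, hδ, hball⟩ := lebesgue_number_lemma_of_metric (s := (Set.univ : Set (Simp n)))
    (c := fun b : Bool => σ ⁻¹' (if b then U else V)) isCompact_univ
    (by rintro (_ | _); exacts [hV.preimage σ.continuous, hU.preimage σ.continuous])
    (fun t _ => by
      rcases hσ t with h | h
      · exact Set.mem_iUnion.2 ⟨true, h⟩
      · exact Set.mem_iUnion.2 ⟨false, h⟩)
  obtain ⟨D, hD⟩ := Metric.isBounded_iff.1 (isCompact_univ (X := Simp n)).isBounded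
  have hlim : Filter.Tendsto (fun k : ℕ => ((n : ℝ) / (n + 1)) ^ k * D) Filter.atTop (nhds 0) := by
    have := (tendsto_pow_atTop_nhds_zero_of_lt_one (r := (n : ℝ) / (n + 1)) (by positivity)
      ((div_lt_one (by positivity)).2 (lt_add_one _))).mul_const D
    simpa using this
  obtain ⟨k, hk⟩ := (hlim.eventually (gt_mem_nhds hδ)).exists
  refine ⟨k, ?_⟩
  have hσ' : Finsupp.single σ (1 : ℤ) = push σ n (ofTuple n n (idTuple n)) := by
    rw [ofTuple_idTuple, push_single, ContinuousMap.comp_id]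
  rw [hσ', ← push_sd_pow, sd_pow_ofTuple, ← LinearMap.comp_apply]
  refine Finsupp.map_mem_of_mem_supported ?_ (TupleChain.sd_pow_single_mem_supported
    (fun n v x r h => Simp.dist_aff_le v _ x r h) Simp.dist_bary_le n _ D
    (fun i j => hD trivial trivial) k)
  intro w hw
  rw [LinearMap.comp_apply, ofTuple_single, push_single]
  obtain ⟨b, hb⟩ : ∃ b : Bool, ∀ t, σ (Simp.aff w t) ∈ if b then U else V := by
    cases n with
    | zero => exact ⟨true, fun t => absurd t.2.2 (by simp)⟩
    | succ n =>
      obtain ⟨b, hb⟩ := hball (w 0) trivial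
      refine ⟨b, fun t => hb ?_⟩
      rw [Metric.mem_ball, dist_comm]
      exact (Simp.dist_aff_le w t _ _ fun j => hw 0 j).trans_lt hk
  cases b
  · exact Submodule.mem_sup_right (Finsupp.single_mem_supported _ _ hb)
  · exact Submodule.mem_sup_left (Finsupp.single_mem_supported _ _ hb)

lemma exists_sd_pow_mem {U V : Set X} (hU : IsOpen U) (hV : IsOpen V) {c : SingChain n X}
    (hc : c ∈ small n (U ∪ V)) : ∃ k, (sd n X ^ k) c ∈ small n U ⊔ small n V := by
  rw [small, Finsupp.supported_eq_span_single] at hc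
  induction hc using Submodule.span_induction with
  | mem c hc =>
    obtain ⟨σ, hσ, rfl⟩ := hc
    exact exists_sd_pow_single_mem hU hV σ hσ
  | zero => exact ⟨0, by simp⟩
  | add c d _ _ hc hd =>
    obtain ⟨k, hk⟩ := hc
    obtain ⟨l, hl⟩ := hd
    refine ⟨k + l, ?_⟩
    rw [map_add]
    refine add_mem ?_ ?_
    · rw [add_comm, pow_add, Module.End.mul_apply]
      exact sd_pow_mem_small_sup hk l
    · rw [pow_add, Module.End.mul_apply]
      exact sd_pow_mem_small_sup hl k
  | smul a c _ hc =>
    obtain ⟨k, hk⟩ := hc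
    exact ⟨k, by rw [map_smul]; exact Submodule.smul_mem _ _ hk⟩

/-! ### Augmented singular homology -/

/-- Cycles of the augmented singular complex. -/
noncomputable def cycles : ∀ (n : ℕ) (X : Type) [TopologicalSpace X],
    Submodule ℤ (SingChain n X)
  | 0, _, _ => ⊤
  | n + 1, X, _ => LinearMap.ker (bd n X)

/-- Boundaries of the augmented singular complex. -/
noncomputable def boundaries (n : ℕ) (X : Type) [TopologicalSpace X] :
    Submodule ℤ (SingChain n X) :=
  LinearMap.range (bd n X)

lemma bd_mem_cycles (c : SingChain (n + 1) X) : bd n X c ∈ cycles n X := by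
  cases n with
  | zero => trivial
  | succ n => exact bd_bd c

lemma push_mem_cycles (f : C(X, Y)) {c : SingChain n X} (hc : c ∈ cycles n X) :
    push f n c ∈ cycles n Y := by
  cases n with
  | zero => trivial
  | succ n =>
    have hc : bd n X c = 0 := hc
    show bd n Y _ = 0
    rw [← push_bd, hc, map_zero]

lemma push_mem_boundaries (f : C(X, Y)) {c : SingChain n X} (hc : c ∈ boundaries n X) :
    push f n c ∈ boundaries n Y := by
  obtain ⟨w, rfl⟩ := hc
  exact ⟨push f _ w, (push_bd f w).symm⟩

lemma mem_cycles_of_push_incl {A : Set X} {c : SingChain n A}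
    (hc : push (incl A) n c ∈ cycles n X) : c ∈ cycles n A := by
  cases n with
  | zero => trivial
  | succ n =>
    have hc : bd n X _ = 0 := hc
    rw [← push_bd] at hc
    exact push_incl_injective A (hc.trans (map_zero _).symm)

lemma sd_pow_mem_cycles {c : SingChain n X} (hc : c ∈ cycles n X) (k : ℕ) :
    (sd n X ^ k) c ∈ cycles n X := by
  cases n with
  | zero => trivial
  | succ n =>
    have hc : bd n X c = 0 := hc
    show bd n X _ = 0
    rw [bd_sd_pow, hc, map_zero]

lemma sub_sd_mem_boundaries {c : SingChain n X} (hc : c ∈ cycles n X) :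
    c - sd n X c ∈ boundaries n X := by
  cases n with
  | zero => rw [sd_zero, sub_self]; exact zero_mem _
  | succ n =>
    have hc : bd n X c = 0 := hc
    exact ⟨sdHomotopy (n + 1) X c, by rw [bd_sdHomotopy, hc, map_zero, sub_zero]⟩

lemma sub_sd_pow_mem_boundaries {c : SingChain n X} (hc : c ∈ cycles n X) (k : ℕ) :
    c - (sd n X ^ k) c ∈ boundaries n X := by
  induction k with
  | zero => simp
  | succ k ih =>
    have := add_mem ih (sub_sd_mem_boundaries (sd_pow_mem_cycles hc k))
    rwa [sub_add_sub_cancel, ← Module.End.mul_apply, ← pow_succ' (sd n X)] at this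

end SingChain

open SingChain

/-- Homology of the augmented singular complex; the index is the number of vertices, so that
`AugHomology (n + 1) X` is reduced homology in degree `n`. -/
abbrev AugHomology (n : ℕ) (X : Type) [TopologicalSpace X] : Type :=
  cycles n X ⧸ (boundaries n X).submoduleOf (cycles n X)

namespace AugHomology

variable {n : ℕ} {X Y Z : Type} [TopologicalSpace X] [TopologicalSpace Y] [TopologicalSpace Z]

/-- The homology class of a cycle. -/
noncomputable def mk (z : SingChain n X) (hz : z ∈ cycles n X) : AugHomology n X :=
  Submodule.Quotient.mk ⟨z, hz⟩

lemma exists_mk (x : AugHomology n X) : ∃ z hz, x = mk z hz := by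
  obtain ⟨⟨z, hz⟩, rfl⟩ := Submodule.Quotient.mk_surjective _ x
  exact ⟨z, hz, rfl⟩

lemma mk_eq_zero {z : SingChain n X} {hz : z ∈ cycles n X} :
    mk z hz = 0 ↔ z ∈ boundaries n X := by
  rw [mk, Submodule.Quotient.mk_eq_zero]; rfl

lemma mk_eq_mk {z w : SingChain n X} {hz : z ∈ cycles n X} {hw : w ∈ cycles n X} :
    mk z hz = mk w hw ↔ z - w ∈ boundaries n X := by
  rw [mk, mk, Submodule.Quotient.eq]; rfl

/-- The induced map on homology. -/
noncomputable def map (f : C(X, Y)) (n : ℕ) : AugHomology n X →ₗ[ℤ] AugHomology n Y :=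
  Submodule.mapQ _ _ ((push f n).restrict fun _ hz => push_mem_cycles f hz)
    fun _ hz => push_mem_boundaries f hz

lemma map_mk (f : C(X, Y)) {z : SingChain n X} (hz : z ∈ cycles n X) :
    map f n (mk z hz) = mk (push f n z) (push_mem_cycles f hz) := rfl

lemma map_comp_apply (g : C(Y, Z)) (f : C(X, Y)) (x : AugHomology n X) :
    map (g.comp f) n x = map g n (map f n x) := by
  obtain ⟨z, hz, rfl⟩ := exists_mk x
  simp only [map_mk, push_comp]

lemma map_id_apply (x : AugHomology n X) : map (ContinuousMap.id X) n x = x := by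
  obtain ⟨z, hz, rfl⟩ := exists_mk x
  simp only [map_mk, push_id]

end AugHomology

/-! ### Homology classes of subspaces represented by chains of the ambient space -/

section Graph

variable {R M N : Type*} [Ring R] [AddCommGroup M] [Module R M] [AddCommGroup N] [Module R N]

/-- A linear relation which is bijective in both directions is the graph of an equivalence. -/
lemma exists_linearEquiv_of_relation (r : Submodule R (M × N))
    (h₁ : ∀ x, ∃ y, (x, y) ∈ r) (h₂ : ∀ y, ∃ x, (x, y) ∈ r)
    (h₃ : ∀ y, (0, y) ∈ r → y = 0) (h₄ : ∀ x, (x, 0) ∈ r → x = 0) :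
    ∃ e : M ≃ₗ[R] N, ∀ x y, e x = y ↔ (x, y) ∈ r := by
  let p : r ≃ₗ[R] M := LinearEquiv.ofBijective (LinearMap.fst R M N ∘ₗ r.subtype)
    ⟨by
      rw [← LinearMap.ker_eq_bot, LinearMap.ker_eq_bot']
      rintro ⟨⟨x, y⟩, h⟩ (rfl : x = 0)
      exact Subtype.ext (Prod.ext rfl (h₃ y h)),
    fun x => by obtain ⟨y, h⟩ := h₁ x; exact ⟨⟨(x, y), h⟩, rfl⟩⟩
  let q : r ≃ₗ[R] N := LinearEquiv.ofBijective (LinearMap.snd R M N ∘ₗ r.subtype)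
    ⟨by
      rw [← LinearMap.ker_eq_bot, LinearMap.ker_eq_bot']
      rintro ⟨⟨x, y⟩, h⟩ (rfl : y = 0)
      exact Subtype.ext (Prod.ext (h₄ x h) rfl),
    fun y => by obtain ⟨x, h⟩ := h₂ y; exact ⟨⟨(x, y), h⟩, rfl⟩⟩
  have key : ∀ x y, (x, y) ∈ r → p.symm.trans q x = y := fun x y h => by
    have : p.symm x = ⟨(x, y), h⟩ := p.symm_apply_eq.2 rfl
    rw [LinearEquiv.trans_apply, this]
    rfl
  refine ⟨p.symm.trans q, fun x y => ⟨?_, key x y⟩⟩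
  rintro rfl
  obtain ⟨y, hy⟩ := h₁ x
  rwa [key x y hy]

end Graph

namespace AugHomology

variable {n : ℕ} {X : Type} [TopologicalSpace X] {A U V : Set X}

/-- The chain `z` of `X` lies in `A` and represents the class `x` of `A`. -/
def Represents (z : SingChain n X) (x : AugHomology n A) : Prop :=
  ∃ z' hz, push (incl A) n z' = z ∧ x = mk z' hz

lemma exists_represents (x : AugHomology n A) : ∃ z, Represents z x := by
  obtain ⟨z, hz, rfl⟩ := exists_mk x
  exact ⟨_, z, hz, rfl, rfl⟩

lemma exists_represents_of_mem {z : SingChain n X} (hA : z ∈ small n A) (hz : z ∈ cycles n X) :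
    ∃ x : AugHomology n A, Represents z x := by
  obtain ⟨z', rfl⟩ := mem_small_iff.1 hA
  exact ⟨_, z', mem_cycles_of_push_incl hz, rfl, rfl⟩

namespace Represents

variable {z w : SingChain n X} {x y : AugHomology n A}

lemma mem_small (h : Represents z x) : z ∈ small n A := by
  obtain ⟨z', hz, rfl, -⟩ := h
  exact push_incl_mem_small _ _

lemma mem_cycles (h : Represents z x) : z ∈ cycles n X := by
  obtain ⟨z', hz, rfl, -⟩ := h
  exact push_mem_cycles _ hz

lemma zero : Represents (0 : SingChain n X) (0 : AugHomology n A) :=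
  ⟨0, zero_mem _, map_zero _, rfl⟩

lemma add (h : Represents z x) (h' : Represents w y) : Represents (z + w) (x + y) := by
  obtain ⟨z', hz, rfl, rfl⟩ := h
  obtain ⟨w', hw, rfl, rfl⟩ := h'
  exact ⟨z' + w', add_mem hz hw, map_add _ _ _, rfl⟩

lemma smul (k : ℤ) (h : Represents z x) : Represents (k • z) (k • x) := by
  obtain ⟨z', hz, rfl, rfl⟩ := h
  exact ⟨k • z', Submodule.smul_mem _ _ hz, map_smul _ _ _, rfl⟩

lemma eq_zero_iff (h : Represents z x) : x = 0 ↔ ∃ w ∈ small (n + 1) A, bd n X w = z := by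
  obtain ⟨z', hz, rfl, rfl⟩ := h
  rw [mk_eq_zero]
  constructor
  · rintro ⟨w, rfl⟩
    exact ⟨_, push_incl_mem_small _ w, (push_bd _ _).symm⟩
  · rintro ⟨w, hw, h⟩
    obtain ⟨w, rfl⟩ := mem_small_iff.1 hw
    rw [← push_bd] at h
    exact ⟨w, push_incl_injective A h⟩

lemma sd_pow (h : Represents z x) (k : ℕ) : Represents ((sd n X ^ k) z) x := by
  obtain ⟨z', hz, rfl, rfl⟩ := h
  exact ⟨(sd n A ^ k) z', sd_pow_mem_cycles hz k, push_sd_pow _ _ _,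
    mk_eq_mk.2 (sub_sd_pow_mem_boundaries hz k)⟩

lemma unique (h : Represents z x) (h' : Represents z y) : x = y := by
  obtain ⟨z', hz, rfl, rfl⟩ := h
  obtain ⟨w', hw, hzw, rfl⟩ := h'
  obtain rfl := push_incl_injective A hzw
  rfl

lemma map {f : C(X, X)} (hf : Set.MapsTo f A A) (h : Represents z x) :
    Represents (push f n z) (AugHomology.map (restrictCM f hf) n x) := by
  obtain ⟨z', hz, rfl, rfl⟩ := h
  refine ⟨push (restrictCM f hf) n z', push_mem_cycles _ hz, ?_, rfl⟩
  rw [← push_comp, ← push_comp]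
  rfl

end Represents

lemma exists_bd_eq [Subsingleton (AugHomology n A)] {z : SingChain n X} (hA : z ∈ small n A)
    (hz : z ∈ cycles n X) : ∃ w ∈ small (n + 1) A, bd n X w = z := by
  obtain ⟨x, hx⟩ := exists_represents_of_mem hA hz
  exact hx.eq_zero_iff.1 (Subsingleton.elim _ _)

/-- The connecting relation of the Mayer-Vietoris sequence. -/
def connecting (n : ℕ) (U V : Set X) :
    Submodule ℤ (AugHomology (n + 1) ↥(U ∪ V) × AugHomology n ↥(U ∩ V)) where
  carrier := {p | ∃ a ∈ small (n + 1) U, ∃ b ∈ small (n + 1) V,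
    Represents (a + b) p.1 ∧ Represents (bd n X a) p.2}
  zero_mem' := ⟨0, zero_mem _, 0, zero_mem _, by
    rw [add_zero]; exact .zero, by rw [map_zero]; exact .zero⟩
  add_mem' := by
    rintro _ _ ⟨a, ha, b, hb, h₁, h₂⟩ ⟨a', ha', b', hb', h₁', h₂'⟩
    refine ⟨a + a', add_mem ha ha', b + b', add_mem hb hb', ?_, ?_⟩
    · rw [add_add_add_comm]; exact h₁.add h₁'
    · rw [map_add]; exact h₂.add h₂'
  smul_mem' := by
    rintro k _ ⟨a, ha, b, hb, h₁, h₂⟩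
    refine ⟨k • a, Submodule.smul_mem _ _ ha, k • b, Submodule.smul_mem _ _ hb, ?_, ?_⟩
    · rw [← smul_add]; exact h₁.smul k
    · rw [map_smul]; exact h₂.smul k

lemma connecting_map {f : C(X, X)} (hU : Set.MapsTo f U U) (hV : Set.MapsTo f V V)
    (hW : Set.MapsTo f (U ∪ V) (U ∪ V)) (hI : Set.MapsTo f (U ∩ V) (U ∩ V))
    {x : AugHomology (n + 1) ↥(U ∪ V)} {y : AugHomology n ↥(U ∩ V)}
    (h : (x, y) ∈ connecting n U V) :
    (map (restrictCM f hW) _ x, map (restrictCM f hI) _ y) ∈ connecting n U V := by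
  obtain ⟨a, ha, b, hb, h₁, h₂⟩ := h
  refine ⟨push f _ a, ?_, push f _ b, ?_, ?_, ?_⟩
  · obtain ⟨a, rfl⟩ := mem_small_iff.1 ha
    exact mem_small_iff.2 ⟨push (restrictCM f hU) _ a, by rw [← push_comp, ← push_comp]; rfl⟩
  · obtain ⟨b, rfl⟩ := mem_small_iff.1 hb
    exact mem_small_iff.2 ⟨push (restrictCM f hV) _ b, by rw [← push_comp, ← push_comp]; rfl⟩
  · rw [← map_add]; exact h₁.map hW
  · rw [← push_bd]; exact h₂.map hI

/-- Mayer-Vietoris for two open sets with trivial homology. -/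
lemma exists_connecting_equiv (hU : IsOpen U) (hV : IsOpen V)
    (hU' : ∀ n, Subsingleton (AugHomology n U)) (hV' : ∀ n, Subsingleton (AugHomology n V))
    (n : ℕ) : ∃ e : AugHomology (n + 1) ↥(U ∪ V) ≃ₗ[ℤ] AugHomology n ↥(U ∩ V),
      ∀ x y, e x = y ↔ (x, y) ∈ connecting n U V := by
  have key : ∀ {a b : SingChain (n + 1) X}, a ∈ small (n + 1) U → b ∈ small (n + 1) V →
      a + b ∈ cycles (n + 1) X → bd n X a ∈ small n (U ∩ V) := by
    intro a b ha hb hab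
    have hab : bd n X (a + b) = 0 := hab
    rw [map_add] at hab
    rw [small_inter]
    refine ⟨bd_mem_small ha, ?_⟩
    rw [eq_neg_of_add_eq_zero_left hab]
    exact neg_mem (bd_mem_small hb)
  refine exists_linearEquiv_of_relation _ (fun x => ?_) (fun y => ?_) ?_ ?_
  · obtain ⟨z, hz⟩ := exists_represents x
    obtain ⟨k, hk⟩ := exists_sd_pow_mem hU hV hz.mem_small
    have hz := hz.sd_pow k
    obtain ⟨a, ha, b, hb, hab⟩ := Submodule.mem_sup.1 hk
    rw [← hab] at hz
    obtain ⟨y, hy⟩ := exists_represents_of_mem (key ha hb hz.mem_cycles) (bd_mem_cycles a)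
    exact ⟨y, a, ha, b, hb, hz, hy⟩
  · obtain ⟨c, hc⟩ := exists_represents y
    obtain ⟨a, ha, hac⟩ := exists_bd_eq (small_mono Set.inter_subset_left hc.mem_small)
      hc.mem_cycles
    obtain ⟨b, hb, hbc⟩ := exists_bd_eq (small_mono Set.inter_subset_right hc.mem_small)
      hc.mem_cycles
    obtain ⟨x, hx⟩ := exists_represents_of_mem (A := U ∪ V) (z := a + -b)
      (add_mem (small_mono Set.subset_union_left ha)
        (neg_mem (small_mono Set.subset_union_right hb)))
      (show bd n X _ = 0 by rw [map_add, map_neg, hac, hbc, add_neg_cancel])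
    exact ⟨x, a, ha, -b, neg_mem hb, hx, hac ▸ hc⟩
  · rintro y ⟨a, ha, b, hb, h₁, h₂⟩
    obtain ⟨w, hw, hwab⟩ := h₁.eq_zero_iff.1 rfl
    obtain ⟨k, hk⟩ := exists_sd_pow_mem hU hV hw
    obtain ⟨w₁, hw₁, w₂, hw₂, hww⟩ := Submodule.mem_sup.1 hk
    refine (h₂.sd_pow k).eq_zero_iff.2 ⟨(sd _ X ^ k) a - bd _ X w₁, ?_, ?_⟩
    · rw [small_inter]
      refine ⟨sub_mem (sd_pow_mem_small ha k) (bd_mem_small hw₁), ?_⟩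
      have : (sd _ X ^ k) a - bd _ X w₁ = bd _ X w₂ - (sd _ X ^ k) b := by
        rw [sub_eq_sub_iff_add_eq_add, ← map_add, ← map_add, add_comm w₂, hww, bd_sd_pow, hwab]
      rw [this]
      exact sub_mem (bd_mem_small hw₂) (sd_pow_mem_small hb k)
    · rw [map_sub, bd_bd, sub_zero, bd_sd_pow]
  · rintro x ⟨a, ha, b, hb, h₁, h₂⟩
    obtain ⟨u, hu, hua⟩ := h₂.eq_zero_iff.1 rfl
    have hu := small_inter U V ▸ hu
    have hab : bd n X (a + b) = 0 := h₁.mem_cycles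
    obtain ⟨p, hp, hpa⟩ := exists_bd_eq (z := a - u) (sub_mem ha hu.1)
      (show bd n X _ = 0 by rw [map_sub, hua, sub_self])
    obtain ⟨q, hq, hqb⟩ := exists_bd_eq (z := b + u) (add_mem hb hu.2)
      (show bd n X _ = 0 by rw [map_add, hua, ← map_add, add_comm b a, hab])
    refine h₁.eq_zero_iff.2 ⟨p + q, add_mem (small_mono Set.subset_union_left hp)
      (small_mono Set.subset_union_right hq), ?_⟩
    rw [map_add, hpa, hqb]
    abel

/-- The Mayer-Vietoris isomorphism, with its naturality. -/
lemma exists_equiv_of_cover {W I : Set X} (hW : U ∪ V = W) (hI : U ∩ V = I)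
    (hU : IsOpen U) (hV : IsOpen V)
    (hU' : ∀ n, Subsingleton (AugHomology n U)) (hV' : ∀ n, Subsingleton (AugHomology n V))
    (n : ℕ) : ∃ e : AugHomology (n + 1) W ≃ₗ[ℤ] AugHomology n I,
      ∀ f : C(X, X), Set.MapsTo f U U → Set.MapsTo f V V →
        ∀ (hfW : Set.MapsTo f W W) (hfI : Set.MapsTo f I I) (x : AugHomology (n + 1) W),
          e (map (restrictCM f hfW) _ x) = map (restrictCM f hfI) _ (e x) := by
  subst hW hI
  obtain ⟨e, he⟩ := exists_connecting_equiv hU hV hU' hV' n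
  exact ⟨e, fun f hfU hfV hfW hfI x =>
    (he _ _).2 (connecting_map hfU hfV hfW hfI ((he _ _).1 rfl))⟩

end AugHomology

/-! ### Homology classes in complexes of modules -/

/-- The chain `c` is a cycle with homology class `x`. -/
def HasClass (K : ChainComplex (ModuleCat.{0} ℤ) ℕ) {n : ℕ} (c : K.X n) (x : K.homology n) :
    Prop :=
  ∃ k : K.cycles n, K.iCycles n k = c ∧ K.homologyπ n k = x

namespace HasClass

variable {K L : ChainComplex (ModuleCat.{0} ℤ) ℕ} {n : ℕ} {c c' : K.X n} {x x' : K.homology n}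

lemma exists_chain (x : K.homology n) : ∃ c, HasClass K c x := by
  obtain ⟨k, hk⟩ := (ModuleCat.epi_iff_surjective (K.homologyπ n)).1 inferInstance x
  exact ⟨_, k, rfl, hk⟩

lemma exists_class (c : K.X n) (j : ℕ) (hj : (ComplexShape.down ℕ).next n = j)
    (hc : K.d n j c = 0) : ∃ x, HasClass K c x := by
  let f : ModuleCat.of ℤ ℤ ⟶ K.X n := ModuleCat.ofHom (LinearMap.toSpanSingleton ℤ (K.X n) c)
  have hf : f ≫ K.d n j = 0 := by
    refine ModuleCat.hom_ext (LinearMap.ext_ring ?_)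
    simpa [f] using hc
  refine ⟨_, K.liftCycles f j hj hf (1 : ℤ), ?_, rfl⟩
  rw [← ConcreteCategory.comp_apply, K.liftCycles_i]
  exact LinearMap.toSpanSingleton_apply_one ℤ _ c

lemma d_eq_zero (h : HasClass K c x) (j : ℕ) : K.d n j c = 0 := by
  obtain ⟨k, rfl, -⟩ := h
  rw [← ConcreteCategory.comp_apply, K.iCycles_d]
  rfl

lemma eq_zero_iff (h : HasClass K c x) : x = 0 ↔ ∃ w, K.d (n + 1) n w = c := by
  obtain ⟨k, rfl, rfl⟩ := h
  have hex := ShortComplex.exact_of_g_is_cokernel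
    (ShortComplex.mk _ _ (K.toCycles_comp_homologyπ (n + 1) n))
    (K.homologyIsCokernel (n + 1) n (by simp))
  rw [ShortComplex.moduleCat_exact_iff] at hex
  constructor
  · intro h0
    obtain ⟨w, hw⟩ := hex k h0
    refine ⟨w, ?_⟩
    rw [← K.toCycles_i, ConcreteCategory.comp_apply]
    exact congrArg _ hw
  · rintro ⟨w, hw⟩
    rw [← K.toCycles_i, ConcreteCategory.comp_apply] at hw
    rw [← (ModuleCat.mono_iff_injective (K.iCycles n)).1 inferInstance hw,
      ← ConcreteCategory.comp_apply, K.toCycles_comp_homologyπ]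
    rfl

lemma sub (h : HasClass K c x) (h' : HasClass K c' x') : HasClass K (c - c') (x - x') := by
  obtain ⟨k, rfl, rfl⟩ := h
  obtain ⟨k', rfl, rfl⟩ := h'
  exact ⟨k - k', map_sub _ _ _, map_sub _ _ _⟩

lemma unique (h : HasClass K c x) (h' : HasClass K c x') : x = x' :=
  sub_eq_zero.1 ((h.sub h').eq_zero_iff.2 ⟨0, by rw [map_zero, sub_self]⟩)

lemma map (h : HasClass K c x) (φ : K ⟶ L) :
    HasClass L (φ.f n c) (HomologicalComplex.homologyMap φ n x) := by
  obtain ⟨k, rfl, rfl⟩ := h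
  refine ⟨HomologicalComplex.cyclesMap φ n k, ?_, ?_⟩
  · rw [← ConcreteCategory.comp_apply, ← ConcreteCategory.comp_apply,
      HomologicalComplex.cyclesMap_i]
  · rw [← ConcreteCategory.comp_apply, ← ConcreteCategory.comp_apply,
      HomologicalComplex.homologyπ_naturality]

end HasClass

/-! ### Comparison of the singular chain complexes -/

namespace SingChain

variable {X Y : Type} [TopologicalSpace X] [TopologicalSpace Y]

lemma _root_.ModuleCat.sum_zsmul_apply {M N : ModuleCat.{0} ℤ} {m : ℕ} (a : Fin m → ℤ)
    (f : Fin m → (M ⟶ N)) (x : M) : (∑ i, a i • f i) x = ∑ i, a i • f i x := by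
  change (∑ i, a i • f i).hom x = _
  rw [ModuleCat.hom_sum, LinearMap.sum_apply]
  rfl

/-- The identification of the two versions of singular chains. -/
noncomputable def chainEquiv (X : Type) [TopologicalSpace X] (n : ℕ) :
    ((singularChains.obj (TopCat.of X)).X n : Type) ≃ₗ[ℤ] SingChain (n + 1) X :=
  Finsupp.domLCongr (TopCat.toSSetObjEquiv (TopCat.of X) (Opposite.op (SimplexCategory.mk n)))

lemma chainEquiv_freeMk (n : ℕ)
    (σ : (TopCat.toSSet.obj (TopCat.of X)).obj (Opposite.op (SimplexCategory.mk n))) :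
    chainEquiv X n (ModuleCat.freeMk σ) =
      Finsupp.single (TopCat.toSSetObjEquiv (TopCat.of X) _ σ) 1 :=
  Finsupp.domLCongr_single _ _ _

lemma chainEquiv_map (f : C(X, Y)) (n : ℕ) (c : (singularChains.obj (TopCat.of X)).X n) :
    chainEquiv Y n ((singularChains.map (TopCat.ofHom f)).f n c) =
      push f (n + 1) (chainEquiv X n c) := by
  have : (chainEquiv Y n).toLinearMap ∘ₗ ((singularChains.map (TopCat.ofHom f)).f n).hom =
      push f (n + 1) ∘ₗ (chainEquiv X n).toLinearMap := by
    refine Finsupp.lhom_ext' fun σ => LinearMap.ext_ring ?_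
    change chainEquiv Y n ((ModuleCat.free ℤ).map
      ((TopCat.toSSet.map (TopCat.ofHom f)).app _) (ModuleCat.freeMk σ)) =
        push f (n + 1) (chainEquiv X n (ModuleCat.freeMk σ))
    rw [ModuleCat.free_map_apply, chainEquiv_freeMk, chainEquiv_freeMk, push_single]
    rfl
  exact congr($this c)

lemma chainEquiv_d (n : ℕ) (c : (singularChains.obj (TopCat.of X)).X (n + 1)) :
    chainEquiv X n ((singularChains.obj (TopCat.of X)).d (n + 1) n c) =
      bd (n + 1) X (chainEquiv X (n + 1) c) := by
  have : (chainEquiv X n).toLinearMap ∘ₗ ((singularChains.obj (TopCat.of X)).d (n + 1) n).hom =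
      bd (n + 1) X ∘ₗ (chainEquiv X (n + 1)).toLinearMap := by
    refine Finsupp.lhom_ext' fun σ => LinearMap.ext_ring ?_
    change chainEquiv X n ((singularChains.obj (TopCat.of X)).d (n + 1) n (ModuleCat.freeMk σ)) =
      bd (n + 1) X (chainEquiv X (n + 1) (ModuleCat.freeMk σ))
    rw [chainEquiv_freeMk, bd_single]
    have hd : (singularChains.obj (TopCat.of X)).d (n + 1) n = ∑ i : Fin (n + 2),
        (-1 : ℤ) ^ (i : ℕ) • (ModuleCat.free ℤ).map ((TopCat.toSSet.obj (TopCat.of X)).δ i) :=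
      AlgebraicTopology.alternatingFaceMapComplex_obj_d _ _
    have hd' := (congrArg (fun φ => φ.hom (ModuleCat.freeMk σ)) hd).trans
      (ModuleCat.sum_zsmul_apply _ _ _)
    refine (congrArg (chainEquiv X n) hd').trans ((map_sum _ _ _).trans
      (Finset.sum_congr rfl fun i _ => (map_zsmul _ _ _).trans (congrArg _ ?_)))
    exact (congrArg (chainEquiv X n) (ModuleCat.free_map_apply _ _)).trans (chainEquiv_freeMk _ _)
  exact congr($this c)

end SingChain

/-! ### Comparison with reduced singular homology -/

namespace SingChain

variable {n : ℕ} {X Y : Type} [TopologicalSpace X] [TopologicalSpace Y]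

lemma push_zero_injective (f : C(X, Y)) : Function.Injective (push f 0) :=
  Finsupp.mapDomain_injective fun _ _ _ => ContinuousMap.ext fun t => absurd t.2.2 (by simp)

/-- The cone operator on the chains of a point. -/
noncomputable def pointCone (n : ℕ) : SingChain n PUnit →ₗ[ℤ] SingChain (n + 1) PUnit :=
  Finsupp.lmapDomain ℤ ℤ fun _ => ContinuousMap.const _ PUnit.unit

lemma bd_pointCone_zero (c : SingChain 0 PUnit) : bd 0 _ (pointCone 0 c) = c := by
  have : bd 0 _ ∘ₗ pointCone 0 = LinearMap.id := by
    refine Finsupp.lhom_ext' fun σ => LinearMap.ext_ring ?_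
    simp [pointCone]
    rfl
  exact congr($this c)

lemma bd_pointCone (c : SingChain (n + 1) PUnit) :
    bd (n + 1) _ (pointCone (n + 1) c) = c - pointCone n (bd n _ c) := by
  have : bd (n + 1) _ ∘ₗ pointCone (n + 1) = LinearMap.id - pointCone n ∘ₗ bd n _ := by
    refine Finsupp.lhom_ext' fun σ => LinearMap.ext_ring ?_
    simp only [LinearMap.comp_apply, LinearMap.sub_apply, Finsupp.lsingle_apply, bd_single,
      pointCone, Finsupp.lmapDomain_apply, Finsupp.mapDomain_single, LinearMap.id_apply, map_sum,
      map_zsmul]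
    rw [Fin.sum_univ_succ]
    simp only [Fin.val_zero, pow_zero, one_smul, Fin.val_succ, pow_succ, mul_neg_one, neg_smul,
      Finset.sum_neg_distrib]
    exact (sub_eq_add_neg _ _).symm
  exact congr($this c)

end SingChain

namespace AugHomology

variable {n : ℕ} {X Y : Type} [TopologicalSpace X] [TopologicalSpace Y]

instance : Subsingleton (AugHomology n PUnit) := by
  refine subsingleton_of_forall_eq 0 fun x => ?_
  obtain ⟨z, hz, rfl⟩ := exists_mk x
  rw [mk_eq_zero]
  refine ⟨pointCone n z, ?_⟩
  cases n with
  | zero => exact bd_pointCone_zero z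
  | succ n =>
    have hz : bd n _ z = 0 := hz
    rw [bd_pointCone, hz, map_zero, sub_zero]

/-- The singular homology class `x` and the augmented homology class `y` have a common
representative. -/
def Corresponds (x : (SH n).obj (TopCat.of X)) (y : AugHomology (n + 1) X) : Prop :=
  ∃ c, HasClass (singularChains.obj (TopCat.of X)) c x ∧
    ∃ hz, y = mk (chainEquiv X n c) hz

namespace Corresponds

variable {x x' : (SH n).obj (TopCat.of X)} {y y' : AugHomology (n + 1) X}

lemma eq_zero_iff (h : Corresponds x y) : x = 0 ↔ y = 0 := by
  obtain ⟨c, hc, hz, rfl⟩ := h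
  refine hc.eq_zero_iff.trans (Iff.trans ?_ mk_eq_zero.symm)
  constructor
  · rintro ⟨w, rfl⟩
    exact ⟨_, (chainEquiv_d n w).symm⟩
  · rintro ⟨w, hw⟩
    refine ⟨(chainEquiv X (n + 1)).symm w, (chainEquiv X n).injective ?_⟩
    rw [chainEquiv_d, LinearEquiv.apply_symm_apply, hw]

lemma sub (h : Corresponds x y) (h' : Corresponds x' y') : Corresponds (x - x') (y - y') := by
  obtain ⟨c, hc, hz, rfl⟩ := h
  obtain ⟨c', hc', hz', rfl⟩ := h'
  refine ⟨c - c', hc.sub hc', ?_, ?_⟩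
  · rw [map_sub]; exact sub_mem hz hz'
  · simp only [map_sub]
    rfl

lemma map (h : Corresponds x y) (f : C(X, Y)) :
    Corresponds (SHmap n f x) (AugHomology.map f (n + 1) y) := by
  obtain ⟨c, hc, hz, rfl⟩ := h
  refine ⟨_, hc.map (singularChains.map (TopCat.ofHom f)), ?_, ?_⟩
  · rw [chainEquiv_map]; exact push_mem_cycles f hz
  · simp only [chainEquiv_map]
    rfl

lemma mem_reducedSH (h : Corresponds x y) : x ∈ reducedSH n X :=
  (h.map (ContinuousMap.const X PUnit.unit)).eq_zero_iff.2 (Subsingleton.elim _ _)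

end Corresponds

lemma exists_corresponds (y : AugHomology (n + 1) X) :
    ∃ x : (SH n).obj (TopCat.of X), Corresponds x y := by
  obtain ⟨z, hz, rfl⟩ := exists_mk y
  obtain ⟨c, rfl⟩ := (chainEquiv X n).surjective z
  suffices ∃ x, HasClass (singularChains.obj (TopCat.of X)) c x by
    obtain ⟨x, hx⟩ := this
    exact ⟨x, c, hx, hz, rfl⟩
  cases n with
  | zero =>
    refine HasClass.exists_class c 0 (by simp) ?_
    rw [HomologicalComplex.shape _ _ _ (by simp)]
    rfl
  | succ n =>
    refine HasClass.exists_class c n (by simp) ((chainEquiv X n).injective ?_)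
    rw [chainEquiv_d, map_zero]
    exact hz

lemma exists_corresponds_of_mem {x : (SH n).obj (TopCat.of X)} (hx : x ∈ reducedSH n X) :
    ∃ y : AugHomology (n + 1) X, Corresponds x y := by
  obtain ⟨c, hc⟩ := HasClass.exists_chain x
  refine ⟨_, c, hc, ?_, rfl⟩
  change bd n X _ = 0
  cases n with
  | zero =>
    obtain ⟨w, hw⟩ := (hc.map (singularChains.map
      (TopCat.ofHom (ContinuousMap.const X PUnit.unit)))).eq_zero_iff.1 hx
    apply push_zero_injective (ContinuousMap.const X PUnit.unit)
    rw [push_bd, ← chainEquiv_map, ← hw, chainEquiv_d, bd_bd, map_zero]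
  | succ n =>
    rw [← chainEquiv_d, hc.d_eq_zero, map_zero]

lemma map_injective_iff_SHmap (f : C(X, Y)) :
    (∀ x ∈ reducedSH n X, SHmap n f x = 0 → x = 0) ↔
      ∀ y, map f (n + 1) y = 0 → y = 0 := by
  constructor
  · intro h y hy
    obtain ⟨x, hx⟩ := exists_corresponds y
    exact hx.eq_zero_iff.1 (h x hx.mem_reducedSH ((hx.map f).eq_zero_iff.2 hy))
  · intro h x hx hfx
    obtain ⟨y, hy⟩ := exists_corresponds_of_mem hx
    exact hy.eq_zero_iff.2 (h y ((hy.map f).eq_zero_iff.1 hfx))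

lemma SHmapNontrivial_iff (f : C(X, Y)) :
    SHmapNontrivial n f ↔ map f (n + 1) ≠ 0 := by
  rw [Ne, LinearMap.ext_iff, not_forall]
  constructor
  · rintro ⟨x, hx, hfx⟩
    obtain ⟨y, hy⟩ := exists_corresponds_of_mem hx
    exact ⟨y, fun h => hfx ((hy.map f).eq_zero_iff.2 h)⟩
  · rintro ⟨y, hy⟩
    obtain ⟨x, hx⟩ := exists_corresponds y
    exact ⟨x, hx.mem_reducedSH, fun h => hy ((hx.map f).eq_zero_iff.1 h)⟩

/-! ### Homotopy invariance -/

lemma SHmap_eq_of_homotopic {f g : C(X, Y)} (h : f.Homotopic g) (n : ℕ) :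
    SHmap n f = SHmap n g := by
  obtain ⟨H⟩ := h
  have H' : TopCat.Homotopy (TopCat.ofHom f) (TopCat.ofHom g) := H
  exact (H'.toSSet.toSimplicialObjectHomotopy.whiskerRight
    (ModuleCat.free ℤ)).toChainHomotopy.homologyMap_eq n

lemma map_eq_of_homotopic {f g : C(X, Y)} (h : f.Homotopic g) (n : ℕ) (x : AugHomology n X) :
    map f n x = map g n x := by
  cases n with
  | zero =>
    obtain ⟨z, hz, rfl⟩ := exists_mk x
    have : push f 0 = push g 0 := by
      refine Finsupp.lhom_ext' fun σ => LinearMap.ext_ring ?_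
      simp only [LinearMap.comp_apply, Finsupp.lsingle_apply, push_single]
      congr 1
      exact ContinuousMap.ext fun t => absurd t.2.2 (by simp)
    simp only [map_mk, this]
  | succ n =>
    obtain ⟨y, hy⟩ := exists_corresponds x
    have := (hy.map f).sub (hy.map g)
    rw [SHmap_eq_of_homotopic h, sub_self] at this
    exact sub_eq_zero.1 (this.eq_zero_iff.1 rfl)

/-- A homotopy equivalence induces an isomorphism. -/
noncomputable def equiv (f : C(X, Y)) (g : C(Y, X))
    (hgf : (g.comp f).Homotopic (ContinuousMap.id X))
    (hfg : (f.comp g).Homotopic (ContinuousMap.id Y)) (n : ℕ) :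
    AugHomology n X ≃ₗ[ℤ] AugHomology n Y :=
  .ofLinearMap (map f n) (map g n)
    (LinearMap.ext fun y => by
      rw [LinearMap.comp_apply, ← map_comp_apply, map_eq_of_homotopic hfg, map_id_apply]; rfl)
    (LinearMap.ext fun x => by
      rw [LinearMap.comp_apply, ← map_comp_apply, map_eq_of_homotopic hgf, map_id_apply]; rfl)

lemma equiv_apply (f : C(X, Y)) (g : C(Y, X))
    (hgf : (g.comp f).Homotopic (ContinuousMap.id X))
    (hfg : (f.comp g).Homotopic (ContinuousMap.id Y)) (n : ℕ) (x : AugHomology n X) :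
    equiv f g hgf hfg n x = map f n x := rfl

lemma subsingleton_of_contractible [ContractibleSpace X] (n : ℕ) :
    Subsingleton (AugHomology n X) := by
  obtain ⟨e⟩ := ContractibleSpace.hequiv_unit X
  exact (equiv e.toFun e.invFun e.left_inv e.right_inv n).toEquiv.subsingleton

end AugHomology

/-! ### Punctured vector spaces -/

section Segments

variable {X E : Type} [TopologicalSpace X] [NormedAddCommGroup E] [NormedSpace ℝ E]

lemma homotopic_of_segment_subset {s : Set E} (f g : C(X, s))
    (h : ∀ x, segment ℝ (f x : E) (g x) ⊆ s) : f.Homotopic g := by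
  refine ⟨⟨⟨fun p => ⟨AffineMap.lineMap (f p.2 : E) (g p.2 : E) (p.1 : ℝ), h p.2 ?_⟩, ?_⟩, ?_, ?_⟩⟩
  · rw [segment_eq_image_lineMap]
    exact ⟨_, p.1.2, rfl⟩
  · simp only [AffineMap.lineMap_apply_module]
    fun_prop
  · intro x; simp
  · intro x; simp

end Segments

namespace AugHomology

section Restrict

variable {X Y : Type} [TopologicalSpace X] [TopologicalSpace Y]

/-- The isomorphism induced by a homeomorphism of pairs. -/
lemma exists_equiv_of_homeomorph (h : X ≃ₜ Y) {s : Set X} {t : Set Y} (hst : Set.MapsTo h s t)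
    (hts : Set.MapsTo h.symm t s) (n : ℕ) :
    ∃ e : AugHomology n s ≃ₗ[ℤ] AugHomology n t,
      ∀ x, e x = map (restrictCM (h : C(X, Y)) hst) n x := by
  refine ⟨equiv (restrictCM (h : C(X, Y)) hst) (restrictCM (h.symm : C(Y, X)) hts) ?_ ?_ n,
    fun x => rfl⟩
  · convert ContinuousMap.Homotopic.refl _
    ext x
    simp [restrictCM]
  · convert ContinuousMap.Homotopic.refl _
    ext x
    simp [restrictCM]

end Restrict

variable (E F G : Type) [NormedAddCommGroup E] [NormedSpace ℝ E] [NormedAddCommGroup F]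
  [NormedSpace ℝ F] [NormedAddCommGroup G] [NormedSpace ℝ G]

/-- There is an isomorphism between the homology of the complements of the origin in `E × F`
and in `E`, in the given degrees, which is natural for self-maps of `E`. -/
def NaturalIso (m n : ℕ) : Prop :=
  ∃ e : AugHomology m ({0}ᶜ : Set (E × F)) ≃ₗ[ℤ] AugHomology n ({0}ᶜ : Set E),
    ∀ (φ : C(E, E)) (hφ : Set.MapsTo φ {0}ᶜ {0}ᶜ)
      (hφ' : Set.MapsTo (φ.prodMap (ContinuousMap.id F)) {0}ᶜ {0}ᶜ) (x),
        e (map (restrictCM _ hφ') _ x) = map (restrictCM φ hφ) _ (e x)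

lemma naturalIso_real (n : ℕ) : NaturalIso E ℝ (n + 1) n := by
  let U : Set (E × ℝ) := {p | p.1 ≠ 0 ∨ 0 < p.2}
  let V : Set (E × ℝ) := {p | p.1 ≠ 0 ∨ p.2 < 0}
  let I : Set (E × ℝ) := {p | p.1 ≠ 0}
  have hU : IsOpen U := (isOpen_ne_fun continuous_fst continuous_const).union
    (isOpen_lt continuous_const continuous_snd)
  have hV : IsOpen V := (isOpen_ne_fun continuous_fst continuous_const).union
    (isOpen_lt continuous_snd continuous_const)
  have hU' : StarConvex ℝ (0, 1) U := by
    rintro ⟨x, t⟩ hx a b ha hb hab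
    rcases hb.eq_or_lt with rfl | hb'
    · right; simp at hab ⊢; simp [hab]
    · rcases hx with hx | hx
      · left; simpa [hb'.ne'] using hx
      · right
        have : 0 < b * t := mul_pos hb' hx
        simp; linarith
  have hV' : StarConvex ℝ (0, -1) V := by
    rintro ⟨x, t⟩ hx a b ha hb hab
    rcases hb.eq_or_lt with rfl | hb'
    · right; simp at hab ⊢; simp [hab]
    · rcases hx with hx | hx
      · left; simpa [hb'.ne'] using hx
      · right
        have : b * t < 0 := mul_neg_of_pos_of_neg hb' hx
        simp; linarith
  have hUne : U.Nonempty := ⟨(0, 1), Or.inr one_pos⟩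
  have hVne : V.Nonempty := ⟨(0, -1), Or.inr (by norm_num)⟩
  have := hU'.contractibleSpace hUne
  have := hV'.contractibleSpace hVne
  have hW : U ∪ V = {0}ᶜ := by
    ext ⟨x, t⟩
    simp only [U, V, Set.mem_union, Set.mem_ofPred_eq, Set.mem_compl_iff, Set.mem_singleton_iff,
      Prod.mk_eq_zero]
    rcases lt_trichotomy t 0 with h | h | h
    · simp [h, h.ne]
    · simp [h]
    · simp [h, h.ne']
  have hI : U ∩ V = I := by
    ext ⟨x, t⟩
    simp only [U, V, I, Set.mem_inter_iff, Set.mem_ofPred_eq]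
    constructor
    · rintro ⟨h | h, h' | h'⟩
      · exact h
      · exact h
      · exact h'
      · exact absurd h (not_lt.2 (le_of_lt h'))
    · exact fun h => ⟨Or.inl h, Or.inl h⟩
  obtain ⟨e, he⟩ := exists_equiv_of_cover hW hI hU hV (fun n => subsingleton_of_contractible n)
    (fun n => subsingleton_of_contractible n) n
  let p : C(I, ({0}ᶜ : Set E)) := restrictCM ContinuousMap.fst fun _ h => h
  let q : C(({0}ᶜ : Set E), I) := restrictCM ((ContinuousMap.id E).prodMk
    (ContinuousMap.const E 0)) fun _ h => h
  have hqp : (q.comp p).Homotopic (ContinuousMap.id I) := by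
    refine homotopic_of_segment_subset _ _ fun ⟨⟨x, t⟩, hx⟩ => ?_
    rintro y ⟨a, b, ha, hb, hab, rfl⟩
    change a • x + b • x ≠ 0
    rwa [← add_smul, hab, one_smul]
  have hpq : (p.comp q).Homotopic (ContinuousMap.id _) := .refl _
  refine ⟨e.trans (equiv p q hqp hpq n), fun φ hφ hφ' x => ?_⟩
  rw [LinearEquiv.trans_apply, LinearEquiv.trans_apply, equiv_apply, equiv_apply,
    he (φ.prodMap (ContinuousMap.id ℝ)) (fun z h => h.imp_left fun h => hφ h)
      (fun z h => h.imp_left fun h => hφ h) hφ' (fun z h => hφ h),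
    ← map_comp_apply, ← map_comp_apply]
  rfl

variable {E F G}

lemma NaturalIso.of_equiv {m n : ℕ} (h : NaturalIso E F m n) (Λ : G ≃L[ℝ] F) :
    NaturalIso E G m n := by
  obtain ⟨e, he⟩ := h
  let L : (E × G) ≃L[ℝ] (E × F) := (ContinuousLinearEquiv.refl ℝ E).prodCongr Λ
  obtain ⟨e', he'⟩ := exists_equiv_of_homeomorph L.toHomeomorph (s := {0}ᶜ) (t := {0}ᶜ)
    (fun x hx => (map_ne_zero_iff L L.injective).2 hx)
    (fun x hx => (map_ne_zero_iff L.symm L.symm.injective).2 hx) m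
  refine ⟨e'.trans e, fun φ hφ hφ' x => ?_⟩
  have hφ'' : Set.MapsTo (φ.prodMap (ContinuousMap.id F)) {0}ᶜ {0}ᶜ := by
    intro p hp
    have := hφ' (x := L.symm p) ((map_ne_zero_iff L.symm L.symm.injective).2 hp)
    have := (map_ne_zero_iff L L.injective).2 this
    convert this using 1
    simp [L, Prod.ext_iff]
  rw [LinearEquiv.trans_apply, LinearEquiv.trans_apply, ← he φ hφ hφ'', he', he',
    ← map_comp_apply, ← map_comp_apply]
  rfl

lemma NaturalIso.of_subsingleton [Subsingleton F] (n : ℕ) : NaturalIso E F n n := by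
  let : Unique F := uniqueOfSubsingleton 0
  let L : (E × F) ≃L[ℝ] E := ContinuousLinearEquiv.prodUnique ℝ E F
  obtain ⟨e, he⟩ := exists_equiv_of_homeomorph L.toHomeomorph (s := {0}ᶜ) (t := {0}ᶜ)
    (fun x hx => (map_ne_zero_iff L L.injective).2 hx)
    (fun x hx => (map_ne_zero_iff L.symm L.symm.injective).2 hx) n
  refine ⟨e, fun φ hφ hφ' x => ?_⟩
  rw [he, he, ← map_comp_apply, ← map_comp_apply]
  rfl

lemma NaturalIso.prod_real {m n : ℕ} (h : NaturalIso E F m n) :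
    NaturalIso E (F × ℝ) (m + 1) n := by
  obtain ⟨e, he⟩ := h
  obtain ⟨e₁, he₁⟩ := naturalIso_real (E × F) m
  let L : (E × F × ℝ) ≃L[ℝ] ((E × F) × ℝ) := (ContinuousLinearEquiv.prodAssoc ℝ E F ℝ).symm
  obtain ⟨e', he'⟩ := exists_equiv_of_homeomorph L.toHomeomorph (s := {0}ᶜ) (t := {0}ᶜ)
    (fun x hx => (map_ne_zero_iff L L.injective).2 hx)
    (fun x hx => (map_ne_zero_iff L.symm L.symm.injective).2 hx) (m + 1)
  refine ⟨e'.trans (e₁.trans e), fun φ hφ hφ' x => ?_⟩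
  have h₁ : Set.MapsTo (φ.prodMap (ContinuousMap.id F)) {0}ᶜ {0}ᶜ := by
    rintro ⟨a, b⟩ hp h
    refine hφ' (x := (a, b, 0)) ?_ ?_
    · simpa using hp
    · simpa using h
  have h₂ : Set.MapsTo ((φ.prodMap (ContinuousMap.id F)).prodMap (ContinuousMap.id ℝ))
      {0}ᶜ {0}ᶜ := by
    rintro ⟨p, t⟩ hp h
    rw [Set.mem_singleton_iff, ContinuousMap.prodMap_apply, Prod.map_apply, Prod.mk_eq_zero] at h
    refine h₁ (x := p) (fun hp' => hp ?_) h.1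
    exact Prod.ext hp' h.2
  simp only [LinearEquiv.trans_apply]
  rw [← he φ hφ h₁, ← he₁ _ h₁ h₂, he', he', ← map_comp_apply, ← map_comp_apply]
  rfl

lemma NaturalIso.of_finrank [FiniteDimensional ℝ F] {k : ℕ} (hk : Module.finrank ℝ F = k)
    (n : ℕ) : NaturalIso E F (n + k) n := by
  induction k generalizing F with
  | zero =>
    have := Module.finrank_zero_iff.1 hk
    exact .of_subsingleton n
  | succ k ih =>
    have h := (ih (F := Fin k → ℝ) (by simp)).prod_real
    exact h.of_equiv (.ofFinrankEq (by simp [hk]))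

end AugHomology

/-! ### Homology of spheres -/

namespace AugHomology

variable {X : Type} [TopologicalSpace X]

lemma nonempty_equiv_int_of_isEmpty [IsEmpty X] : Nonempty (AugHomology 0 X ≃ₗ[ℤ] ℤ) := by
  have : IsEmpty C(Simp 1, X) :=
    ⟨fun σ => isEmptyElim (σ (Classical.arbitrary _))⟩
  have : IsEmpty (Simp 0) := ⟨fun t => absurd t.2.2 (by simp)⟩
  have : Subsingleton C(Simp 0, X) := ⟨fun f g => ContinuousMap.ext fun t => isEmptyElim t⟩
  let : Unique C(Simp 0, X) := uniqueOfSubsingleton ⟨isEmptyElim, by fun_prop⟩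
  have hb : (boundaries 0 X).submoduleOf (cycles 0 X) = ⊥ := by
    rw [eq_bot_iff]
    rintro ⟨z, hz⟩ ⟨w, rfl⟩
    rw [Submodule.mem_bot]
    refine Subtype.ext ?_
    change bd 0 X w = 0
    rw [Subsingleton.elim w 0, map_zero]
  exact ⟨(Submodule.quotEquivOfEqBot _ hb).trans
    ((LinearEquiv.ofTop (cycles 0 X) rfl).trans (Finsupp.uniqueLinearEquiv ℤ ℤ default))⟩

/-- The complement of the origin in a `d`-dimensional space has the homology of `S^{d-1}`. -/
lemma nonempty_punctured_equiv_int (F : Type) [NormedAddCommGroup F] [NormedSpace ℝ F]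
    [FiniteDimensional ℝ F] {d : ℕ} (hd : Module.finrank ℝ F = d) :
    Nonempty (AugHomology d ({0}ᶜ : Set F) ≃ₗ[ℤ] ℤ) := by
  obtain ⟨e, -⟩ := NaturalIso.of_finrank (E := Fin 0 → ℝ) hd 0
  rw [Nat.zero_add] at e
  have : IsEmpty ↥({0}ᶜ : Set (Fin 0 → ℝ)) := ⟨fun x => x.2 (Subsingleton.elim _ _)⟩
  obtain ⟨c⟩ := nonempty_equiv_int_of_isEmpty (X := ↥({0}ᶜ : Set (Fin 0 → ℝ)))
  let L : ((Fin 0 → ℝ) × F) ≃L[ℝ] F := ContinuousLinearEquiv.uniqueProd ℝ F (Fin 0 → ℝ)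
  obtain ⟨e', -⟩ := exists_equiv_of_homeomorph L.toHomeomorph (s := {0}ᶜ) (t := {0}ᶜ)
    (fun x hx => (map_ne_zero_iff L L.injective).2 hx)
    (fun x hx => (map_ne_zero_iff L.symm L.symm.injective).2 hx) d
  exact ⟨e'.symm.trans (e.trans c)⟩

/-- If `ι` identifies `X` with the unit sphere of `V`, then `ι` is a homology isomorphism from `X`
to the complement of the origin. -/
lemma exists_equiv_punctured {V : Type} [NormedAddCommGroup V] [NormedSpace ℝ V]
    (ι : C(X, ({0}ᶜ : Set V))) (hι : ∀ x, ‖(ι x : V)‖ = 1) (hinj : Function.Injective ι)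
    (ρ : C(({0}ᶜ : Set V), X)) (hρ : ∀ v, (ι (ρ v) : V) = ‖(v : V)‖⁻¹ • (v : V)) (n : ℕ) :
    ∃ e : AugHomology n X ≃ₗ[ℤ] AugHomology n ({0}ᶜ : Set V), ∀ x, e x = map ι n x := by
  have h₁ : (ρ.comp ι).Homotopic (ContinuousMap.id X) := by
    convert ContinuousMap.Homotopic.refl _
    ext x
    refine hinj (Subtype.ext ?_)
    simp [hρ, hι]
  have h₂ : (ι.comp ρ).Homotopic (ContinuousMap.id _) := by
    refine homotopic_of_segment_subset _ _ fun v => ?_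
    rintro y ⟨a, b, ha, hb, hab, rfl⟩
    have hv : (v : V) ≠ 0 := v.2
    change a • (ι (ρ v) : V) + b • (v : V) ≠ 0
    rw [hρ, smul_smul, ← add_smul]
    refine smul_ne_zero (ne_of_gt ?_) hv
    have : 0 < ‖(v : V)‖⁻¹ := by positivity
    rcases ha.eq_or_lt with rfl | ha
    · simp at hab; simp [hab]
    · positivity
  exact ⟨equiv ι ρ h₁ h₂ n, fun x => rfl⟩

end AugHomology

lemma LinearMap.eq_zero_of_map_eq_zero_of_equiv_int {M : Type} [AddCommGroup M]
    (c : M ≃ₗ[ℤ] ℤ) {f : M →ₗ[ℤ] M} (hf : f ≠ 0) {x : M} (hx : f x = 0) : x = 0 := by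
  by_contra hx0
  refine hf (LinearMap.ext fun y => ?_)
  have hc : c x ≠ 0 := (map_ne_zero_iff c c.injective).2 hx0
  have hxy : c x • y = c y • x := c.injective (by simp [mul_comm])
  have h : c x • f y = 0 := by rw [← map_smul, hxy, map_smul, hx, smul_zero]
  refine c.injective ?_
  simpa [hc] using congr(c $h)

/-! ### Radial extension -/

section Radial

variable {E : Type} [NormedAddCommGroup E] [NormedSpace ℝ E]

lemma inv_norm_smul_mem_closedBall_zero (x : E) : ‖x‖⁻¹ • x ∈ Metric.closedBall (0 : E) 1 := by
  rw [mem_closedBall_zero_iff, norm_smul, norm_inv, norm_norm]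
  exact inv_mul_le_one

/-- The positively homogeneous extension of the restriction of `g` to the unit sphere. -/
noncomputable def radialExtension
    (g : C(Metric.closedBall (0 : E) 1, Metric.closedBall (0 : E) 1)) : C(E, E) where
  toFun x := ‖x‖ • (g ⟨‖x‖⁻¹ • x, inv_norm_smul_mem_closedBall_zero x⟩ : E)
  continuous_toFun := by
    rw [continuous_iff_continuousAt]
    intro x
    by_cases hx : x = 0
    · subst hx
      simp only [ContinuousAt, norm_zero, zero_smul]
      rw [tendsto_zero_iff_norm_tendsto_zero]
      refine squeeze_zero (fun _ => norm_nonneg _) (fun y => ?_) tendsto_norm_zero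
      rw [norm_smul, norm_norm]
      exact mul_le_of_le_one_right (norm_nonneg _) (mem_closedBall_zero_iff.1 (g _).2)
    · have h : ContinuousAt (fun y : E => ‖y‖⁻¹ • y) x :=
        (continuous_norm.continuousAt.inv₀ (norm_ne_zero_iff.2 hx)).smul continuousAt_id
      refine continuous_norm.continuousAt.smul ?_
      exact (continuous_subtype_val.comp g.continuous).continuousAt.comp
        (Topology.IsInducing.subtypeVal.continuousAt_iff.2 h)

variable (g : C(Metric.closedBall (0 : E) 1, Metric.closedBall (0 : E) 1))

lemma radialExtension_of_norm_eq_one {x : Metric.closedBall (0 : E) 1} (hx : ‖(x : E)‖ = 1) :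
    radialExtension g x = g x := by
  simp [radialExtension, hx]

lemma radialExtension_ne_zero 
    (hg : ∀ x : Metric.closedBall (0 : E) 1, ‖(x : E)‖ = 1 → ‖(g x : E)‖ = 1) {x : E} (hx : x ≠ 0) :
    radialExtension g x ≠ 0 := by
  refine smul_ne_zero (norm_ne_zero_iff.2 hx) (norm_ne_zero_iff.1 ?_)
  rw [hg _ (norm_smul_inv_norm (𝕜 := ℝ) hx)]
  exact one_ne_zero

end Radial

/-! ### The boundary of a product of balls -/

section Boundary

variable (E F : Type) [NormedAddCommGroup E] [NormedAddCommGroup F]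

/-- The unit sphere as a subset of the closed unit ball. -/
abbrev ballSphere : Set (Metric.closedBall (0 : E) 1) := {x | ‖(x : E)‖ = 1}

/-- The boundary of the product of two closed unit balls. -/
abbrev prodSphere : Set (Metric.closedBall (0 : E) 1 × Metric.closedBall (0 : F) 1) :=
  ballSphere E ×ˢ Set.univ ∪ Set.univ ×ˢ ballSphere F

/-- The inclusion of the unit sphere into the complement of the origin. -/
def ballSphereIncl : C(ballSphere E, ({0}ᶜ : Set E)) :=
  restrictCM ⟨Subtype.val, continuous_subtype_val⟩ fun _ hx =>
    norm_ne_zero_iff.1 (hx.trans_ne one_ne_zero)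

variable {E F} in
lemma norm_eq_one_of_mem_prodSphere {p : Metric.closedBall (0 : E) 1 × Metric.closedBall (0 : F) 1}
    (hp : p ∈ prodSphere E F) : ‖((p.1 : E), (p.2 : F))‖ = 1 := by
  have h₁ := mem_closedBall_zero_iff.1 p.1.2
  have h₂ := mem_closedBall_zero_iff.1 p.2.2
  rw [Prod.norm_mk]
  rcases hp with ⟨h, -⟩ | ⟨-, h⟩
  · have h : ‖(p.1 : E)‖ = 1 := h
    rw [h, max_eq_left h₂]
  · have h : ‖(p.2 : F)‖ = 1 := h
    rw [h, max_eq_right h₁]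

/-- The inclusion of the boundary of the product of the unit balls into the complement of the
origin. -/
def prodSphereIncl : C(prodSphere E F, ({0}ᶜ : Set (E × F))) :=
  restrictCM ⟨Prod.map Subtype.val Subtype.val, by fun_prop⟩ fun _ hp =>
    norm_ne_zero_iff.1 ((norm_eq_one_of_mem_prodSphere hp).trans_ne one_ne_zero)

variable {E} in
lemma mapsTo_prodSphere {g : C(Metric.closedBall (0 : E) 1, Metric.closedBall (0 : E) 1)}
    (hg : Set.MapsTo g (ballSphere E) (ballSphere E)) :
    Set.MapsTo (g.prodMap (ContinuousMap.id (Metric.closedBall (0 : F) 1)))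
      (prodSphere E F) (prodSphere E F) := by
  rintro p (hp | hp)
  · exact Or.inl ⟨hg hp.1, trivial⟩
  · exact Or.inr ⟨trivial, hp.2⟩

variable [NormedSpace ℝ E] [NormedSpace ℝ F]

lemma continuous_inv_norm_smul : Continuous fun x : ({0}ᶜ : Set E) => ‖(x : E)‖⁻¹ • (x : E) :=
  (continuous_subtype_val.norm.inv₀ fun x => norm_ne_zero_iff.2 x.2).smul continuous_subtype_val

lemma exists_equiv_ballSphere (n : ℕ) :
    ∃ e : AugHomology n (ballSphere E) ≃ₗ[ℤ] AugHomology n ({0}ᶜ : Set E),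
      ∀ x, e x = AugHomology.map (ballSphereIncl E) n x := by
  refine AugHomology.exists_equiv_punctured (ballSphereIncl E) (fun x => x.2)
    (fun x y h => Subtype.ext (Subtype.ext congr(($h : E))))
    ⟨fun x => ⟨⟨‖(x : E)‖⁻¹ • (x : E), inv_norm_smul_mem_closedBall_zero _⟩,
      norm_smul_inv_norm (𝕜 := ℝ) x.2⟩, ?_⟩ (fun v => rfl) n
  exact ((continuous_inv_norm_smul E).subtype_mk _).subtype_mk _

lemma exists_equiv_prodSphere (n : ℕ) :
    ∃ e : AugHomology n (prodSphere E F) ≃ₗ[ℤ] AugHomology n ({0}ᶜ : Set (E × F)),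
      ∀ x, e x = AugHomology.map (prodSphereIncl E F) n x := by
  have h (v : E × F) := mem_closedBall_zero_iff.1 (inv_norm_smul_mem_closedBall_zero v)
  have hc := continuous_inv_norm_smul (E × F)
  refine AugHomology.exists_equiv_punctured (prodSphereIncl E F)
    (fun x => norm_eq_one_of_mem_prodSphere x.2)
    (fun x y h => Subtype.ext (Prod.ext (Subtype.ext congr(($h : E × F).1))
      (Subtype.ext congr(($h : E × F).2))))
    ⟨fun x => ⟨(⟨‖(x : E × F)‖⁻¹ • (x : E × F).1,
        mem_closedBall_zero_iff.2 ((norm_fst_le _).trans (h x))⟩,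
      ⟨‖(x : E × F)‖⁻¹ • (x : E × F).2,
        mem_closedBall_zero_iff.2 ((norm_snd_le _).trans (h x))⟩), ?_⟩, ?_⟩ (fun v => rfl) n
  · have hx : ‖‖(x : E × F)‖⁻¹ • (x : E × F)‖ = 1 := norm_smul_inv_norm (𝕜 := ℝ) x.2
    rw [Prod.norm_def] at hx
    rcases max_choice ‖(‖(x : E × F)‖⁻¹ • (x : E × F)).1‖ ‖(‖(x : E × F)‖⁻¹ • (x : E × F)).2‖
      with hm | hm
    · exact Or.inl ⟨hm.symm.trans hx, trivial⟩
    · exact Or.inr ⟨trivial, hm.symm.trans hx⟩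
  · exact ((hc.fst.subtype_mk _).prodMk (hc.snd.subtype_mk _)).subtype_mk _

variable {E} {g : C(Metric.closedBall (0 : E) 1, Metric.closedBall (0 : E) 1)}
  (hg : Set.MapsTo g (ballSphere E) (ballSphere E))

lemma homotopic_prodSphereIncl
    (hφ : Set.MapsTo ((radialExtension g).prodMap (ContinuousMap.id F)) {0}ᶜ {0}ᶜ) :
    ((prodSphereIncl E F).comp (restrictCM _ (mapsTo_prodSphere F hg))).Homotopic
      ((restrictCM _ hφ).comp (prodSphereIncl E F)) := by
  refine homotopic_of_segment_subset _ _ fun p => ?_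
  obtain ⟨⟨x, y⟩, hp⟩ := p
  rintro z ⟨a, b, ha, hb, hab, rfl⟩ h
  change a • ((g x : E), (y : F)) + b • (radialExtension g x, (y : F)) = 0 at h
  rw [Prod.smul_mk, Prod.smul_mk, Prod.mk_add_mk, ← add_smul, hab, one_smul,
    Prod.mk_eq_zero] at h
  obtain ⟨h₁, h₂⟩ := h
  rcases hp with ⟨hx, -⟩ | ⟨-, hy⟩
  · have hx' : ‖(g x : E)‖ = 1 := hg hx
    rw [radialExtension_of_norm_eq_one g hx, ← add_smul, hab, one_smul] at h₁
    simp [h₁] at hx'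
  · have hy : ‖(y : F)‖ = 1 := hy
    simp [h₂] at hy

lemma AugHomology.map_prodSphere_injective [FiniteDimensional ℝ E] [FiniteDimensional ℝ F]
    {d e : ℕ} (hd : Module.finrank ℝ E = d) (he : Module.finrank ℝ F = e)
    (h : AugHomology.map (restrictCM g hg) d ≠ 0) (y)
    (hy : AugHomology.map (restrictCM _ (mapsTo_prodSphere F hg)) (d + e) y = 0) : y = 0 := by
  have hg' : ∀ x : Metric.closedBall (0 : E) 1, ‖(x : E)‖ = 1 → ‖(g x : E)‖ = 1 := fun x hx => hg hx
  have hφ : Set.MapsTo (radialExtension g) {0}ᶜ {0}ᶜ := fun x hx =>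
    radialExtension_ne_zero g hg' hx
  have hφ' : Set.MapsTo ((radialExtension g).prodMap (ContinuousMap.id F)) {0}ᶜ {0}ᶜ := by
    rintro ⟨a, b⟩ hp h
    obtain ⟨ha, hb⟩ := Prod.mk_eq_zero.1 h
    exact hp (Prod.ext (not_not.1 fun h => radialExtension_ne_zero g hg' h ha) hb)
  obtain ⟨i, hi⟩ := exists_equiv_ballSphere E d
  obtain ⟨j, hj⟩ := exists_equiv_prodSphere E F (d + e)
  obtain ⟨k, hk⟩ := NaturalIso.of_finrank (E := E) he d
  obtain ⟨c⟩ := nonempty_punctured_equiv_int E hd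
  have hij (x) : i (map (restrictCM g hg) d x) = map (restrictCM _ hφ) d (i x) := by
    rw [hi, hi, ← map_comp_apply, ← map_comp_apply]
    congr 2
    ext x
    exact (radialExtension_of_norm_eq_one g x.2).symm
  have hj0 : map (restrictCM _ hφ') _ (j y) = 0 := by
    rw [hj, ← map_comp_apply, ← map_eq_of_homotopic (homotopic_prodSphereIncl F hg hφ'),
      map_comp_apply, hy, map_zero]
  have hi0 : i (map (restrictCM g hg) d (i.symm (k (j y)))) = 0 := by
    rw [hij, LinearEquiv.apply_symm_apply, ← hk _ hφ hφ', hj0, map_zero]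
  simpa using LinearMap.eq_zero_of_map_eq_zero_of_equiv_int (i.trans c) h
    (i.map_eq_zero_iff.1 hi0)

lemma AugHomology.nontrivial_prodSphere [FiniteDimensional ℝ E] [FiniteDimensional ℝ F]
    {d e : ℕ} (hd : Module.finrank ℝ E = d) (he : Module.finrank ℝ F = e) :
    Nontrivial (AugHomology (d + e) (prodSphere E F)) := by
  obtain ⟨j, -⟩ := exists_equiv_prodSphere E F (d + e)
  obtain ⟨c⟩ := nonempty_punctured_equiv_int (E × F) (d := d + e) (by simp [hd, he])
  exact (j.trans c).toEquiv.nontrivial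

end Boundary

/-- Let `d, e ≥ 1` and let `g : Dᵈ → Dᵈ` be a continuous map with
`g(S^{d-1}) ⊆ S^{d-1}` inducing a nonzero homomorphism on the reduced singular homology
`H̃_{d-1}(S^{d-1})`.  Then `F = g × id` maps `∂(Dᵈ × Dᵉ) = (S^{d-1} × Dᵉ) ∪ (Dᵈ × S^{e-1})`
into itself, and the induced homomorphism on `H̃_{d+e-1}(∂(Dᵈ × Dᵉ))` is injective;
in particular it is nonzero. -/
theorem prod_id_nontrivial (d e : ℕ) (hd : 1 ≤ d) (he : 1 ≤ e)
    (g : C(unitBall d, unitBall d))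
    (hgb : Set.MapsTo g (unitSpherePart d) (unitSpherePart d))
    (hgnt : SHmapNontrivial (d - 1) (restrictCM g hgb)) :
    ∃ hF : Set.MapsTo (g.prodMap (ContinuousMap.id (unitBall e)))
        ((unitSpherePart d ×ˢ (Set.univ : Set (unitBall e))) ∪
          ((Set.univ : Set (unitBall d)) ×ˢ unitSpherePart e))
        ((unitSpherePart d ×ˢ (Set.univ : Set (unitBall e))) ∪
          ((Set.univ : Set (unitBall d)) ×ˢ unitSpherePart e)),
      (∀ x ∈ reducedSH (d + e - 1)
          ((unitSpherePart d ×ˢ (Set.univ : Set (unitBall e))) ∪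
            ((Set.univ : Set (unitBall d)) ×ˢ unitSpherePart e) :
              Set (unitBall d × unitBall e)),
        SHmap (d + e - 1) (restrictCM (g.prodMap (ContinuousMap.id (unitBall e))) hF) x = 0 →
          x = 0) ∧
      SHmapNontrivial (d + e - 1)
        (restrictCM (g.prodMap (ContinuousMap.id (unitBall e))) hF) := by
  obtain ⟨d, rfl⟩ := Nat.exists_eq_add_of_le' hd
  obtain ⟨e, rfl⟩ := Nat.exists_eq_add_of_le' he
  rw [AugHomology.SHmapNontrivial_iff] at hgnt
  have hinj := AugHomology.map_prodSphere_injective (EuclideanSpace ℝ (Fin (e + 1))) hgb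
    finrank_euclideanSpace_fin finrank_euclideanSpace_fin hgnt
  have hnt := AugHomology.nontrivial_prodSphere (E := EuclideanSpace ℝ (Fin (d + 1)))
    (EuclideanSpace ℝ (Fin (e + 1))) finrank_euclideanSpace_fin finrank_euclideanSpace_fin
  refine ⟨mapsTo_prodSphere _ hgb, (AugHomology.map_injective_iff_SHmap _).2 hinj,
    (AugHomology.SHmapNontrivial_iff _).2 fun h => ?_⟩
  obtain ⟨y, hy⟩ := exists_ne (0 : AugHomology (d + 1 + (e + 1))
    (prodSphere (EuclideanSpace ℝ (Fin (d + 1))) (EuclideanSpace ℝ (Fin (e + 1)))))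
  exact hy (hinj y congr($h y))
end

section
/- Let m ≥ 1 and u ≥ 1 be integers. Let A be a topological space, U ⊆ ℝᵘ an open neighborhood of 0, h₁ : A → ℝᵐ continuous with h₁(A) = (−1,1)^{m−1} × {0}, and h₂ : U → ℝᵐ continuous with h₂(U) ⊆ (−1,1)ᵐ (ℝᵐ carrying the Euclidean metric). Suppose the m-th coordinate of h₂(0) equals 0, and suppose h₁ and h₂ are C⁰ transverse at every pair (a, b) ∈ A × U with h₁(a) = h₂(b). Then there exists an embedded closed arc B_u ⊆ U (a subset homeomorphic to [0,1]) whose two endpoints v₁, v₂ satisfy: 0 ∈ B_u ∖ {v₁, v₂}; the m-th coordinate of h₂(v₁) is strictly positive and the m-th coordinate of h₂(v₂) is strictly negative; consequently h₂({v₁, v₂}) ⊆ (−1,1)ᵐ ∖ ((−1,1)^{m−1} × {0}), and the restriction of h₂ to the two-point set {v₁, v₂} induces a nonzero homomorphism H̃₀({v₁, v₂}) → H̃₀((−1,1)ᵐ ∖ ((−1,1)^{m−1} × {0})) of reduced singular homology groups with integer coefficients. -/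
open CategoryTheory

/-- The intersection `h₁(C) ∩ h₂(D)` is `δ`-essential: for all continuous maps `h₁'`, `h₂'`
within uniform `C⁰` distance `δ` of `h₁`, `h₂` respectively, the images `h₁'(C)` and `h₂'(D)`
still intersect. -/
def DeltaEssential {A B M : Type*} [TopologicalSpace A] [TopologicalSpace B] [MetricSpace M]
    (h₁ : C(A, M)) (h₂ : C(B, M)) (Cs : Set A) (Ds : Set B) (δ : ℝ) : Prop :=
  ∀ (h₁' : C(A, M)) (h₂' : C(B, M)),
    (∀ x : A, dist (h₁ x) (h₁' x) ≤ δ) → (∀ y : B, dist (h₂ y) (h₂' y) ≤ δ) →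
    (h₁' '' Cs ∩ h₂' '' Ds).Nonempty

/-- `h₁` and `h₂` are `C⁰` transverse at the pair `(a, b)`: for all neighborhoods `Ua` of `a`
and `Ub` of `b` there is `δ > 0` such that the intersection `h₁(Ua) ∩ h₂(Ub)` is
`δ`-essential. -/
def C0TransverseAt {A B M : Type*} [TopologicalSpace A] [TopologicalSpace B] [MetricSpace M]
    (h₁ : C(A, M)) (h₂ : C(B, M)) (a : A) (b : B) : Prop :=
  ∀ Ua ∈ nhds a, ∀ Ub ∈ nhds b, ∃ δ > (0 : ℝ), DeltaEssential h₁ h₂ Ua Ub δ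

/-- The last coordinate index of `Fin m` for `m ≥ 1`. -/
def lastIndex (m : ℕ) (hm : 1 ≤ m) : Fin m := ⟨m - 1, by omega⟩

/-- The open cube `(-1, 1)ᵐ` in `ℝᵐ`. -/
def openCube (m : ℕ) : Set (EuclideanSpace ℝ (Fin m)) :=
  {y | ∀ i : Fin m, y i ∈ Set.Ioo (-1 : ℝ) 1}

/-- The slice `(-1, 1)^{m-1} × {0}` in `ℝᵐ`: the first `m - 1` coordinates lie in `(-1, 1)` and
the last coordinate is `0`. -/
def openSlice (m : ℕ) : Set (EuclideanSpace ℝ (Fin m)) :=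
  {y | ∀ i : Fin m, ((i : ℕ) + 1 < m → y i ∈ Set.Ioo (-1 : ℝ) 1) ∧
    ((i : ℕ) + 1 = m → y i = 0)}


/-- The singular `0`-chain of a point. -/
noncomputable def pointChain {X : Type} [TopologicalSpace X] (x : X) :
    (singularChains.obj (TopCat.of X)).X 0 :=
  ModuleCat.freeMk (R := ℤ) (TopCat.toSSetObj₀Equiv (X := TopCat.of X).symm x)

lemma singularChains_map_pointChain {X Y : Type} [TopologicalSpace X] [TopologicalSpace Y]
    (f : C(X, Y)) (x : X) :
    (singularChains.map (X := TopCat.of X) (Y := TopCat.of Y) (TopCat.ofHom f)).f 0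
      (pointChain x) = pointChain (f x) :=
  ModuleCat.free_map_apply _ _

/-- The class of a point in zeroth singular homology. -/
noncomputable def pointClass {X : Type} [TopologicalSpace X] (x : X) :
    (SH 0).obj (TopCat.of X) :=
  ((singularChains.obj (TopCat.of X)).pOpcycles 0 ≫
    (singularChains.obj (TopCat.of X)).isoHomologyι₀.inv) (pointChain x)

lemma SHmap_pointClass {X Y : Type} [TopologicalSpace X] [TopologicalSpace Y]
    (f : C(X, Y)) (x : X) : SHmap 0 f (pointClass x) = pointClass (f x) := by
  let F := singularChains.map (X := TopCat.of X) (Y := TopCat.of Y) (TopCat.ofHom f)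
  have h : (singularChains.obj (TopCat.of X)).pOpcycles 0 ≫
      (singularChains.obj (TopCat.of X)).isoHomologyι₀.inv ≫ HomologicalComplex.homologyMap F 0 =
      F.f 0 ≫ (singularChains.obj (TopCat.of Y)).pOpcycles 0 ≫
      (singularChains.obj (TopCat.of Y)).isoHomologyι₀.inv := by
    rw [ChainComplex.isoHomologyι₀_inv_naturality, HomologicalComplex.p_opcyclesMap_assoc]
  refine (ConcreteCategory.congr_hom h (pointChain x)).trans ?_
  rw [ConcreteCategory.comp_apply, singularChains_map_pointChain, pointClass]

/-- A continuous integer-valued function induces a functional on zeroth singular homology. -/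
lemma exists_hom_pointClass {X : Type} [TopologicalSpace X] (φ : C(X, ℤ)) :
    ∃ ψ : (SH 0).obj (TopCat.of X) ⟶ ModuleCat.of ℤ ℤ, ∀ x, ψ (pointClass x) = φ x := by
  let K := singularChains.obj (TopCat.of X)
  let S := TopCat.toSSet.obj (TopCat.of X)
  let k : K.X 0 ⟶ ModuleCat.of ℤ ℤ := ModuleCat.freeDesc (R := ℤ) (M := ModuleCat.of ℤ ℤ)
    (↾fun s => φ (TopCat.toSSetObj₀Equiv (X := TopCat.of X) s))
  have hk : K.d 1 0 ≫ k = 0 := by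
    let d (i : Fin 2) : K.X 1 ⟶ K.X 0 := (ModuleCat.free ℤ).map (S.δ i)
    have hd : K.d 1 0 = d 0 - d 1 := by
      refine (AlgebraicTopology.alternatingFaceMapComplex_obj_d _ _).trans ?_
      rw [AlgebraicTopology.AlternatingFaceMapComplex.objD, Fin.sum_univ_two]
      change (-1 : ℤ) ^ 0 • d 0 + (-1 : ℤ) ^ 1 • d 1 = d 0 - d 1
      rw [pow_zero, pow_one, one_smul, neg_smul, one_smul, sub_eq_add_neg]
    rw [hd, Preadditive.sub_comp, sub_eq_zero]
    refine ModuleCat.free_hom_ext fun s => ?_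
    have key : φ (TopCat.toSSetObj₀Equiv (S.δ 0 s)) = φ (TopCat.toSSetObj₀Equiv (S.δ 1 s)) := by
      rw [← TopCat.toSSetObj₁Equiv_apply_zero, ← TopCat.toSSetObj₁Equiv_apply_one]
      have : PreconnectedSpace TopCat.I.{0} :=
        TopCat.I.homeomorph.symm.surjective.denseRange.preconnectedSpace
          TopCat.I.homeomorph.symm.continuous
      exact PreconnectedSpace.constant this
        (φ.comp (TopCat.toSSetObj₁Equiv s).hom).continuous
    have hi (i : Fin 2) : k ((ModuleCat.free ℤ).map (S.δ i) (ModuleCat.freeMk s)) =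
        φ (TopCat.toSSetObj₀Equiv (S.δ i s)) := by
      rw [ModuleCat.free_map_apply]
      exact ModuleCat.freeDesc_apply _ _
    exact (hi 0).trans (key.trans (hi 1).symm)
  refine ⟨K.isoHomologyι₀.hom ≫ K.descOpcycles k 1 (by simp) hk, fun x => ?_⟩
  have h : (K.pOpcycles 0 ≫ K.isoHomologyι₀.inv) ≫ K.isoHomologyι₀.hom ≫
    K.descOpcycles k 1 (by simp) hk = k := by simp
  refine (ConcreteCategory.congr_hom h (pointChain x)).trans ?_
  refine (ModuleCat.freeDesc_apply _ _).trans ?_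
  simp

lemma SHmapNontrivial_zero_of_isClopen {X Y : Type} [TopologicalSpace X] [TopologicalSpace Y]
    (f : C(X, Y)) {S : Set Y} (hS : IsClopen S) {x y : X} (hx : f x ∈ S) (hy : f y ∉ S) :
    SHmapNontrivial 0 f := by
  obtain ⟨ψ, hψ⟩ := exists_hom_pointClass (X := Y)
    ⟨LocallyConstant.charFn ℤ hS, (LocallyConstant.charFn ℤ hS).continuous⟩
  refine ⟨pointClass x - pointClass y, ?_, fun h => ?_⟩
  · simp [reducedSH, SHmap_pointClass]
  · have := congrArg ψ h
    rw [map_sub, map_sub, SHmap_pointClass, SHmap_pointClass, hψ, hψ] at this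
    simp [LocallyConstant.coe_charFn, hx, hy] at this

lemma openSlice_apply_lastIndex {m : ℕ} (hm : 1 ≤ m) {y : EuclideanSpace ℝ (Fin m)}
    (hy : y ∈ openSlice m) : y (lastIndex m hm) = 0 :=
  (hy _).2 (by simp only [lastIndex]; omega)

lemma mem_openSlice_of_mem_openCube {m : ℕ} (hm : 1 ≤ m) {y : EuclideanSpace ℝ (Fin m)}
    (hy : y ∈ openCube m) (h0 : y (lastIndex m hm) = 0) : y ∈ openSlice m := by
  refine fun i => ⟨fun _ => hy i, fun hi => ?_⟩
  have : i = lastIndex m hm := Fin.ext (by simp only [lastIndex]; omega)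
  rwa [this]

/-- Near a pair where `h₁` and `h₂` are `C⁰` transverse and where a coordinate vanishes
identically along `h₁`, that coordinate of `h₂` takes
values of the same sign as any given `s ≠ 0`. -/
lemma C0TransverseAt.exists_pos {A B ι : Type*} [TopologicalSpace A] [TopologicalSpace B]
    [Fintype ι] [DecidableEq ι]
    {h₁ : C(A, EuclideanSpace ℝ ι)} {h₂ : C(B, EuclideanSpace ℝ ι)} {a : A} {b : B} {i : ι}
    (h : C0TransverseAt h₁ h₂ a b) (hi : ∀ x, h₁ x i = 0) {s : ℝ} (hs : s ≠ 0)
    {V : Set B} (hV : V ∈ nhds b) : ∃ v ∈ V, 0 < s * h₂ v i := by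
  obtain ⟨δ, hδ, hess⟩ := h Set.univ Filter.univ_mem V hV
  by_contra! hcon
  let t : ℝ := -(δ / |s|) * s
  have ht : |t| = δ := by
    simp only [t, abs_mul, abs_neg, abs_div, abs_abs, abs_of_pos hδ]
    field_simp
  obtain ⟨_, ⟨x, -, rfl⟩, v, hv, hxv⟩ := hess h₁ ⟨fun y => h₂ y + EuclideanSpace.single i t,
    by fun_prop⟩ (fun x => by simp [hδ.le]) (fun y => by simp [dist_eq_norm, ht])
  have h0 : h₂ v i + t = 0 := by
    have := congrArg (fun z : EuclideanSpace ℝ ι => z i) hxv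
    simpa [hi] using this
  have h1 := hcon v hv
  have h2 : h₂ v i = (δ / |s|) * s := by simp only [t] at h0; linarith
  rw [h2] at h1
  have : 0 < δ / |s| * (s * s) := mul_pos (div_pos hδ (abs_pos.2 hs)) (mul_self_pos.2 hs)
  nlinarith

/-- If `f` takes both signs arbitrarily close to each of its zeros, then near a zero `0` it takes
both signs at two points lying on different rays from the origin. -/
lemma exists_pos_neg_not_sameRay {E : Type*} [NormedAddCommGroup E] [InnerProductSpace ℝ E]
    {f : E → ℝ} {r : ℝ} (hr : 0 < r) (h0 : f 0 = 0)
    (hf : ∀ z ∈ Metric.ball (0 : E) r, f z = 0 → ∀ V ∈ nhds z,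
      (∃ v ∈ V, 0 < f v) ∧ ∃ v ∈ V, f v < 0) :
    ∃ p ∈ Metric.ball (0 : E) r, ∃ q ∈ Metric.ball (0 : E) r,
      0 < f p ∧ f q < 0 ∧ ¬ SameRay ℝ p q := by
  have hball := Metric.ball_mem_nhds (0 : E) hr
  obtain ⟨⟨p, hp, hfp⟩, q, hq, hfq⟩ := hf 0 (Metric.mem_ball_self hr) h0 _ hball
  by_cases hpq : SameRay ℝ p q
  swap
  · exact ⟨p, hp, q, hq, hfp, hfq, hpq⟩
  have hp0 : p ≠ 0 := by rintro rfl; linarith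
  have hq0 : q ≠ 0 := by rintro rfl; linarith
  have hnp : -p ∈ Metric.ball (0 : E) r := by simpa using hp
  have hW : Metric.ball (0 : E) r ∩ {x | inner ℝ x p < 0} ∈ nhds (-p) := by
    refine (Metric.isOpen_ball.inter
      (isOpen_lt (by fun_prop) continuous_const)).mem_nhds ⟨hnp, ?_⟩
    simp [hp0]
  obtain ⟨p', ⟨hp', hin⟩, hfp'⟩ : ∃ v ∈ Metric.ball (0 : E) r ∩ {x | inner ℝ x p < 0},
      f v ≠ 0 := by
    by_cases h : f (-p) = 0
    · obtain ⟨v, hv, hfv⟩ := (hf _ hnp h _ hW).1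
      exact ⟨v, hv, hfv.ne'⟩
    · exact ⟨-p, mem_of_mem_nhds hW, h⟩
  have key : ¬ SameRay ℝ p p' := by
    intro h
    obtain ⟨c, hc, rfl⟩ := h.exists_nonneg_left hp0
    simp only [Set.mem_ofPred_eq, real_inner_smul_left] at hin
    exact absurd hin (not_lt.2 (mul_nonneg hc real_inner_self_nonneg))
  rcases hfp'.lt_or_gt with h | h
  · exact ⟨p, hp, p', hp', hfp, h, key⟩
  · refine ⟨p', hp', q, hq, h, hfq, fun h' => key ?_⟩
    exact (hpq.trans h'.symm fun h => absurd h hq0)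

/-- The broken line from `p` through the origin to `q`. -/
def brokenLine {E : Type*} [NormedAddCommGroup E] [NormedSpace ℝ E] (p q : E) (t : ℝ) : E :=
  max (1 - 2 * t) 0 • p + max (2 * t - 1) 0 • q

lemma continuous_brokenLine {E : Type*} [NormedAddCommGroup E] [NormedSpace ℝ E] (p q : E) :
    Continuous (brokenLine p q) := by
  unfold brokenLine; fun_prop

lemma brokenLine_mem {E : Type*} [NormedAddCommGroup E] [NormedSpace ℝ E] {p q : E} {s : Set E}
    (hs : Convex ℝ s) (h0 : 0 ∈ s) (hp : p ∈ s) (hq : q ∈ s) {t : ℝ} (ht : t ∈ Set.Icc (0 : ℝ) 1) :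
    brokenLine p q t ∈ s := by
  obtain ⟨h1, h2⟩ := ht
  rcases le_total t (1 / 2) with h | h
  · rw [brokenLine, max_eq_left (by linarith), max_eq_right (by linarith), zero_smul, add_zero]
    exact hs.smul_mem_of_zero_mem h0 hp ⟨by linarith, by linarith⟩
  · rw [brokenLine, max_eq_right (by linarith), max_eq_left (by linarith), zero_smul, zero_add]
    exact hs.smul_mem_of_zero_mem h0 hq ⟨by linarith, by linarith⟩

lemma brokenLine_injective {E : Type*} [NormedAddCommGroup E] [NormedSpace ℝ E] {p q : E}
    (h : ¬ SameRay ℝ p q) : Function.Injective (brokenLine p q) := by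
  have hp : p ≠ 0 := by rintro rfl; exact h (SameRay.zero_left q)
  have hq : q ≠ 0 := by rintro rfl; exact h (SameRay.zero_right p)
  intro s t hst
  wlog hle : s ≤ t generalizing s t
  · exact (this hst.symm (le_of_not_ge hle)).symm
  unfold brokenLine at hst
  rcases le_total t (1 / 2) with ht | ht
  · rw [max_eq_left (by linarith), max_eq_right (by linarith), max_eq_left (by linarith),
      max_eq_right (by linarith), zero_smul, add_zero, add_zero] at hst
    have := smul_left_injective ℝ hp hst
    linarith
  rcases le_total s (1 / 2) with hs | hs
  · rw [max_eq_left (by linarith), max_eq_right (by linarith), max_eq_right (by linarith),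
      max_eq_left (by linarith), zero_smul, add_zero, zero_smul, zero_add] at hst
    rcases hs.eq_or_lt with rfl | hs
    · have h0 : (2 * t - 1) • q = 0 := by simpa using hst.symm
      have := (smul_eq_zero.1 h0).resolve_right hq
      linarith
    rcases ht.eq_or_lt with rfl | ht
    · have h0 : (1 - 2 * s) • p = 0 := by simpa using hst
      have := (smul_eq_zero.1 h0).resolve_right hp
      linarith
    exact absurd (Or.inr (Or.inr ⟨_, _, by linarith, by linarith, hst⟩)) h
  · rw [max_eq_right (by linarith), max_eq_left (by linarith), max_eq_right (by linarith),
      max_eq_left (by linarith), zero_smul, zero_add, zero_add] at hst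
    have := smul_left_injective ℝ hq hst
    linarith

lemma isClopen_lastIndex_pos {m : ℕ} (hm : 1 ≤ m) :
    IsClopen {y : ↥(openCube m \ openSlice m) |
      0 < (y : EuclideanSpace ℝ (Fin m)) (lastIndex m hm)} := by
  have hc : Continuous fun y : ↥(openCube m \ openSlice m) =>
      (y : EuclideanSpace ℝ (Fin m)) (lastIndex m hm) := by fun_prop
  refine ⟨?_, isOpen_lt continuous_const hc⟩
  refine (congrArg IsClosed (Set.ext fun y => ?_)).mpr
    (isClosed_le (continuous_const (y := (0 : ℝ))) hc)
  have hne : (y : EuclideanSpace ℝ (Fin m)) (lastIndex m hm) ≠ 0 := fun h0 =>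
    y.2.2 (mem_openSlice_of_mem_openCube hm y.2.1 h0)
  exact hne.symm.le_iff_lt.symm

/-- In the situation of Statement 8, there is an embedded closed arc
`B_u ⊆ U` whose endpoints `v₁`, `v₂` satisfy `0 ∈ B_u \ {v₁, v₂}`, `(h₂ v₁)ₘ > 0`,
`(h₂ v₂)ₘ < 0`; consequently `h₂({v₁, v₂}) ⊆ (-1,1)ᵐ \ ((-1,1)^{m-1} × {0})` and the
restriction of `h₂` to `{v₁, v₂}` induces a nonzero homomorphism
`H̃₀({v₁, v₂}) → H̃₀((-1,1)ᵐ \ ((-1,1)^{m-1} × {0}))` of reduced singular homology groups. -/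
theorem c0Transverse_arc (m u : ℕ) (hm : 1 ≤ m) (hu : 1 ≤ u)
    (A : Type) [TopologicalSpace A]
    (U : Set (EuclideanSpace ℝ (Fin u))) (hU : IsOpen U) (hU0 : 0 ∈ U)
    (h₁ : C(A, EuclideanSpace ℝ (Fin m))) (h₂ : C(U, EuclideanSpace ℝ (Fin m)))
    (hh₁ : Set.range h₁ = openSlice m)
    (hh₂ : ∀ v : U, h₂ v ∈ openCube m)
    (hz : h₂ ⟨0, hU0⟩ (lastIndex m hm) = 0)
    (htrans : ∀ (a : A) (b : U), h₁ a = h₂ b → C0TransverseAt h₁ h₂ a b) :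
    ∃ (v₁ v₂ : U) (Bu : Set (EuclideanSpace ℝ (Fin u))) (_ : Bu ⊆ U)
      (e : (Set.Icc (0 : ℝ) 1) ≃ₜ Bu),
      (v₁ : EuclideanSpace ℝ (Fin u)) = e ⟨0, by simp⟩ ∧
      (v₂ : EuclideanSpace ℝ (Fin u)) = e ⟨1, by simp⟩ ∧
      (0 : EuclideanSpace ℝ (Fin u)) ∈ Bu ∧
      (0 : EuclideanSpace ℝ (Fin u)) ≠ (v₁ : EuclideanSpace ℝ (Fin u)) ∧
      (0 : EuclideanSpace ℝ (Fin u)) ≠ (v₂ : EuclideanSpace ℝ (Fin u)) ∧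
      0 < h₂ v₁ (lastIndex m hm) ∧ h₂ v₂ (lastIndex m hm) < 0 ∧
      ∃ hmp : Set.MapsTo h₂ ({v₁, v₂} : Set U) (openCube m \ openSlice m),
        SHmapNontrivial 0 (restrictCM h₂ hmp) := by
  set l := lastIndex m hm
  have hslice : ∀ x, h₁ x l = 0 := fun x =>
    openSlice_apply_lastIndex hm (hh₁ ▸ Set.mem_range_self x)
  obtain ⟨r, hr, hrU⟩ := Metric.isOpen_iff.1 hU 0 hU0
  classical
  let f : EuclideanSpace ℝ (Fin u) → ℝ := fun x => if hx : x ∈ U then h₂ ⟨x, hx⟩ l else 0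
  have hfU (v : U) : f v = h₂ v l := dif_pos v.2
  have hf : ∀ z ∈ Metric.ball (0 : EuclideanSpace ℝ (Fin u)) r, f z = 0 → ∀ V ∈ nhds z,
      (∃ v ∈ V, 0 < f v) ∧ ∃ v ∈ V, f v < 0 := by
    intro z hz hfz V hV
    have hfz' : h₂ ⟨z, hrU hz⟩ l = 0 := by rw [← hfU]; exact hfz
    obtain ⟨a, ha⟩ : h₂ ⟨z, hrU hz⟩ ∈ Set.range h₁ :=
      hh₁ ▸ mem_openSlice_of_mem_openCube hm (hh₂ _) hfz'
    have hV' : ((↑) : U → EuclideanSpace ℝ (Fin u)) ⁻¹' V ∈ nhds ⟨z, hrU hz⟩ :=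
      continuous_subtype_val.continuousAt.preimage_mem_nhds hV
    obtain ⟨v, hv, hvp⟩ := (htrans a _ ha).exists_pos hslice one_ne_zero hV'
    obtain ⟨w, hw, hwp⟩ := (htrans a _ ha).exists_pos hslice (neg_ne_zero.2 one_ne_zero) hV'
    exact ⟨⟨v, hv, by rw [hfU]; linarith⟩, w, hw, by rw [hfU]; linarith⟩
  obtain ⟨p, hp, q, hq, hfp, hfq, hpq⟩ :=
    exists_pos_neg_not_sameRay hr ((hfU ⟨0, hU0⟩).trans hz) hf
  rw [hfU ⟨p, hrU hp⟩] at hfp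
  rw [hfU ⟨q, hrU hq⟩] at hfq
  let γ : Set.Icc (0 : ℝ) 1 → EuclideanSpace ℝ (Fin u) := fun t => brokenLine p q t
  have hγ : Topology.IsEmbedding γ :=
    (((continuous_brokenLine p q).comp continuous_subtype_val).isClosedEmbedding
      ((brokenLine_injective hpq).comp Subtype.val_injective)).isEmbedding
  have hmp : Set.MapsTo h₂ ({⟨p, hrU hp⟩, ⟨q, hrU hq⟩} : Set U) (openCube m \ openSlice m) := by
    rintro v (rfl | rfl)
    · exact ⟨hh₂ _, fun h => hfp.ne' (openSlice_apply_lastIndex hm h)⟩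
    · exact ⟨hh₂ _, fun h => hfq.ne (openSlice_apply_lastIndex hm h)⟩
  refine ⟨⟨p, hrU hp⟩, ⟨q, hrU hq⟩, Set.range γ, ?_, hγ.toHomeomorph, ?_, ?_, ?_, ?_, ?_,
    hfp, hfq, hmp, ?_⟩
  · rintro _ ⟨t, rfl⟩
    exact hrU (brokenLine_mem (convex_ball 0 r) (Metric.mem_ball_self hr) hp hq t.2)
  · change p = brokenLine p q 0
    simp [brokenLine]
  · change q = brokenLine p q 1
    norm_num [brokenLine]
  · exact ⟨⟨1 / 2, by norm_num⟩, by norm_num [γ, brokenLine]⟩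
  · rintro rfl
    exact hpq (SameRay.zero_left q)
  · rintro rfl
    exact hpq (SameRay.zero_right p)
  · exact SHmapNontrivial_zero_of_isClopen _ (isClopen_lastIndex_pos hm)
      (x := ⟨⟨p, hrU hp⟩, Or.inl rfl⟩) (y := ⟨⟨q, hrU hq⟩, Or.inr rfl⟩) hfp
      (not_lt.2 hfq.le)
end

section
/- Let m ≥ 2 be an integer, let s₁, s₂ ∈ (−1,1) with s₁ < 0 < s₂, and let ε ∈ (0,1). Set B₀ = {x ∈ ℝᵐ : x₁ ∈ [s₁, s₂], (x₂, …, x_{m−1}) lies in the closed ball of radius ε in ℝ^{m−2}, and x_m = 0}, and let S₀ = {x ∈ B₀ : x₁ ∈ {s₁, s₂} or ‖(x₂, …, x_{m−1})‖ = ε} (S₀ is homeomorphic to the sphere S^{m−2}). Let g : B₀ → (−1,1) be continuous with g(x) > 0 whenever x₁ = s₁ and g(x) < 0 whenever x₁ = s₂, and define h : B₀ → ℝᵐ by h(x) = (x₁, …, x_{m−1}, g(x)). Then h(S₀) ⊆ (−1,1)ᵐ ∖ ((−1,1) × {0}^{m−1}), and the restriction h|_{S₀} induces a nonzero homomorphism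 (h|_{S₀})_* : H̃_{m−2}(S₀) → H̃_{m−2}((−1,1)ᵐ ∖ ((−1,1) × {0}^{m−1})) of reduced singular homology groups with integer coefficients. -/
open CategoryTheory

/-- The open segment `(-1, 1) × {0}^{m-1}` of the first coordinate axis in `ℝᵐ`. -/
def axisSlice (m : ℕ) : Set (EuclideanSpace ℝ (Fin m)) :=
  {y | ∀ i : Fin m, ((i : ℕ) = 0 → y i ∈ Set.Ioo (-1 : ℝ) 1) ∧ (0 < (i : ℕ) → y i = 0)}

/-- The Euclidean norm of the middle block `(x₂, …, x_{m-1})` of coordinates of `x ∈ ℝᵐ`. -/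
noncomputable def midNorm (m : ℕ) (x : EuclideanSpace ℝ (Fin m)) : ℝ :=
  Real.sqrt (∑ i : Fin m, if 0 < (i : ℕ) ∧ (i : ℕ) + 1 < m then (x i) ^ 2 else 0)

/-- The set `B₀ = {x : x₁ ∈ [s₁, s₂], ‖(x₂, …, x_{m-1})‖ ≤ ε, x_m = 0} ⊆ ℝᵐ`. -/
def stadiumBase (m : ℕ) (hm : 2 ≤ m) (s₁ s₂ ε : ℝ) : Set (EuclideanSpace ℝ (Fin m)) :=
  {x | x ⟨0, by omega⟩ ∈ Set.Icc s₁ s₂ ∧ midNorm m x ≤ ε ∧ x ⟨m - 1, by omega⟩ = 0}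

/-- The set `S₀ = {x ∈ B₀ : x₁ ∈ {s₁, s₂} or ‖(x₂, …, x_{m-1})‖ = ε}`, homeomorphic to the
sphere `S^{m-2}`. -/
def stadiumBoundary (m : ℕ) (hm : 2 ≤ m) (s₁ s₂ ε : ℝ) : Set (EuclideanSpace ℝ (Fin m)) :=
  {x ∈ stadiumBase m hm s₁ s₂ ε |
    x ⟨0, by omega⟩ = s₁ ∨ x ⟨0, by omega⟩ = s₂ ∨ midNorm m x = ε}

/-- The alternating sum of the values of `F` on the faces of the affine simplex with vertices
`v`. -/
def faceSum {E : Type*} {n : ℕ} (F : (Fin (n + 1) → E) → ℤ) (v : Fin (n + 2) → E) : ℤ :=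
  ∑ i : Fin (n + 2), (-1) ^ (i : ℕ) * F (v ∘ i.succAbove)

/-- The barycenter of the vertices of an affine simplex. -/
noncomputable def vertexBarycenter {E : Type*} [AddCommGroup E] [Module ℝ E] {n : ℕ}
    (v : Fin (n + 1) → E) : E :=
  ((n : ℝ) + 1)⁻¹ • ∑ i, v i

/-- The pullback along barycentric subdivision: `sdPull n F v` is the sum, with signs, of the
values of the cochain `F` on the simplices of the barycentric subdivision of `v`. -/
noncomputable def sdPull {E : Type*} [AddCommGroup E] [Module ℝ E] :
    ∀ n : ℕ, ((Fin (n + 1) → E) → ℤ) → (Fin (n + 1) → E) → ℤ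
  | 0, F => F
  | n + 1, F => fun v ↦ faceSum (sdPull n fun w ↦ F (Fin.cons (vertexBarycenter v) w)) v

/-- The signed indicator of the affine simplices whose vertices carry each of the labels
`0, …, n` exactly once. -/
def labelSign {E : Type*} (n : ℕ) (l : E → ℕ) (w : Fin (n + 1) → E) : ℤ :=
  (Matrix.of fun i j : Fin (n + 1) ↦ if l (w i) = j then (1 : ℤ) else 0).det

section Cochains

variable {E : Type*}

lemma faceSum_faceSum {n : ℕ} (F : (Fin (n + 1) → E) → ℤ) (v : Fin (n + 3) → E) :
    faceSum (faceSum F) v = 0 := by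
  simp only [faceSum, Finset.mul_sum]
  rw [← Finset.sum_product']
  have sign : ∀ (i : Fin (n + 3)) (j : Fin (n + 2)),
      (-1 : ℤ) ^ (i.succAbove j : ℕ) * (-1) ^ (j.predAbove i : ℕ) =
        -((-1) ^ (i : ℕ) * (-1) ^ (j : ℕ)) := by
    intro i j
    rcases Fin.lt_or_le j.castSucc i with h | h
    · rw [Fin.succAbove_of_castSucc_lt _ _ h, Fin.predAbove_of_castSucc_lt _ _ h]
      obtain ⟨i, rfl⟩ := Fin.exists_succ_eq.2 (Fin.ne_zero_of_lt h)
      simp only [Fin.pred_succ, Fin.val_castSucc, Fin.val_succ, pow_succ]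
      ring
    · rw [Fin.succAbove_of_le_castSucc _ _ h, Fin.predAbove_of_le_castSucc _ _ h]
      simp only [Fin.coe_castPred, Fin.val_succ, pow_succ]
      ring
  refine Finset.sum_involution (fun p _ ↦ (p.1.succAbove p.2, p.2.predAbove p.1)) ?_ ?_ ?_ ?_
  · rintro ⟨i, j⟩ -
    have h : (v ∘ (i.succAbove j).succAbove) ∘ (j.predAbove i).succAbove =
        (v ∘ i.succAbove) ∘ j.succAbove := by
      funext k
      simp [Fin.succAbove_succAbove_succAbove_predAbove]
    simp only [h, ← mul_assoc, sign]
    ring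
  · rintro ⟨i, j⟩ - - h
    exact Fin.succAbove_ne i j (congrArg Prod.fst h)
  · simp
  · rintro ⟨i, j⟩ -
    simp [Fin.succAbove_succAbove_predAbove, Fin.predAbove_predAbove_succAbove]

lemma faceSum_sub {n : ℕ} (F G : (Fin (n + 1) → E) → ℤ) (v : Fin (n + 2) → E) :
    faceSum (fun w ↦ F w - G w) v = faceSum F v - faceSum G v := by
  simp [faceSum, mul_sub, Finset.sum_sub_distrib]

lemma faceSum_cons {n : ℕ} (F : (Fin (n + 2) → E) → ℤ) (b : E) (w : Fin (n + 2) → E) :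
    faceSum F (Fin.cons b w) = F w - faceSum (fun u ↦ F (Fin.cons b u)) w := by
  rw [faceSum, Fin.sum_univ_succ]
  have h0 : (Fin.cons b w : Fin (n + 3) → E) ∘ Fin.succAbove 0 = w := by
    funext k; simp
  have hs : ∀ i : Fin (n + 2), (Fin.cons b w : Fin (n + 3) → E) ∘ i.succ.succAbove =
      Fin.cons b (w ∘ i.succAbove) := by
    intro i
    funext k
    refine Fin.cases ?_ (fun k ↦ ?_) k <;> simp
  simp only [h0, hs, faceSum, Fin.val_succ, pow_succ]
  simp [Finset.sum_neg_distrib, sub_eq_add_neg]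

lemma labelSign_eq_zero {n : ℕ} {l : E → ℕ} {w : Fin (n + 1) → E} (k : Fin (n + 1))
    (h : ∀ i, l (w i) ≠ k) : labelSign n l w = 0 :=
  Matrix.det_eq_zero_of_column_eq_zero k fun i ↦ by simp [h i]

lemma labelSign_succ {n : ℕ} {l : E → ℕ} {w : Fin (n + 2) → E} (h : ∀ i, l (w i) ≤ n + 1) :
    labelSign (n + 1) l w = (-1) ^ (n + 1) * faceSum (labelSign n l) w := by
  rw [labelSign]
  set A := Matrix.of fun i j : Fin (n + 2) ↦ if l (w i) = j then (1 : ℤ) else 0 with hA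
  have h1 := Matrix.det_updateCol_sum A (Fin.last _) (fun _ ↦ 1)
  have h2 : (fun k ↦ ∑ i, (1 : ℤ) • A k i) = fun _ ↦ 1 := by
    funext k
    have : ∀ i : Fin (n + 2), (1 : ℤ) • A k i =
        if i = ⟨l (w k), Nat.lt_succ_of_le (h k)⟩ then 1 else 0 := by
      intro i
      simp [hA, Fin.ext_iff, eq_comm]
    simp only [this]
    simp
  rw [h2, one_smul] at h1
  rw [← h1, Matrix.det_succ_column _ (Fin.last _), faceSum, Finset.mul_sum]
  refine Finset.sum_congr rfl fun i _ ↦ ?_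
  rw [labelSign, Matrix.updateCol_self, Fin.val_last, pow_add]
  have : (A.updateCol (Fin.last _) fun _ ↦ 1).submatrix i.succAbove (Fin.last _).succAbove =
      Matrix.of fun i' j : Fin (n + 1) ↦
        if l ((w ∘ i.succAbove) i') = j then (1 : ℤ) else 0 := by
    ext a b
    simp [hA]
  rw [this]
  ring

variable [AddCommGroup E] [Module ℝ E]

lemma sdPull_sub : ∀ (n : ℕ) (F G : (Fin (n + 1) → E) → ℤ) (v : Fin (n + 1) → E),
    sdPull n (fun w ↦ F w - G w) v = sdPull n F v - sdPull n G v
  | 0, _, _, _ => rfl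
  | n + 1, F, G, v => by
    simp only [sdPull, ← faceSum_sub]
    congr 1
    funext w
    exact sdPull_sub n _ _ w

lemma sdPull_const_mul : ∀ (n : ℕ) (c : ℤ) (F : (Fin (n + 1) → E) → ℤ) (v : Fin (n + 1) → E),
    sdPull n (fun w ↦ c * F w) v = c * sdPull n F v
  | 0, _, _, _ => rfl
  | n + 1, c, F, v => by
    simp only [sdPull, faceSum, Finset.mul_sum, mul_left_comm c]
    simp only [sdPull_const_mul n]

lemma sdPull_faceSum : ∀ (n : ℕ) (F : (Fin (n + 1) → E) → ℤ),
    sdPull (n + 1) (faceSum F) = faceSum (sdPull n F)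
  | 0, F => by
    funext v
    have h : ∀ (b : E) (w : Fin 1 → E),
        faceSum F (Fin.cons b w) = F w - F fun _ ↦ b := fun b w ↦ by
      have h1 : (Fin.cons b w : Fin 2 → E) ∘ Fin.succAbove 1 = fun _ ↦ b := by
        funext k; fin_cases k; rfl
      simp [faceSum, h1, sub_eq_add_neg]
    rw [sdPull]
    simp only [h, sdPull, faceSum_sub]
    simp [faceSum]
  | n + 1, F => by
    funext v
    rw [sdPull]
    simp only [faceSum_cons]
    have h : (sdPull (n + 1) fun w : Fin (n + 2) → E ↦ F w -
        faceSum (fun u ↦ F (Fin.cons (vertexBarycenter v) u)) w) =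
        fun w ↦ sdPull (n + 1) F w -
          faceSum (sdPull n fun u ↦ F (Fin.cons (vertexBarycenter v) u)) w := by
      funext w
      rw [sdPull_sub, ← sdPull_faceSum n]
    rw [h, faceSum_sub, faceSum_faceSum, sub_zero]

lemma sdPull_iterate_faceSum (n N : ℕ) (F : (Fin (n + 1) → E) → ℤ) :
    (sdPull (n + 1))^[N] (faceSum F) = faceSum ((sdPull n)^[N] F) := by
  induction N with
  | zero => rfl
  | succ N ih => rw [Function.iterate_succ_apply', ih, sdPull_faceSum,
      Function.iterate_succ_apply']

lemma sdPull_iterate_sub (n N : ℕ) (F G : (Fin (n + 1) → E) → ℤ) (v : Fin (n + 1) → E) :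
    (sdPull n)^[N] (fun w ↦ F w - G w) v = (sdPull n)^[N] F v - (sdPull n)^[N] G v := by
  induction N generalizing v with
  | zero => rfl
  | succ N ih =>
    rw [Function.iterate_succ_apply', Function.iterate_succ_apply', Function.iterate_succ_apply',
      funext ih, sdPull_sub]

lemma sdPull_iterate_const_mul (n N : ℕ) (c : ℤ) (F : (Fin (n + 1) → E) → ℤ)
    (v : Fin (n + 1) → E) :
    (sdPull n)^[N] (fun w ↦ c * F w) v = c * (sdPull n)^[N] F v := by
  induction N generalizing v with
  | zero => rfl
  | succ N ih =>
    rw [Function.iterate_succ_apply', Function.iterate_succ_apply', funext ih, sdPull_const_mul]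

lemma map_vertexBarycenter {E' : Type*} [AddCommGroup E'] [Module ℝ E'] (A : E →ₗ[ℝ] E') {n : ℕ}
    (v : Fin (n + 1) → E) : A (vertexBarycenter v) = vertexBarycenter (A ∘ v) := by
  simp [vertexBarycenter]

lemma sdPull_comp_linearMap {E' : Type*} [AddCommGroup E'] [Module ℝ E'] (A : E →ₗ[ℝ] E') :
    ∀ (n : ℕ) (F : (Fin (n + 1) → E') → ℤ) (v : Fin (n + 1) → E),
      sdPull n (fun w ↦ F (A ∘ w)) v = sdPull n F (A ∘ v)
  | 0, _, _ => rfl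
  | n + 1, F, v => by
    have h : ∀ w : Fin (n + 1) → E, A ∘ (Fin.cons (vertexBarycenter v) w : Fin (n + 2) → E) =
        Fin.cons (vertexBarycenter (A ∘ v)) (A ∘ w) := by
      intro w
      funext k
      refine Fin.cases ?_ (fun k ↦ ?_) k <;> simp [map_vertexBarycenter]
    simp only [sdPull, faceSum, h]
    refine Finset.sum_congr rfl fun i _ ↦ ?_
    rw [sdPull_comp_linearMap A n fun w ↦ F (Fin.cons (vertexBarycenter (A ∘ v)) w)]
    rfl

lemma sdPull_iterate_comp_linearMap {E' : Type*} [AddCommGroup E'] [Module ℝ E']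
    (A : E →ₗ[ℝ] E') (n N : ℕ) (F : (Fin (n + 1) → E') → ℤ) (v : Fin (n + 1) → E) :
    (sdPull n)^[N] (fun w ↦ F (A ∘ w)) v = (sdPull n)^[N] F (A ∘ v) := by
  induction N generalizing v with
  | zero => rfl
  | succ N ih =>
    rw [Function.iterate_succ_apply', Function.iterate_succ_apply', funext ih,
      sdPull_comp_linearMap]

end Cochains

section Subdivision

variable {E : Type*} [NormedAddCommGroup E] [NormedSpace ℝ E]

lemma vertexBarycenter_mem_convexHull {n : ℕ} (v : Fin (n + 1) → E) :
    vertexBarycenter v ∈ convexHull ℝ (Set.range v) := by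
  have hn : (n : ℝ) + 1 ≠ 0 := by positivity
  rw [vertexBarycenter, Finset.smul_sum]
  exact (convex_convexHull ℝ _).sum_mem (fun _ _ ↦ by positivity) (by simp [hn])
    fun i _ ↦ subset_convexHull ℝ _ ⟨i, rfl⟩

lemma dist_vertexBarycenter_le {n : ℕ} {v : Fin (n + 1) → E} {D : ℝ}
    (hD : ∀ i j, dist (v i) (v j) ≤ D) {x : E} (hx : x ∈ convexHull ℝ (Set.range v)) :
    dist x (vertexBarycenter v) ≤ n / (n + 1) * D := by
  obtain ⟨_, ⟨k, rfl⟩, hk⟩ := convexHull_exists_dist_ge hx (vertexBarycenter v)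
  refine hk.trans ?_
  have hn : (n : ℝ) + 1 ≠ 0 := by positivity
  have h1 : v k - vertexBarycenter v = ((n : ℝ) + 1)⁻¹ • ∑ i, (v k - v i) := by
    rw [vertexBarycenter, Finset.sum_sub_distrib, smul_sub, Finset.sum_const, Finset.card_univ,
      Fintype.card_fin, ← Nat.cast_smul_eq_nsmul ℝ, smul_smul]
    push_cast
    rw [inv_mul_cancel₀ hn, one_smul]
  have h2 : ‖∑ i, (v k - v i)‖ ≤ n * D := by
    rw [Fin.sum_univ_succAbove _ k, sub_self, zero_add]
    refine (norm_sum_le _ _).trans ?_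
    refine (Finset.sum_le_card_nsmul _ _ D fun i _ ↦ ?_).trans ?_
    · rw [← dist_eq_norm]; exact hD _ _
    · simp
  rw [dist_eq_norm, h1, norm_smul, Real.norm_of_nonneg (by positivity), div_eq_inv_mul, mul_assoc]
  gcongr

lemma sdPull_eq_zero : ∀ (n : ℕ) {F : (Fin (n + 1) → E) → ℤ} {v : Fin (n + 1) → E} {D : ℝ},
    (∀ i j, dist (v i) (v j) ≤ D) →
    (∀ w : Fin (n + 1) → E, (∀ k, w k ∈ convexHull ℝ (Set.range v)) →
      (∀ i j, dist (w i) (w j) ≤ n / (n + 1) * D) → F w = 0) →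
    sdPull n F v = 0
  | 0, F, v, D, hD, hF => by
    refine hF v (fun k ↦ subset_convexHull ℝ _ ⟨k, rfl⟩) fun i j ↦ ?_
    simp [Subsingleton.elim (α := Fin 1) i j]
  | n + 1, F, v, D, hD, hF => by
    have hD0 : 0 ≤ D := by simpa using hD 0 0
    simp only [sdPull, faceSum]
    refine Finset.sum_eq_zero fun i _ ↦ ?_
    refine mul_eq_zero_of_right _ (sdPull_eq_zero n (D := D) (fun _ _ ↦ hD _ _) ?_)
    intro w hw hwD
    have hw' : ∀ k, w k ∈ convexHull ℝ (Set.range v) := fun k ↦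
      convexHull_mono (Set.range_comp_subset_range _ _) (hw k)
    have hb : ∀ k, dist (w k) (vertexBarycenter v) ≤ ((n + 1 : ℕ) : ℝ) / ((n + 1 : ℕ) + 1) * D :=
      fun k ↦ dist_vertexBarycenter_le hD (hw' k)
    have hr : (n : ℝ) / (n + 1) ≤ ((n + 1 : ℕ) : ℝ) / ((n + 1 : ℕ) + 1) := by
      push_cast
      rw [div_le_div_iff₀ (by positivity) (by positivity)]
      nlinarith
    refine hF _ (Fin.cases (vertexBarycenter_mem_convexHull v) hw') fun i j ↦ ?_
    refine Fin.cases ?_ (fun i ↦ ?_) i <;> refine Fin.cases ?_ (fun j ↦ ?_) j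
    · simp only [Fin.cons_zero, dist_self]; positivity
    · simpa [dist_comm] using hb j
    · simpa using hb i
    · simp only [Fin.cons_succ]
      exact (hwD i j).trans (by gcongr)

lemma sdPull_iterate_eq_zero (n N : ℕ) {F : (Fin (n + 1) → E) → ℤ} {v : Fin (n + 1) → E} {D : ℝ}
    (hD : ∀ i j, dist (v i) (v j) ≤ D)
    (hF : ∀ w : Fin (n + 1) → E, (∀ k, w k ∈ convexHull ℝ (Set.range v)) →
      (∀ i j, dist (w i) (w j) ≤ (n / (n + 1)) ^ N * D) → F w = 0) :
    (sdPull n)^[N] F v = 0 := by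
  induction N generalizing v D with
  | zero => exact hF v (fun k ↦ subset_convexHull ℝ _ ⟨k, rfl⟩) (by simpa using hD)
  | succ N ih =>
    rw [Function.iterate_succ_apply']
    refine sdPull_eq_zero n hD fun w hw hwD ↦ ih hwD fun u hu huD ↦ hF u (fun k ↦ ?_) ?_
    · exact convexHull_min (Set.range_subset_iff.2 hw) (convex_convexHull ℝ _) (hu k)
    · intro i j
      rw [pow_succ, mul_assoc]
      exact huD i j

lemma sdPull_iterate_congr (n N : ℕ) {F G : (Fin (n + 1) → E) → ℤ} {v : Fin (n + 1) → E}
    (h : ∀ w : Fin (n + 1) → E, (∀ k, w k ∈ convexHull ℝ (Set.range v)) → F w = G w) :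
    (sdPull n)^[N] F v = (sdPull n)^[N] G v := by
  rw [← sub_eq_zero, ← sdPull_iterate_sub]
  exact sdPull_iterate_eq_zero n N
    (fun i j ↦ Metric.dist_le_diam_of_mem (Set.finite_range v).isBounded ⟨i, rfl⟩ ⟨j, rfl⟩)
    fun w hw _ ↦ sub_eq_zero.2 (h w hw)

lemma sdPull_iterate_labelSign_succ (n N : ℕ) {l : E → ℕ} {v : Fin (n + 2) → E}
    (hl : ∀ x ∈ convexHull ℝ (Set.range v), l x ≤ n + 1) :
    (sdPull (n + 1))^[N] (labelSign (n + 1) l) v =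
      (-1) ^ (n + 1) * faceSum ((sdPull n)^[N] (labelSign n l)) v := by
  rw [sdPull_iterate_congr (n + 1) N
      (G := fun w ↦ (-1) ^ (n + 1) * faceSum (labelSign n l) w)
      fun w hw ↦ labelSign_succ fun i ↦ hl _ (hw i),
    sdPull_iterate_const_mul, sdPull_iterate_faceSum]

/-- **Sperner's lemma** for iterated barycentric subdivisions, counting with signs. -/
theorem sdPull_iterate_labelSign_eq_one (N : ℕ) : ∀ (n : ℕ) {l : E → ℕ} {v : Fin (n + 1) → E},
    (∀ s : Set (Fin (n + 1)), ∀ x ∈ convexHull ℝ (v '' s), ∃ k ∈ s, l x = k) →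
    (sdPull n)^[N] (labelSign n l) v = 1
  | 0, l, v, h => by
    rw [Function.iterate_fixed (f := sdPull 0) rfl]
    obtain ⟨k, -, hk⟩ := h Set.univ (v 0) (subset_convexHull ℝ _ ⟨0, trivial, rfl⟩)
    obtain rfl := Subsingleton.elim (α := Fin 1) k 0
    simp [labelSign, hk]
  | n + 1, l, v, h => by
    rw [sdPull_iterate_labelSign_succ n N fun x hx ↦ ?_, faceSum,
      Finset.sum_eq_single (Fin.last _)]
    · have : (sdPull n)^[N] (labelSign n l) (v ∘ (Fin.last (n + 1)).succAbove) = 1 := by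
        refine sdPull_iterate_labelSign_eq_one N n fun s x hx ↦ ?_
        rw [Set.image_comp] at hx
        obtain ⟨_, ⟨k, hk, rfl⟩, hkx⟩ := h _ x hx
        exact ⟨k, hk, by simpa using hkx⟩
      rw [this, Fin.val_last, mul_one, ← mul_pow]
      simp
    · intro i _ hi
      obtain ⟨i, rfl⟩ := Fin.exists_castSucc_eq.2 hi
      rw [sdPull_iterate_congr n N (G := fun _ ↦ 0 * 0), sdPull_iterate_const_mul, zero_mul,
        mul_zero]
      intro w hw
      rw [mul_zero]
      refine labelSign_eq_zero i fun k hk ↦ ?_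
      have hwk := hw k
      rw [Set.range_comp] at hwk
      obtain ⟨_, ⟨a, rfl⟩, ha⟩ := h _ _ hwk
      exact Fin.succAbove_ne i.castSucc a (Fin.ext (by simpa [ha] using hk))
    · simp
    · rw [← Set.image_univ] at hx
      obtain ⟨k, -, hk⟩ := h _ x hx
      omega

end Subdivision

section SingularCochain

variable {Y : Type*} [TopologicalSpace Y]

open Classical in
/-- The labelling of the ambient space of the standard simplex induced by a singular simplex and
a labelling of the target (with junk value `0` outside of the standard simplex). -/
noncomputable def simplexLabel {n : ℕ} (L : Y → ℕ) (σ : C(stdSimplex ℝ (Fin (n + 1)), Y))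
    (x : Fin (n + 1) → ℝ) : ℕ :=
  if h : x ∈ stdSimplex ℝ (Fin (n + 1)) then L (σ ⟨x, h⟩) else 0

lemma simplexLabel_apply {n : ℕ} (L : Y → ℕ) (σ : C(stdSimplex ℝ (Fin (n + 1)), Y))
    (x : stdSimplex ℝ (Fin (n + 1))) : simplexLabel L σ x = L (σ x) := by
  have hx : (⇑x : Fin (n + 1) → ℝ) ∈ stdSimplex ℝ (Fin (n + 1)) := x.2
  rw [simplexLabel, dif_pos hx]
  rfl

/-- The signed number of fully labelled simplices in the `N`-th barycentric subdivision of a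
singular simplex. -/
noncomputable def labelCount (L : Y → ℕ) (N : ℕ) {n : ℕ}
    (σ : C(stdSimplex ℝ (Fin (n + 1)), Y)) : ℤ :=
  (sdPull n)^[N] (labelSign n (simplexLabel L σ)) fun i ↦ Pi.single i 1

/-- The inclusion of the `i`-th face of the standard simplex. -/
noncomputable def faceMap {n : ℕ} (i : Fin (n + 2)) :
    C(stdSimplex ℝ (Fin (n + 1)), stdSimplex ℝ (Fin (n + 2))) :=
  ⟨stdSimplex.map i.succAbove, stdSimplex.continuous_map _⟩

lemma sum_labelCount (L : Y → ℕ) (N : ℕ) {n : ℕ} {l : (Fin (n + 2) → ℝ) → ℕ}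
    {σ : Fin (n + 2) → C(stdSimplex ℝ (Fin (n + 1)), Y)}
    (h : ∀ i x, L (σ i x) = l (faceMap i x)) :
    ∑ i : Fin (n + 2), (-1) ^ (i : ℕ) * labelCount L N (σ i) =
      faceSum ((sdPull n)^[N] (labelSign n l)) fun i ↦ Pi.single i 1 := by
  refine Finset.sum_congr rfl fun i _ ↦ ?_
  congr 1
  set A : (Fin (n + 1) → ℝ) →ₗ[ℝ] (Fin (n + 2) → ℝ) := FunOnFinite.linearMap ℝ ℝ i.succAbove
  have hA : A ∘ (fun k ↦ Pi.single k (1 : ℝ)) =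
      (fun k ↦ Pi.single k (1 : ℝ)) ∘ i.succAbove := by
    funext k
    simp [A, FunOnFinite.linearMap_piSingle]
  rw [← hA, ← sdPull_iterate_comp_linearMap, labelCount]
  refine sdPull_iterate_congr n N fun w hw ↦ ?_
  rw [convexHull_rangle_single_eq_stdSimplex] at hw
  simp only [labelSign, simplexLabel, hw, dif_pos, h]
  rfl

lemma exists_sum_labelCount_eq_zero {n : ℕ} {L : Y → ℕ} {V : Fin (n + 2) → Set Y}
    (hL : ∀ y, L y ≤ n + 1) (hV : ∀ i, IsOpen (V i)) (hcover : ∀ y, ∃ i, y ∈ V i)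
    (hVL : ∀ i, ∀ y ∈ V i, L y ≠ i) (τ : C(stdSimplex ℝ (Fin (n + 2)), Y)) :
    ∃ N₀, ∀ N ≥ N₀,
      ∑ i : Fin (n + 2), (-1) ^ (i : ℕ) * labelCount L N (τ.comp (faceMap i)) = 0 := by
  obtain ⟨δ, hδ, hball⟩ := lebesgue_number_lemma_of_metric
    (isCompact_univ (X := stdSimplex ℝ (Fin (n + 2)))) (c := fun i ↦ τ ⁻¹' V i)
    (fun i ↦ (hV i).preimage τ.continuous) (fun x _ ↦ by simpa using hcover (τ x))
  set e : Fin (n + 2) → Fin (n + 2) → ℝ := fun i ↦ Pi.single i 1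
  set D := Metric.diam (Set.range e)
  have hr : Filter.Tendsto (fun N : ℕ ↦ (((n + 1 : ℕ) : ℝ) / ((n + 1 : ℕ) + 1)) ^ N * D)
      Filter.atTop (nhds (0 * D)) := by
    refine (tendsto_pow_atTop_nhds_zero_of_lt_one (by positivity) ?_).mul_const D
    rw [div_lt_one (by positivity)]
    exact lt_add_one _
  rw [zero_mul] at hr
  obtain ⟨N₀, hN₀⟩ := Filter.eventually_atTop.1 (hr.eventually (gt_mem_nhds hδ))
  refine ⟨N₀, fun N hN ↦ ?_⟩
  have hlab : ∀ x, simplexLabel L τ x ≤ n + 1 := fun x ↦ by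
    unfold simplexLabel
    split_ifs
    exacts [hL _, Nat.zero_le _]
  rw [sum_labelCount L N (l := simplexLabel L τ)]
  · have h := sdPull_iterate_labelSign_succ n N (l := simplexLabel L τ) (v := e)
      fun x _ ↦ hlab x
    rw [sdPull_iterate_eq_zero (n + 1) N (D := D)] at h
    · exact (mul_eq_zero.1 h.symm).resolve_left (by simp)
    · exact fun i j ↦
        Metric.dist_le_diam_of_mem (Set.finite_range e).isBounded ⟨i, rfl⟩ ⟨j, rfl⟩
    · intro w hw hwD
      rw [convexHull_rangle_single_eq_stdSimplex] at hw
      obtain ⟨i, hi⟩ := hball ⟨w 0, hw 0⟩ trivial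
      refine labelSign_eq_zero i fun k hk ↦ ?_
      rw [simplexLabel, dif_pos (hw k)] at hk
      have hmem : (⟨w k, hw k⟩ : stdSimplex ℝ (Fin (n + 2))) ∈ Metric.ball ⟨w 0, hw 0⟩ δ :=
        (hwD k 0).trans_lt (hN₀ N hN)
      exact hVL i _ (hi hmem) hk
  · exact fun i x ↦ (simplexLabel_apply L τ _).symm

lemma sum_labelCount_ne_zero {n : ℕ} {L : Y → ℕ} (N : ℕ) {l : (Fin (n + 2) → ℝ) → ℕ}
    {σ : Fin (n + 2) → C(stdSimplex ℝ (Fin (n + 1)), Y)}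
    (h : ∀ i x, L (σ i x) = l (faceMap i x))
    (hl : ∀ x ∈ stdSimplex ℝ (Fin (n + 2)), l x ≤ n + 1)
    (hl' : ∀ x ∈ stdSimplex ℝ (Fin (n + 2)), ∀ i, x i = 0 → l x ≠ i) :
    ∑ i : Fin (n + 2), (-1) ^ (i : ℕ) * labelCount L N (σ i) ≠ 0 := by
  set e : Fin (n + 2) → Fin (n + 2) → ℝ := fun i ↦ Pi.single i 1
  have hsub : ∀ s : Set (Fin (n + 2)), convexHull ℝ (e '' s) ⊆ stdSimplex ℝ (Fin (n + 2)) := by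
    intro s
    rw [← convexHull_rangle_single_eq_stdSimplex]
    exact convexHull_mono (Set.image_subset_range _ _)
  have h1 := sdPull_iterate_labelSign_eq_one N (n + 1) (l := l) (v := e) fun s x hx ↦ by
    have hxs := hsub s hx
    refine ⟨⟨l x, Nat.lt_succ_of_le (hl x hxs)⟩, ?_, rfl⟩
    by_contra hs
    refine hl' x hxs ⟨l x, Nat.lt_succ_of_le (hl x hxs)⟩ ?_ rfl
    have hconv : Convex ℝ {y : Fin (n + 2) → ℝ | y ⟨l x, Nat.lt_succ_of_le (hl x hxs)⟩ = 0} :=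
      (convex_singleton (0 : ℝ)).linear_preimage
        (LinearMap.proj (R := ℝ) (φ := fun _ : Fin (n + 2) ↦ ℝ) _)
    refine convexHull_min ?_ hconv hx
    rintro _ ⟨k, hk, rfl⟩
    exact Pi.single_eq_of_ne (fun h ↦ hs (by rwa [h])) _
  rw [sdPull_iterate_labelSign_succ n N fun x hx ↦ hl x ?_] at h1
  · rw [sum_labelCount L N h]
    intro h0
    rw [h0, mul_zero] at h1
    exact zero_ne_one h1
  · rwa [convexHull_rangle_single_eq_stdSimplex] at hx

end SingularCochain

section SingularChains

open Simplicial Opposite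

/-- The generator of the singular chains corresponding to a singular simplex. -/
noncomputable def simplexChain {X : Type} [TopologicalSpace X] {n : ℕ}
    (σ : C(stdSimplex ℝ (Fin (n + 1)), X)) : (singularChains.obj (TopCat.of X)).X n :=
  ModuleCat.freeMk ((TopCat.toSSetObjEquiv (TopCat.of X) (op ⦋n⦌)).symm σ)

/-- The linear form on singular chains with prescribed values on singular simplices. -/
noncomputable def chainEval {X : Type} [TopologicalSpace X] {n : ℕ}
    (φ : C(stdSimplex ℝ (Fin (n + 1)), X) → ℤ) :
    (singularChains.obj (TopCat.of X)).X n ⟶ ModuleCat.of ℤ ℤ :=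
  ModuleCat.freeDesc (M := ModuleCat.of ℤ ℤ)
    (↾fun s ↦ φ (TopCat.toSSetObjEquiv (TopCat.of X) (op ⦋n⦌) s))

variable {X Y : Type} [TopologicalSpace X] [TopologicalSpace Y] {n : ℕ}

lemma chainEval_simplexChain (φ : C(stdSimplex ℝ (Fin (n + 1)), X) → ℤ)
    (σ : C(stdSimplex ℝ (Fin (n + 1)), X)) : chainEval φ (simplexChain σ) = φ σ := by
  refine (ModuleCat.freeDesc_apply _ _).trans ?_
  exact congrArg φ (Equiv.apply_symm_apply _ σ)

lemma map_simplexChain (f : C(X, Y)) (σ : C(stdSimplex ℝ (Fin (n + 1)), X)) :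
    (singularChains.map (X := TopCat.of X) (Y := TopCat.of Y) (TopCat.ofHom f)).f n
      (simplexChain σ) = simplexChain (f.comp σ) :=
  ModuleCat.free_map_apply _ _

lemma zsmul_hom_apply {M N : ModuleCat.{0} ℤ} (k : ℤ) (f : M ⟶ N) (x : M) :
    (k • f).hom x = k • f.hom x := by
  rw [ModuleCat.hom_zsmul]
  rfl

lemma d_simplexChain (τ : C(stdSimplex ℝ (Fin (n + 2)), X)) :
    (singularChains.obj (TopCat.of X)).d (n + 1) n (simplexChain τ) =
      ∑ i : Fin (n + 2), (-1 : ℤ) ^ (i : ℕ) • simplexChain (τ.comp (faceMap i)) := by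
  have h := AlgebraicTopology.alternatingFaceMapComplex_obj_d
    (((SimplicialObject.whiskering _ _).obj (ModuleCat.free ℤ)).obj
      (TopCat.toSSet.obj (TopCat.of X))) n
  refine (congrArg (fun g ↦ g.hom (simplexChain τ)) h).trans ?_
  rw [AlgebraicTopology.AlternatingFaceMapComplex.objD, ModuleCat.hom_sum]
  refine (LinearMap.sum_apply _ _ _).trans ?_
  refine Finset.sum_congr rfl fun i _ ↦ ?_
  refine (zsmul_hom_apply _ _ _).trans (congrArg _ ?_)
  refine (ModuleCat.free_map_apply _ _).trans ?_
  refine congrArg ModuleCat.freeMk ?_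
  rfl

lemma singularChains_induction {p : (singularChains.obj (TopCat.of X)).X n → Prop}
    (h0 : p 0) (hadd : ∀ a b, p a → p b → p (a + b)) (hsmul : ∀ (k : ℤ) a, p a → p (k • a))
    (hσ : ∀ σ, p (simplexChain σ)) (c : (singularChains.obj (TopCat.of X)).X n) : p c := by
  refine Finsupp.induction_linear c h0 hadd fun s k ↦ ?_
  have h := hsmul k _ (hσ (TopCat.toSSetObjEquiv (TopCat.of X) (op ⦋n⦌) s))
  rw [simplexChain, Equiv.symm_apply_apply] at h
  refine (congrArg p ?_).mp h
  refine (Finsupp.smul_single k s (1 : ℤ)).trans ?_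
  rw [smul_eq_mul, mul_one]

end SingularChains

section HomologyClasses

variable {K L : ChainComplex (ModuleCat.{0} ℤ) ℕ} {n : ℕ}

lemma exists_iCycles_eq (z : K.X n) (hz : ∀ j, K.d n j z = 0) :
    ∃ x : K.cycles n, K.iCycles n x = z := by
  have hk : ModuleCat.ofHom (LinearMap.toSpanSingleton ℤ (K.X n) z) ≫
      K.d n ((ComplexShape.down ℕ).next n) = 0 := by
    ext
    simp [hz]
  refine ⟨K.liftCycles _ _ rfl hk (1 : ℤ), ?_⟩
  rw [← ConcreteCategory.comp_apply, HomologicalComplex.liftCycles_i]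
  exact LinearMap.toSpanSingleton_apply_one ℤ (K.X n) z

lemma homologyπ_eq_zero_iff (x : K.cycles n) :
    K.homologyπ n x = 0 ↔ ∃ c : K.X (n + 1), K.d (n + 1) n c = K.iCycles n x := by
  have hex := ShortComplex.exact_of_g_is_cokernel
    (ShortComplex.mk _ _ (K.toCycles_comp_homologyπ (n + 1) n))
    (K.homologyIsCokernel (n + 1) n (by simp))
  rw [ShortComplex.moduleCat_exact_iff] at hex
  have hinj : Function.Injective (K.iCycles n) :=
    (ModuleCat.mono_iff_injective _).1 inferInstance
  constructor
  · intro h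
    obtain ⟨c, hc⟩ := hex x h
    refine ⟨c, ?_⟩
    rw [← K.toCycles_i (n + 1) n, ConcreteCategory.comp_apply]
    exact congrArg _ hc
  · rintro ⟨c, hc⟩
    rw [← K.toCycles_i (n + 1) n, ConcreteCategory.comp_apply] at hc
    rw [← hinj hc, ← ConcreteCategory.comp_apply, K.toCycles_comp_homologyπ]
    rfl

lemma homologyMap_homologyπ (φ : K ⟶ L) (x : K.cycles n) :
    HomologicalComplex.homologyMap φ n (K.homologyπ n x) =
      L.homologyπ n (HomologicalComplex.cyclesMap φ n x) := by
  rw [← ConcreteCategory.comp_apply, HomologicalComplex.homologyπ_naturality,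
    ConcreteCategory.comp_apply]

lemma iCycles_cyclesMap (φ : K ⟶ L) (x : K.cycles n) :
    L.iCycles n (HomologicalComplex.cyclesMap φ n x) = φ.f n (K.iCycles n x) := by
  rw [← ConcreteCategory.comp_apply, HomologicalComplex.cyclesMap_i,
    ConcreteCategory.comp_apply]

lemma homologyMap_homologyπ_eq_zero_iff (φ : K ⟶ L) (x : K.cycles n) :
    HomologicalComplex.homologyMap φ n (K.homologyπ n x) = 0 ↔
      ∃ c : L.X (n + 1), L.d (n + 1) n c = φ.f n (K.iCycles n x) := by
  rw [homologyMap_homologyπ, homologyπ_eq_zero_iff, iCycles_cyclesMap]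
end HomologyClasses

section SimplexBoundary

/-- The boundary of the standard simplex. -/
abbrev SimplexBoundary (n : ℕ) : Type :=
  {t : stdSimplex ℝ (Fin (n + 2)) // ∃ i, t i = 0}

/-- The inclusion of the `i`-th face into the boundary of the standard simplex. -/
noncomputable def boundaryFace {n : ℕ} (i : Fin (n + 2)) :
    C(stdSimplex ℝ (Fin (n + 1)), SimplexBoundary n) :=
  ⟨fun x ↦ ⟨faceMap i x, i, by
    simp only [faceMap, ContinuousMap.coe_mk, stdSimplex.map_coe,
      FunOnFinite.linearMap_apply_apply]
    exact Finset.sum_eq_zero fun j hj ↦ absurd (Finset.mem_filter.1 hj).2 (i.succAbove_ne j)⟩,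
    (faceMap i).continuous.subtype_mk _⟩

/-- The singular chain given by the boundary of the standard simplex. -/
noncomputable def boundaryChain (n : ℕ) :
    (singularChains.obj (TopCat.of (SimplexBoundary n))).X n :=
  ∑ i : Fin (n + 2), (-1 : ℤ) ^ (i : ℕ) • simplexChain (boundaryFace i)

variable {X Y : Type} [TopologicalSpace X] [TopologicalSpace Y] {n : ℕ}

/-- The map of singular chain complexes induced by a continuous map. -/
noncomputable abbrev chainMap (f : C(X, Y)) :
    singularChains.obj (TopCat.of X) ⟶ singularChains.obj (TopCat.of Y) :=
  singularChains.map (X := TopCat.of X) (Y := TopCat.of Y) (TopCat.ofHom f)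

lemma chainMap_injective (f : C(X, Y)) (hf : Function.Injective f) :
    Function.Injective ((chainMap f).f n) := by
  refine Finsupp.mapDomain_injective fun a b h ↦ ?_
  apply (TopCat.toSSetObjEquiv (TopCat.of X) (Opposite.op (SimplexCategory.mk n))).injective
  ext x
  have h' := congrArg (TopCat.toSSetObjEquiv (TopCat.of Y) (Opposite.op (SimplexCategory.mk n))) h
  exact hf (DFunLike.congr_fun h' x)

lemma chainMap_boundaryChain (f : C(SimplexBoundary n, Y)) :
    (chainMap f).f n (boundaryChain n) =
      ∑ i : Fin (n + 2), (-1 : ℤ) ^ (i : ℕ) • simplexChain (f.comp (boundaryFace i)) := by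
  rw [boundaryChain, map_sum]
  refine Finset.sum_congr rfl fun i _ ↦ ?_
  rw [map_zsmul, map_simplexChain]

lemma d_boundaryChain (j : ℕ) :
    (singularChains.obj (TopCat.of (SimplexBoundary n))).d n j (boundaryChain n) = 0 := by
  let f : C(SimplexBoundary n, stdSimplex ℝ (Fin (n + 2))) := ⟨Subtype.val, continuous_subtype_val⟩
  apply chainMap_injective f Subtype.val_injective
  rw [map_zero, ← ConcreteCategory.comp_apply, ← (chainMap f).comm, ConcreteCategory.comp_apply,
    chainMap_boundaryChain]
  have h := d_simplexChain (ContinuousMap.id (stdSimplex ℝ (Fin (n + 2))))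
  refine (congrArg _ h.symm).trans ?_
  rw [← ConcreteCategory.comp_apply, HomologicalComplex.d_comp_d]
  rfl

lemma exists_chainEval_d_eq_zero {L : Y → ℕ} {V : Fin (n + 2) → Set Y}
    (hL : ∀ y, L y ≤ n + 1) (hV : ∀ i, IsOpen (V i)) (hcover : ∀ y, ∃ i, y ∈ V i)
    (hVL : ∀ i, ∀ y ∈ V i, L y ≠ i) (c : (singularChains.obj (TopCat.of Y)).X (n + 1)) :
    ∃ N₀, ∀ N ≥ N₀, chainEval (labelCount L N)
      ((singularChains.obj (TopCat.of Y)).d (n + 1) n c) = 0 := by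
  induction c using singularChains_induction with
  | h0 => exact ⟨0, fun N _ ↦ by rw [map_zero, map_zero]⟩
  | hadd a b ha hb =>
    obtain ⟨A, hA⟩ := ha
    obtain ⟨B, hB⟩ := hb
    refine ⟨max A B, fun N hN ↦ ?_⟩
    rw [map_add, map_add, hA N (le_of_max_le_left hN), hB N (le_of_max_le_right hN), add_zero]
  | hsmul k a ha =>
    obtain ⟨A, hA⟩ := ha
    refine ⟨A, fun N hN ↦ ?_⟩
    rw [map_zsmul, map_zsmul, hA N hN, smul_zero]
  | hσ τ =>
    obtain ⟨A, hA⟩ := exists_sum_labelCount_eq_zero hL hV hcover hVL τ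
    refine ⟨A, fun N hN ↦ ?_⟩
    rw [d_simplexChain, map_sum]
    refine Eq.trans (Finset.sum_congr rfl fun i _ ↦ ?_) (hA N hN)
    rw [map_zsmul, chainEval_simplexChain, smul_eq_mul]

/-- A continuous map is nonzero on reduced homology in degree `n` if a labelling of its target by
`0, …, n + 1`, for which locally one label is missing, pulls back to a Sperner labelling of the
boundary of a simplex mapped to its source. -/
theorem shMapNontrivial_of_labelling (κ : C(SimplexBoundary n, X)) (F : C(X, Y)) (L : Y → ℕ)
    (V : Fin (n + 2) → Set Y) (hL : ∀ y, L y ≤ n + 1) (hV : ∀ i, IsOpen (V i))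
    (hcover : ∀ y, ∃ i, y ∈ V i) (hVL : ∀ i, ∀ y ∈ V i, L y ≠ i)
    (hκ : ∀ (t : SimplexBoundary n) (i : Fin (n + 2)), t.1 i = 0 → L (F (κ t)) ≠ i) :
    SHmapNontrivial n F := by
  obtain ⟨x, hx⟩ := exists_iCycles_eq (boundaryChain n) d_boundaryChain
  refine ⟨(singularChains.obj _).homologyπ n (HomologicalComplex.cyclesMap (chainMap κ) n x),
    ?_, fun h0 ↦ ?_⟩
  · refine (homologyMap_homologyπ_eq_zero_iff (chainMap _) _).2
      ⟨simplexChain (ContinuousMap.const _ PUnit.unit), ?_⟩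
    rw [iCycles_cyclesMap, hx, chainMap_boundaryChain, d_simplexChain, map_sum]
    refine Finset.sum_congr rfl fun i _ ↦ ?_
    rw [map_zsmul, map_simplexChain]
    rfl
  · obtain ⟨c, hc⟩ := (homologyMap_homologyπ_eq_zero_iff (chainMap F) _).1 h0
    rw [iCycles_cyclesMap, hx, chainMap_boundaryChain, map_sum] at hc
    obtain ⟨N, hN⟩ := exists_chainEval_d_eq_zero hL hV hcover hVL c
    have h1 := hN N le_rfl
    rw [hc, map_sum] at h1
    classical
    refine sum_labelCount_ne_zero (L := L) N
      (l := fun x ↦ if hx : x ∈ stdSimplex ℝ (Fin (n + 2)) then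
        (if ht : ∃ i, x i = 0 then L (F (κ ⟨⟨x, hx⟩, ht⟩)) else 0) else 0)
      (σ := fun i ↦ F.comp (κ.comp (boundaryFace i))) (fun i x ↦ ?_) (fun x hx ↦ ?_)
      (fun x hx i hi ↦ ?_) (Eq.trans (Finset.sum_congr rfl fun i _ ↦ ?_) h1)
    · have h1 : ⇑(faceMap i x) ∈ stdSimplex ℝ (Fin (n + 2)) := (faceMap i x).2
      have h2 : ∃ j, faceMap i x j = 0 := (boundaryFace i x).2
      rw [dif_pos h1, dif_pos h2]
      rfl
    · split_ifs
      exacts [hL _, Nat.zero_le _]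
    · have ht : ∃ i, x i = 0 := ⟨i, hi⟩
      rw [dif_pos hx, dif_pos ht]
      exact hκ ⟨⟨x, hx⟩, ht⟩ i hi
    · rw [map_zsmul, map_zsmul, map_simplexChain, chainEval_simplexChain, smul_eq_mul]

end SimplexBoundary

section Stadium

variable {n : ℕ}

open Classical in
/-- The smallest positive index of a positive coordinate, or `0` if there is none. -/
noncomputable def posLabel (y : EuclideanSpace ℝ (Fin (n + 2))) : ℕ :=
  if h : ∃ k : ℕ, 0 < k ∧ ∃ hk : k < n + 2, 0 < y ⟨k, hk⟩ then Nat.find h else 0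

lemma posLabel_le (y : EuclideanSpace ℝ (Fin (n + 2))) : posLabel y ≤ n + 1 := by
  unfold posLabel
  split_ifs with h
  · obtain ⟨k, hk, hk', hy⟩ := h
    exact (Nat.find_min' _ ⟨hk, hk', hy⟩).trans (by omega)
  · exact Nat.zero_le _

lemma posLabel_ne {y : EuclideanSpace ℝ (Fin (n + 2))} {j : Fin (n + 2)} (hj : j ≠ 0)
    (hy : y j ≤ 0) : posLabel y ≠ j := by
  unfold posLabel
  split_ifs with h
  · intro hf
    obtain ⟨-, hk, hpos⟩ := Nat.find_spec h
    have hjk : j = ⟨Nat.find h, hk⟩ := Fin.ext hf.symm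
    exact absurd hpos (by rw [← hjk]; exact hy.not_gt)
  · exact fun h0 ↦ hj (Fin.ext h0.symm)

lemma posLabel_pos {y : EuclideanSpace ℝ (Fin (n + 2))} {j : Fin (n + 2)} (hj : j ≠ 0)
    (hy : 0 < y j) : 0 < posLabel y := by
  have h : ∃ k : ℕ, 0 < k ∧ ∃ hk : k < n + 2, 0 < y ⟨k, hk⟩ :=
    ⟨j, Fin.pos_iff_ne_zero.2 hj, j.2, hy⟩
  rw [posLabel, dif_pos h]
  exact (Nat.find_spec h).1

lemma posLabel_le_of_pos {y : EuclideanSpace ℝ (Fin (n + 2))} {j : Fin (n + 2)} (hj : j ≠ 0)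
    (hy : 0 < y j) : posLabel y ≤ j := by
  have h : ∃ k : ℕ, 0 < k ∧ ∃ hk : k < n + 2, 0 < y ⟨k, hk⟩ :=
    ⟨j, Fin.pos_iff_ne_zero.2 hj, j.2, hy⟩
  rw [posLabel, dif_pos h]
  exact Nat.find_min' _ ⟨Fin.pos_iff_ne_zero.2 hj, j.2, hy⟩

/-- For each `i`, an open set of points whose label is not `i`. -/
def posLabelAvoid (i : Fin (n + 2)) : Set (EuclideanSpace ℝ (Fin (n + 2))) :=
  if i = 0 then {y | ∃ j ≠ 0, 0 < y j} else {y | y i < 0}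

lemma isOpen_posLabelAvoid (i : Fin (n + 2)) : IsOpen (posLabelAvoid i) := by
  unfold posLabelAvoid
  split_ifs
  · simp only [Set.ofPred_exists, ← exists_prop]
    exact isOpen_iUnion fun j ↦ isOpen_iUnion fun _ ↦
      isOpen_lt continuous_const (by fun_prop)
  · exact isOpen_lt (by fun_prop) continuous_const

lemma posLabel_ne_of_mem_avoid {i : Fin (n + 2)} {y : EuclideanSpace ℝ (Fin (n + 2))}
    (hy : y ∈ posLabelAvoid i) : posLabel y ≠ i := by
  unfold posLabelAvoid at hy
  split_ifs at hy with hi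
  · obtain ⟨j, hj, hyj⟩ := hy
    rw [hi]
    exact (posLabel_pos hj hyj).ne'
  · exact posLabel_ne hi (le_of_lt hy)

lemma exists_mem_posLabelAvoid {y : EuclideanSpace ℝ (Fin (n + 2))}
    (hy : ∃ j ≠ 0, y j ≠ 0) : ∃ i, y ∈ posLabelAvoid i := by
  obtain ⟨j, hj, hyj⟩ := hy
  rcases hyj.lt_or_gt with h | h
  · exact ⟨j, by rw [posLabelAvoid, if_neg hj]; exact h⟩
  · exact ⟨0, by rw [posLabelAvoid, if_pos rfl]; exact ⟨j, hj, h⟩⟩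

lemma exists_ne_zero_of_notMem_axisSlice {y : EuclideanSpace ℝ (Fin (n + 2))}
    (hy : y ∈ openCube (n + 2) \ axisSlice (n + 2)) : ∃ j ≠ 0, y j ≠ 0 := by
  by_contra! h
  exact hy.2 fun i ↦ ⟨fun _ ↦ hy.1 i, fun hi ↦ h i (Fin.pos_iff_ne_zero.1 hi)⟩

lemma midNorm_eq_mul {c : ℝ} (hc : 0 ≤ c) {x y : EuclideanSpace ℝ (Fin (n + 2))}
    (h : ∀ j : Fin (n + 2), j ≠ 0 → j ≠ Fin.last (n + 1) → y j = c * x j) :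
    midNorm (n + 2) y = c * midNorm (n + 2) x := by
  rw [midNorm, midNorm, ← Real.sqrt_sq hc, ← Real.sqrt_mul (sq_nonneg c), Finset.mul_sum]
  refine congrArg Real.sqrt ?_
  refine Finset.sum_congr rfl fun i _ ↦ ?_
  split_ifs with hi
  · rw [h i (Fin.pos_iff_ne_zero.1 hi.1) (fun hl ↦ by simp [hl] at hi), mul_pow]
  · rw [mul_zero]

lemma abs_le_midNorm (x : EuclideanSpace ℝ (Fin (n + 2))) {j : Fin (n + 2)} (h0 : j ≠ 0)
    (hl : j ≠ Fin.last (n + 1)) : |x j| ≤ midNorm (n + 2) x := by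
  have hj : 0 < (j : ℕ) ∧ (j : ℕ) + 1 < n + 2 :=
    ⟨Fin.pos_iff_ne_zero.2 h0, by have := Fin.val_lt_last hl; omega⟩
  refine Real.abs_le_sqrt ?_
  refine (if_pos hj).symm.le.trans (Finset.single_le_sum
    (f := fun i : Fin (n + 2) ↦ if 0 < (i : ℕ) ∧ (i : ℕ) + 1 < n + 2 then x i ^ 2 else 0)
    (fun i _ ↦ ?_) (Finset.mem_univ j))
  beta_reduce
  split_ifs
  exacts [sq_nonneg _, le_rfl]

lemma midNorm_eq_zero {x : EuclideanSpace ℝ (Fin (n + 2))}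
    (h : ∀ j : Fin (n + 2), j ≠ 0 → j ≠ Fin.last (n + 1) → x j = 0) : midNorm (n + 2) x = 0 := by
  have h' := midNorm_eq_mul le_rfl (x := 0) (y := x) fun j h0 hl ↦ by rw [h j h0 hl, zero_mul]
  rwa [zero_mul] at h'

lemma continuous_midNorm (m : ℕ) : Continuous (midNorm m) := by
  unfold midNorm
  refine Real.continuous_sqrt.comp (continuous_finsetSum _ fun i _ ↦ ?_)
  split_ifs <;> fun_prop

/-- The difference of the extreme barycentric coordinates. -/
def extremeDiff (t : Fin (n + 2) → ℝ) : ℝ := t 0 - t (Fin.last (n + 1))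

/-- The barycentric coordinates, shifted by the smaller one of the extreme ones. -/
noncomputable def shiftedCoords (t : Fin (n + 2) → ℝ) : EuclideanSpace ℝ (Fin (n + 2)) :=
  WithLp.toLp 2 fun j ↦ t j - min (t 0) (t (Fin.last (n + 1)))

/-- A gauge on the standard simplex which vanishes only at the barycenter. -/
noncomputable def simplexGauge (t : Fin (n + 2) → ℝ) : ℝ :=
  max |extremeDiff t| (midNorm (n + 2) (shiftedCoords t))

lemma simplexGauge_pos (t : SimplexBoundary n) : 0 < simplexGauge (t.1 : Fin (n + 2) → ℝ) := by
  obtain ⟨t, i, hi⟩ := t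
  by_contra! h
  have h1 := (le_max_left _ _).trans h
  have h2 := (le_max_right _ _).trans h
  have hd : t 0 = t (Fin.last (n + 1)) := sub_eq_zero.1 (abs_nonpos_iff.1 h1)
  have hall : ∀ j, t j = t 0 := fun j ↦ by
    by_cases h0 : j = 0
    · rw [h0]
    by_cases hl : j = Fin.last (n + 1)
    · rw [hl, hd]
    have h3 := abs_nonpos_iff.1 ((abs_le_midNorm _ h0 hl).trans h2)
    simp only [shiftedCoords, ← hd, min_self] at h3
    exact sub_eq_zero.1 h3
  have hz : ∀ j, t j = 0 := fun j ↦ by rw [hall j, ← hall i, hi]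
  have := t.2.2
  exact one_ne_zero (this.symm.trans (Finset.sum_eq_zero fun j _ ↦ hz j))

/-- The radial projection of the boundary of the simplex to the boundary of the stadium. -/
noncomputable def stadiumPoint (s₁ s₂ ε : ℝ) (t : Fin (n + 2) → ℝ) :
    EuclideanSpace ℝ (Fin (n + 2)) :=
  WithLp.toLp 2 fun j ↦
    if j = 0 then
      (s₂ * max (extremeDiff t) 0 + s₁ * max (-extremeDiff t) 0) / simplexGauge t
    else if j = Fin.last (n + 1) then 0
    else ε / simplexGauge t * shiftedCoords t j

lemma continuous_stadiumPoint (s₁ s₂ ε : ℝ) :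
    Continuous fun t : SimplexBoundary n ↦ stadiumPoint s₁ s₂ ε (t.1 : Fin (n + 2) → ℝ) := by
  have hcoe : Continuous fun t : SimplexBoundary n ↦ (⇑t.1 : Fin (n + 2) → ℝ) :=
    continuous_subtype_val.comp continuous_subtype_val
  have hc : ∀ j, Continuous fun t : SimplexBoundary n ↦ t.1 j := fun j ↦
    (continuous_apply j).comp hcoe
  have hd : Continuous fun t : SimplexBoundary n ↦ extremeDiff ⇑t.1 := (hc _).sub (hc _)
  have hs : Continuous fun t : SimplexBoundary n ↦ shiftedCoords ⇑t.1 :=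
    (PiLp.continuous_toLp 2 _).comp
      (continuous_pi fun j ↦ (hc j).sub ((hc _).min (hc _)))
  have hg : Continuous fun t : SimplexBoundary n ↦ simplexGauge ⇑t.1 :=
    hd.abs.max ((continuous_midNorm _).comp hs)
  refine (PiLp.continuous_toLp 2 _).comp (continuous_pi fun j ↦ ?_)
  have hne : ∀ t : SimplexBoundary n, simplexGauge ⇑t.1 ≠ 0 := fun t ↦ (simplexGauge_pos t).ne'
  split_ifs
  · exact Continuous.div (by fun_prop) hg hne
  · exact continuous_const
  · exact (continuous_const.div hg hne).mul (by fun_prop)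

lemma stadiumPoint_zero (s₁ s₂ ε : ℝ) (t : Fin (n + 2) → ℝ) :
    stadiumPoint s₁ s₂ ε t 0 =
      (s₂ * max (extremeDiff t) 0 + s₁ * max (-extremeDiff t) 0) / simplexGauge t := by
  simp [stadiumPoint]

lemma stadiumPoint_last (s₁ s₂ ε : ℝ) (t : Fin (n + 2) → ℝ) :
    stadiumPoint s₁ s₂ ε t (Fin.last (n + 1)) = 0 := by
  simp [stadiumPoint]

lemma stadiumPoint_mid (s₁ s₂ ε : ℝ) (t : Fin (n + 2) → ℝ) {j : Fin (n + 2)} (h0 : j ≠ 0)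
    (hl : j ≠ Fin.last (n + 1)) :
    stadiumPoint s₁ s₂ ε t j = ε / simplexGauge t * shiftedCoords t j := by
  simp [stadiumPoint, h0, hl]

lemma midNorm_stadiumPoint (s₁ s₂ : ℝ) {ε : ℝ} (hε : 0 ≤ ε) (t : SimplexBoundary n) :
    midNorm (n + 2) (stadiumPoint s₁ s₂ ε t.1) =
      ε / simplexGauge t.1 * midNorm (n + 2) (shiftedCoords t.1) :=
  midNorm_eq_mul (div_nonneg hε (simplexGauge_pos t).le) fun _ h0 hl ↦
    stadiumPoint_mid _ _ _ _ h0 hl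

lemma simplexGauge_eq_abs {t : Fin (n + 2) → ℝ}
    (hmin : min (t 0) (t (Fin.last (n + 1))) = 0)
    (ht : ∀ j : Fin (n + 2), j ≠ 0 → j ≠ Fin.last (n + 1) → t j = 0) :
    simplexGauge t = |extremeDiff t| := by
  have h : midNorm (n + 2) (shiftedCoords t) = 0 := midNorm_eq_zero fun j h0 hl ↦ by
    simp [shiftedCoords, hmin, ht j h0 hl]
  rw [simplexGauge, h, max_eq_left (abs_nonneg _)]

lemma add_last_eq_one (t : stdSimplex ℝ (Fin (n + 2)))
    (ht : ∀ j : Fin (n + 2), j ≠ 0 → j ≠ Fin.last (n + 1) → t j = 0) :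
    t 0 + t (Fin.last (n + 1)) = 1 := by
  have hsum : ∑ j, t j = 1 := t.2.2
  rw [← hsum, Finset.sum_eq_add 0 (Fin.last (n + 1)) Fin.last_pos.ne
    (fun j _ hj ↦ ht j hj.1 hj.2) (by simp) (by simp)]

lemma stadiumPoint_eq_left (s₁ s₂ ε : ℝ) {t : stdSimplex ℝ (Fin (n + 2))} (h0 : t 0 = 0)
    (ht : ∀ j : Fin (n + 2), j ≠ 0 → j ≠ Fin.last (n + 1) → t j = 0) :
    stadiumPoint s₁ s₂ ε t 0 = s₁ := by
  have hl := add_last_eq_one t ht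
  rw [h0, zero_add] at hl
  rw [stadiumPoint_zero, simplexGauge_eq_abs (by simp [h0, hl]) ht]
  simp [extremeDiff, h0, hl]

lemma stadiumPoint_eq_right (s₁ s₂ ε : ℝ) {t : stdSimplex ℝ (Fin (n + 2))}
    (hl : t (Fin.last (n + 1)) = 0)
    (ht : ∀ j : Fin (n + 2), j ≠ 0 → j ≠ Fin.last (n + 1) → t j = 0) :
    stadiumPoint s₁ s₂ ε t 0 = s₂ := by
  have h0 := add_last_eq_one t ht
  rw [hl, add_zero] at h0
  rw [stadiumPoint_zero, simplexGauge_eq_abs (by simp [h0, hl]) ht]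
  simp [extremeDiff, h0, hl]

lemma stadiumPoint_mem {s₁ s₂ ε : ℝ} (hs₁ : s₁ < 0) (hs₂ : 0 < s₂) (hε : 0 ≤ ε)
    (t : SimplexBoundary n) :
    stadiumPoint s₁ s₂ ε t.1 ∈ stadiumBoundary (n + 2) (by omega) s₁ s₂ ε := by
  have hg := simplexGauge_pos t
  have hx : stadiumPoint s₁ s₂ ε t.1 ⟨0, by omega⟩ = _ := stadiumPoint_zero s₁ s₂ ε t.1
  have hmid := midNorm_stadiumPoint s₁ s₂ hε t
  have hda : |extremeDiff t.1| ≤ simplexGauge t.1 := le_max_left _ _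
  have hma : midNorm (n + 2) (shiftedCoords t.1) ≤ simplexGauge t.1 := le_max_right _ _
  rw [abs_le] at hda
  refine ⟨⟨?_, ?_, stadiumPoint_last _ _ _ _⟩, ?_⟩
  · rw [hx, Set.mem_Icc, le_div_iff₀ hg, div_le_iff₀ hg]
    rcases le_total 0 (extremeDiff t.1) with h | h
    · rw [max_eq_left h, max_eq_right (by linarith)]
      constructor <;> nlinarith
    · rw [max_eq_right h, max_eq_left (by linarith)]
      constructor <;> nlinarith
  · rw [hmid, div_mul_eq_mul_div, div_le_iff₀ hg]
    exact mul_le_mul_of_nonneg_left hma hε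
  · rcases max_choice |extremeDiff t.1| (midNorm (n + 2) (shiftedCoords t.1)) with h | h
    · change simplexGauge t.1 = _ at h
      rcases le_total 0 (extremeDiff t.1) with h' | h'
      · right; left
        rw [hx, max_eq_left h', max_eq_right (by linarith), h, abs_of_nonneg h', mul_zero, add_zero,
          mul_div_cancel_right₀]
        rw [abs_of_nonneg h'] at h
        rw [← h]
        exact hg.ne'
      · left
        rw [hx, max_eq_right h', max_eq_left (by linarith), h, abs_of_nonpos h', mul_zero, zero_add,
          mul_div_cancel_right₀]
        rw [abs_of_nonpos h'] at h
        rw [← h]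
        exact hg.ne'
    · change simplexGauge t.1 = _ at h
      right; right
      rw [hmid, ← h, div_mul_cancel₀ _ hg.ne']

end Stadium

/-- Let `m ≥ 2`, `s₁ < 0 < s₂` in `(-1,1)`, `ε ∈ (0,1)`, and let
`g : B₀ → (-1,1)` be continuous with `g > 0` on `{x₁ = s₁}` and `g < 0` on `{x₁ = s₂}`.
Then `h(x) = (x₁, …, x_{m-1}, g(x))` maps `S₀` into `(-1,1)ᵐ \ ((-1,1) × {0}^{m-1})` and
`h|_{S₀}` induces a nonzero homomorphism
`H̃_{m-2}(S₀) → H̃_{m-2}((-1,1)ᵐ \ ((-1,1) × {0}^{m-1}))` of reduced singular homology groups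
with `ℤ` coefficients. -/
theorem graph_on_stadium_nontrivial (m : ℕ) (hm : 2 ≤ m) (s₁ s₂ : ℝ)
    (hs₁ : s₁ ∈ Set.Ioo (-1 : ℝ) 1) (hs₂ : s₂ ∈ Set.Ioo (-1 : ℝ) 1)
    (hs₁0 : s₁ < 0) (hs₂0 : 0 < s₂) (ε : ℝ) (hε : ε ∈ Set.Ioo (0 : ℝ) 1)
    (g : C(stadiumBase m hm s₁ s₂ ε, ℝ))
    (hg : ∀ x : stadiumBase m hm s₁ s₂ ε, g x ∈ Set.Ioo (-1 : ℝ) 1)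
    (hgpos : ∀ x : stadiumBase m hm s₁ s₂ ε,
      (x : EuclideanSpace ℝ (Fin m)) ⟨0, by omega⟩ = s₁ → 0 < g x)
    (hgneg : ∀ x : stadiumBase m hm s₁ s₂ ε,
      (x : EuclideanSpace ℝ (Fin m)) ⟨0, by omega⟩ = s₂ → g x < 0)
    (h : C(stadiumBase m hm s₁ s₂ ε, EuclideanSpace ℝ (Fin m)))
    (hh : ∀ (x : stadiumBase m hm s₁ s₂ ε) (i : Fin m),
      h x i = if (i : ℕ) + 1 < m then (x : EuclideanSpace ℝ (Fin m)) i else g x) :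
    ∃ hmp : Set.MapsTo h
        {x : stadiumBase m hm s₁ s₂ ε |
          (x : EuclideanSpace ℝ (Fin m)) ∈ stadiumBoundary m hm s₁ s₂ ε}
        (openCube m \ axisSlice m),
      SHmapNontrivial (m - 2) (restrictCM h hmp) := by
  obtain ⟨n, rfl⟩ := Nat.exists_eq_add_of_le' hm
  have hlast : ∀ x, h x (Fin.last (n + 1)) = g x := fun x ↦ by
    rw [hh, if_neg (by simp)]
  have hne : ∀ x (j : Fin (n + 2)), j ≠ Fin.last (n + 1) → h x j = x.1 j := fun x j hj ↦ by
    rw [hh, if_pos]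
    have := Fin.val_lt_last hj
    omega
  have hmp : Set.MapsTo h {x : stadiumBase (n + 2) hm s₁ s₂ ε |
      (x : EuclideanSpace ℝ (Fin (n + 2))) ∈ stadiumBoundary (n + 2) hm s₁ s₂ ε}
      (openCube (n + 2) \ axisSlice (n + 2)) := by
    rintro x ⟨-, hx⟩
    refine ⟨fun j ↦ ?_, fun hax ↦ ?_⟩
    · by_cases hl : j = Fin.last (n + 1)
      · rw [hl, hlast]
        exact hg x
      rw [hne x j hl]
      by_cases h0 : j = 0
      · rw [h0]
        exact ⟨hs₁.1.trans_le x.2.1.1, x.2.1.2.trans_lt hs₂.2⟩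
      · exact abs_lt.1 (((abs_le_midNorm x.1 h0 hl).trans x.2.2.1).trans_lt hε.2)
    · have hg0 : g x = 0 := by
        rw [← hlast]
        exact (hax _).2 (by simp)
      rcases hx with hx | hx | hx
      · exact (hgpos x hx).ne' hg0
      · exact (hgneg x hx).ne hg0
      · refine hε.1.ne' (hx.symm.trans (midNorm_eq_zero fun j h0 hl ↦ ?_))
        rw [← hne x j hl]
        exact (hax j).2 (Fin.pos_iff_ne_zero.2 h0)
  refine ⟨hmp, ?_⟩
  have hmem := stadiumPoint_mem (n := n) hs₁0 hs₂0 hε.1.le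
  let κ : C(SimplexBoundary n, {x : stadiumBase (n + 2) hm s₁ s₂ ε |
      (x : EuclideanSpace ℝ (Fin (n + 2))) ∈ stadiumBoundary (n + 2) hm s₁ s₂ ε}) :=
    ⟨fun t ↦ ⟨⟨stadiumPoint s₁ s₂ ε t.1, (hmem t).1⟩, hmem t⟩,
      ((continuous_stadiumPoint s₁ s₂ ε).subtype_mk _).subtype_mk _⟩
  refine shMapNontrivial_of_labelling (n := n) κ (restrictCM h hmp) (fun y ↦ posLabel y.1)
    (fun i ↦ Subtype.val ⁻¹' posLabelAvoid i) (fun y ↦ posLabel_le _)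
    (fun i ↦ (isOpen_posLabelAvoid i).preimage continuous_subtype_val)
    (fun y ↦ exists_mem_posLabelAvoid (exists_ne_zero_of_notMem_axisSlice y.2))
    (fun i y hy ↦ posLabel_ne_of_mem_avoid hy) fun t i hi ↦ ?_
  change posLabel (h (κ t).1) ≠ i
  have hgauge := simplexGauge_pos t
  have hmid : ∀ j : Fin (n + 2), j ≠ 0 → j ≠ Fin.last (n + 1) →
      h (κ t).1 j = ε / simplexGauge t.1 * (t.1 j - min (t.1 0) (t.1 (Fin.last (n + 1)))) :=
    fun j h0 hl ↦ (hne _ j hl).trans (stadiumPoint_mid _ _ _ _ h0 hl)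
  have hnonneg : ∀ j, 0 ≤ t.1 j := t.1.2.1
  have hl0 : Fin.last (n + 1) ≠ 0 := (Fin.last_pos).ne'
  by_cases hi0 : i = 0
  · by_cases hex : ∃ j ≠ 0, 0 < h (κ t).1 j
    · obtain ⟨j, h0, hj⟩ := hex
      rw [hi0]
      exact (posLabel_pos h0 hj).ne'
    rw [hi0] at hi
    push Not at hex
    refine absurd (hex _ hl0) (not_le.2 ?_)
    rw [hlast]
    refine hgpos _ (stadiumPoint_eq_left s₁ s₂ ε hi fun j h0 hl ↦ ?_)
    have hj := hex j h0
    rw [hmid j h0 hl, hi, min_eq_left (hnonneg _), sub_zero] at hj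
    exact le_antisymm (nonpos_of_mul_nonpos_right hj (div_pos hε.1 hgauge)) (hnonneg j)
  by_cases hil : i = Fin.last (n + 1)
  · by_cases hex : ∃ j ≠ 0, j ≠ Fin.last (n + 1) ∧ 0 < h (κ t).1 j
    · obtain ⟨j, h0, hl, hj⟩ := hex
      rw [hil]
      exact ((posLabel_le_of_pos h0 hj).trans_lt (Fin.val_lt_last hl)).ne
    rw [hil] at hi
    push Not at hex
    refine posLabel_ne hi0 ?_
    rw [hil, hlast]
    refine (hgneg _ (stadiumPoint_eq_right s₁ s₂ ε hi fun j h0 hl ↦ ?_)).le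
    have hj := hex j h0 hl
    rw [hmid j h0 hl, hi, min_eq_right (hnonneg _), sub_zero] at hj
    exact le_antisymm (nonpos_of_mul_nonpos_right hj (div_pos hε.1 hgauge)) (hnonneg j)
  · refine posLabel_ne hi0 ?_
    rw [hmid i hi0 hil, hi, zero_sub]
    exact mul_nonpos_of_nonneg_of_nonpos (div_pos hε.1 hgauge).le
      (neg_nonpos.2 (le_min (hnonneg _) (hnonneg _)))
end
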